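/- arXiv:2502.02219 — 10 statements merged into one kernel-verified Lean document; each statement's English description precedes it below -/
import Mathlib

section
/- Let q be a prime power, let f1, f2, f3 ∈ F_q[X,Y,Z] satisfy f_i(0,0,0) = 0, and set d = max(deg f1, deg f2, deg f3). Assume q > 6.3·(d+1)^(13/3). If the polynomial F ∈ F_q[X1,...,X6] has a nonconstant factor G ∈ F_q[X1,...,X6] whose image in K[X1,...,X6], where K is an algebraic closure of F_q, is irreducible (i.e., the hypersurface S_{f1,f2,f3} contains an absolutely irreducible component defined over F_q), then the ovoid condition fails: there exist distinct triples (x1,y1,z1), (x2,y2,z2) ∈ F_q^3 with (x1-x2)(f3(x2,y2,z2)-f3(x1,y1,z1)) + (y1-y2)(f2(x2,y2,z2)-f2(x1,y1,z1)) + (z1-z2)(f1(x2,y2,z2)-f1(x1,y1,z1)) = 0, so O_7(f1,f2,f3) is not an ovoid of Q. -/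
open MvPolynomial

/-- The ovoid condition for `O_7(f1,f2,f3)` (Equation (3) of the paper): for all distinct
triples `(x1,y1,z1), (x2,y2,z2)` the bilinear pairing of the corresponding points of the
quadric is nonzero. -/
def ovoidCondition {F : Type*} [Field F] (f1 f2 f3 : F → F → F → F) : Prop :=
  ∀ x1 y1 z1 x2 y2 z2 : F, (x1, y1, z1) ≠ (x2, y2, z2) →
    (x1 - x2) * (f3 x2 y2 z2 - f3 x1 y1 z1) +
      (y1 - y2) * (f2 x2 y2 z2 - f2 x1 y1 z1) +
      (z1 - z2) * (f1 x2 y2 z2 - f1 x1 y1 z1) ≠ 0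

/-- The polynomial `F ∈ F_q[X1,...,X6]` (variables indexed `0,...,5`) defining the
hypersurface `S_{f1,f2,f3}` associated with `O_7(f1,f2,f3)`. -/
noncomputable def polyF {F : Type*} [CommRing F] (f1 f2 f3 : MvPolynomial (Fin 3) F) :
    MvPolynomial (Fin 6) F :=
  (X 0 - X 3) *
      (aeval ![(X 3 : MvPolynomial (Fin 6) F), X 4, X 5] f3 -
        aeval ![(X 0 : MvPolynomial (Fin 6) F), X 1, X 2] f3) +
    (X 1 - X 4) *
      (aeval ![(X 3 : MvPolynomial (Fin 6) F), X 4, X 5] f2 -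
        aeval ![(X 0 : MvPolynomial (Fin 6) F), X 1, X 2] f2) +
    (X 2 - X 5) *
      (aeval ![(X 3 : MvPolynomial (Fin 6) F), X 4, X 5] f1 -
        aeval ![(X 0 : MvPolynomial (Fin 6) F), X 1, X 2] f1)

section LinearCount
variable {κ E E' : Type*} [Field κ] [AddCommGroup E] [Module κ E] [AddCommGroup E'] [Module κ E']

/-- Imposing membership in a subspace of relative codimension at most `w` lowers the dimension
by at most `w`. -/
theorem finrank_le_finrank_inf_comap_add (φ : E →ₗ[κ] E') (V : Submodule κ E)
    [FiniteDimensional κ V] (W T : Submodule κ E') [FiniteDimensional κ W]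
    (h : V.map φ ≤ W ⊔ T) :
    Module.finrank κ V ≤
      Module.finrank κ (V ⊓ T.comap φ : Submodule κ E) + Module.finrank κ W := by
  let ψ : V →ₗ[κ] E' ⧸ T := T.mkQ ∘ₗ φ ∘ₗ V.subtype
  have hker : Module.finrank κ (LinearMap.ker ψ) =
      Module.finrank κ (V ⊓ T.comap φ : Submodule κ E) := by
    have : (LinearMap.ker ψ).map V.subtype = V ⊓ T.comap φ := by
      ext e
      simp only [Submodule.mem_map, LinearMap.mem_ker, Submodule.mem_inf, Submodule.mem_comap]
      constructor
      · rintro ⟨v, hv, rfl⟩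
        exact ⟨v.2, by simpa [ψ] using hv⟩
      · rintro ⟨hv, ht⟩
        exact ⟨⟨e, hv⟩, by simpa [ψ] using ht, rfl⟩
    rw [← this]
    exact LinearEquiv.finrank_eq (Submodule.equivMapOfInjective V.subtype V.subtype_injective _)
  have hrange : Module.finrank κ (LinearMap.range ψ) ≤ Module.finrank κ W := by
    have hle : LinearMap.range ψ ≤ W.map T.mkQ := by
      rintro _ ⟨v, rfl⟩
      obtain ⟨w, hw, t, ht, hwt⟩ := Submodule.mem_sup.1 (h ⟨v, v.2, rfl⟩)
      refine ⟨w, hw, ?_⟩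
      have : φ v = w + t := hwt.symm
      simp only [ψ, LinearMap.comp_apply, Submodule.subtype_apply, this, map_add]
      simpa using ht
    exact (Submodule.finrank_mono hle).trans (Submodule.finrank_map_le _ _)
  have := LinearMap.finrank_range_add_finrank_ker ψ
  omega

end LinearCount

namespace Polynomial
variable {S : Type*} [CommRing S]

theorem resultant_mem_of_coeff_mem (Fil : ℕ → AddSubgroup S) [SetLike.GradedMonoid Fil]
    {f g : S[X]} {m n a b : ℕ} (hf : ∀ i, f.coeff i ∈ Fil a) (hg : ∀ i, g.coeff i ∈ Fil b) :
    resultant f g m n ∈ Fil (n * a + m * b) := by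
  rw [resultant, Matrix.det_apply]
  refine sum_mem fun σ _ => ?_
  have key : ∏ i, sylvester f g m n (σ i) i ∈
      Fil (∑ i : Fin (m + n), Fin.addCases (fun _ => b) (fun _ => a) i) := by
    refine SetLike.prod_mem_graded _ _ _ fun i _ => ?_
    refine Fin.addCases (fun j => ?_) (fun j => ?_) i
    · simp only [sylvester, Matrix.of_apply, Fin.addCases_left]
      split_ifs
      exacts [hg _, zero_mem _]
    · simp only [sylvester, Matrix.of_apply, Fin.addCases_right]
      split_ifs
      exacts [hf _, zero_mem _]
  have hsum : (∑ i : Fin (m + n), Fin.addCases (fun _ => b) (fun _ => a) i) = n * a + m * b := by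
    rw [Fin.sum_univ_add]; simp [add_comm]
  rw [hsum] at key
  rcases Int.units_eq_one_or (Equiv.Perm.sign σ) with h | h <;> simp [h, key]

theorem resultant_ne_zero_of_irreducible [IsDomain S] [IsIntegrallyClosed S] {f h : S[X]}
    (hf : f.Monic) (hirr : Irreducible f) (h0 : h ≠ 0) (hdeg : h.natDegree < f.natDegree) :
    resultant f h ≠ 0 := by
  let K := FractionRing S
  have hinj : Function.Injective (algebraMap S K) := IsFractionRing.injective S K
  have hirr' : Irreducible (f.map (algebraMap S K)) :=
    (hf.irreducible_iff_irreducible_map_fraction_map).1 hirr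
  have hcop : IsCoprime (f.map (algebraMap S K)) (h.map (algebraMap S K)) := by
    refine (hirr'.coprime_iff_not_dvd).2 fun hd => ?_
    have := natDegree_le_of_dvd hd ((Polynomial.map_ne_zero_iff hinj).2 h0)
    rw [natDegree_map_eq_of_injective hinj, natDegree_map_eq_of_injective hinj] at this
    omega
  have := resultant_ne_zero _ _ hcop
  rw [natDegree_map_eq_of_injective hinj, natDegree_map_eq_of_injective hinj,
    resultant_map_map] at this
  exact fun h => this (by rw [h, map_zero])

end Polynomial

namespace Polynomial
open scoped Polynomial
variable {κ A : Type*} [Field κ] [CommRing A] [Algebra κ A]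

theorem exists_aeval_sub_aeval_eq_mul (F : Submodule κ A) (h1 : 1 ≤ F) {x T : A} (hx : x ∈ F)
    (hT : T ∈ F) (p : κ[X]) :
    ∃ r ∈ F ^ (p.natDegree - 1), aeval x p - aeval T p = (x - T) * r := by
  refine ⟨∑ k ∈ Finset.range (p.natDegree + 1),
    p.coeff k • ∑ s ∈ Finset.range k, x ^ s * T ^ (k - 1 - s), ?_, ?_⟩
  · refine sum_mem fun k hk => Submodule.smul_mem _ _ (sum_mem fun s hs => ?_)
    rw [Finset.mem_range] at hk hs
    refine pow_le_pow_right₀ h1 (by omega : s + (k - 1 - s) ≤ p.natDegree - 1) ?_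
    rw [pow_add]
    exact Submodule.mul_mem_mul (Submodule.pow_mem_pow _ hx _) (Submodule.pow_mem_pow _ hT _)
  · rw [aeval_eq_sum_range, aeval_eq_sum_range, ← Finset.sum_sub_distrib, Finset.mul_sum]
    refine Finset.sum_congr rfl fun k _ => ?_
    rw [← smul_sub, mul_smul_comm, mul_comm, geom_sum₂_mul]

/-- The span of the words of length at most `n` in `x, y, T, Z` is the `n`-th power of this. -/
def wordSpan (κ : Type*) {A : Type*} [Field κ] [CommRing A] [Algebra κ A] (x y T Z : A) :
    Submodule κ A :=
  Submodule.span κ {1, x, y, T, Z}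

section Words
variable (x y T Z : A)

theorem one_le_wordSpan : 1 ≤ wordSpan κ x y T Z :=
  Submodule.one_le.2 (Submodule.subset_span (by simp))

theorem wordSpan_pow_le (n : ℕ) : wordSpan κ x y T Z ^ n ≤ Submodule.span κ
    {m | ∃ a b c e, a + b + c + e ≤ n ∧ m = x ^ a * y ^ b * T ^ c * Z ^ e} := by
  induction n with
  | zero =>
    rw [pow_zero, Submodule.one_le]
    exact Submodule.subset_span ⟨0, 0, 0, 0, by simp⟩
  | succ n ih =>
    rw [pow_succ]
    refine (mul_le_mul_left ih _).trans ?_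
    rw [wordSpan, Submodule.span_mul_span, Submodule.span_le]
    rintro _ ⟨_, ⟨a, b, c, e, h, rfl⟩, s, hs, rfl⟩
    refine Submodule.subset_span ?_
    rcases hs with rfl | rfl | rfl | rfl | rfl
    · exact ⟨a, b, c, e, by omega, by simp⟩
    · exact ⟨a + 1, b, c, e, by omega, by simp only; ring⟩
    · exact ⟨a, b + 1, c, e, by omega, by simp only; ring⟩
    · exact ⟨a, b, c + 1, e, by omega, by simp only; ring⟩
    · exact ⟨a, b, c, e + 1, by omega, by simp only; ring⟩

variable {x y T Z}

theorem mul_mem_wordSpan_pow {m n k : ℕ} {a b : A} (ha : a ∈ wordSpan κ x y T Z ^ m)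
    (hb : b ∈ wordSpan κ x y T Z ^ n) (h : m + n ≤ k) : a * b ∈ wordSpan κ x y T Z ^ k :=
  pow_le_pow_right₀ (one_le_wordSpan x y T Z) h (by
    rw [pow_add]; exact Submodule.mul_mem_mul ha hb)

theorem monomial_mem_wordSpan_pow {a b c e n : ℕ} (h : a + b + c + e ≤ n) :
    x ^ a * y ^ b * T ^ c * Z ^ e ∈ wordSpan κ x y T Z ^ n := by
  have key : ∀ s ∈ ({1, x, y, T, Z} : Set A), ∀ k, s ^ k ∈ wordSpan κ x y T Z ^ k :=
    fun s hs k => Submodule.pow_mem_pow _ (Submodule.subset_span hs) _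
  exact mul_mem_wordSpan_pow (mul_mem_wordSpan_pow (mul_mem_wordSpan_pow (key x (by simp) a)
    (key y (by simp) b) le_rfl) (key T (by simp) c) le_rfl) (key Z (by simp) e) h

/-- Those `Q` for which `(Z - y) * Q` is again `(T - x)` times a word of length at most `n`. -/
def liftable (κ : Type*) {A : Type*} [Field κ] [CommRing A] [Algebra κ A] (x y T Z : A) (n : ℕ) :
    Submodule κ A :=
  ((wordSpan κ x y T Z ^ n).map (LinearMap.mulLeft κ (T - x))).comap
    (LinearMap.mulLeft κ (Z - y))

theorem mem_liftable {n : ℕ} {Q : A} : Q ∈ liftable κ x y T Z n ↔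
    ∃ Q' ∈ wordSpan κ x y T Z ^ n, (T - x) * Q' = (Z - y) * Q := by
  simp [liftable]

/-- The span of the reduced words. -/
def reducedSpan (κ : Type*) {A : Type*} [Field κ] [CommRing A] [Algebra κ A] (x y Z : A)
    (d n : ℕ) : Submodule κ A :=
  Submodule.span κ (Set.range fun t : Fin (n + 1) × Fin d × Fin (d - 1) =>
    x ^ (t.1 : ℕ) * y ^ (t.2.1 : ℕ) * Z ^ (t.2.2 : ℕ))

instance (d n : ℕ) : FiniteDimensional κ (reducedSpan κ x y Z d n) :=
  FiniteDimensional.span_of_finite κ (Set.finite_range _)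

theorem finrank_reducedSpan_le (d n : ℕ) :
    Module.finrank κ (reducedSpan κ x y Z d n) ≤ (n + 1) * (d * (d - 1)) := by
  refine (finrank_range_le_card (R := κ) _).trans ?_
  simp

end Words

section Reduction
variable {x y T Z : A} {d : ℕ} {g : ℕ → κ[X]}

theorem pow_mul_pow_mul_mem (hg : ∀ j < d, (g j).natDegree + j ≤ d)
    (hxy : y ^ d = -∑ j ∈ Finset.range d, aeval x (g j) * y ^ j) {W : Submodule κ A} {n : ℕ}
    {z : A} (hW : ∀ k, ∀ i < d, k + i ≤ n → x ^ k * y ^ i * z ∈ W) (b : ℕ) :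
    ∀ a, a + b ≤ n → x ^ a * y ^ b * z ∈ W := by
  induction b using Nat.strong_induction_on with
  | _ b ih =>
    intro a h
    rcases lt_or_ge b d with hb | hb
    · exact hW a b hb h
    · obtain ⟨b, rfl⟩ := Nat.exists_eq_add_of_le' hb
      rw [pow_add, hxy, mul_neg, mul_neg, neg_mul, Finset.mul_sum, Finset.mul_sum,
        Finset.sum_mul]
      refine neg_mem (sum_mem fun j hj => ?_)
      rw [Finset.mem_range] at hj
      have hgj := hg j hj
      rw [aeval_eq_sum_range, Finset.sum_mul, Finset.mul_sum, Finset.mul_sum, Finset.sum_mul]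
      refine sum_mem fun k hk => ?_
      rw [Finset.mem_range] at hk
      have := ih (b + j) (by omega) (a + k) (by omega)
      convert Submodule.smul_mem _ ((g j).coeff k) this using 1
      simp only [Algebra.smul_def]
      ring

theorem mem_reducedSpan (hg : ∀ j < d, (g j).natDegree + j ≤ d)
    (hxy : y ^ d = -∑ j ∈ Finset.range d, aeval x (g j) * y ^ j) {n e : ℕ} (he : e < d - 1)
    (a b : ℕ) (h : a + b + e ≤ n) : x ^ a * y ^ b * Z ^ e ∈ reducedSpan κ x y Z d n :=
  pow_mul_pow_mul_mem hg hxy (W := reducedSpan κ x y Z d n) (n := n - e)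
    (fun k i hi hki => Submodule.subset_span ⟨(⟨k, by omega⟩, ⟨i, hi⟩, ⟨e, he⟩), rfl⟩) b a (by omega)

theorem exists_sub_mul_eq (hd : 1 ≤ d) (hg : ∀ j < d, (g j).natDegree + j ≤ d)
    (hxy : y ^ d = -∑ j ∈ Finset.range d, aeval x (g j) * y ^ j)
    (hTZ : Z ^ d = -∑ j ∈ Finset.range d, aeval T (g j) * Z ^ j) :
    ∃ l ∈ Submodule.span κ
        {m | ∃ k t s, k + t + s ≤ d - 1 ∧ s < d - 1 ∧ m = x ^ k * y ^ t * Z ^ s},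
      Z ^ (d - 1) + l ∈ liftable κ x y T Z (d - 1) := by
  let Γ : ℕ → A := fun j => ∑ s ∈ Finset.range j, Z ^ s * y ^ (j - 1 - s)
  have hΓ : ∀ j, (Z - y) * Γ j = Z ^ j - y ^ j := fun j => by
    rw [mul_comm]; exact geom_sum₂_mul Z y j
  choose r hr hr' using fun j => exists_aeval_sub_aeval_eq_mul (wordSpan κ x y T Z)
    (one_le_wordSpan x y T Z) (x := x) (T := T) (Submodule.subset_span (by simp))
    (Submodule.subset_span (by simp)) (g j)
  refine ⟨Γ d - Z ^ (d - 1) + ∑ j ∈ Finset.range d, aeval x (g j) * Γ j,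
    add_mem ?_ (sum_mem fun j hj => ?_), ?_⟩
  · obtain ⟨d, rfl⟩ := Nat.exists_eq_add_of_le' hd
    simp only [Γ, Finset.sum_range_succ, Nat.add_sub_cancel, Nat.sub_self, pow_zero, mul_one,
      add_sub_cancel_right]
    refine sum_mem fun s hs => Submodule.subset_span ⟨0, d - s, s, ?_, ?_, ?_⟩
    · have := Finset.mem_range.1 hs; omega
    · exact Finset.mem_range.1 hs
    · ring
  · rw [Finset.mem_range] at hj
    have hgj := hg j hj
    simp only [Γ]
    rw [aeval_eq_sum_range, Finset.sum_mul_sum]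
    refine sum_mem fun k hk => sum_mem fun s hs => ?_
    rw [Finset.mem_range] at hk hs
    rw [smul_mul_assoc]
    refine Submodule.smul_mem _ _ (Submodule.subset_span
      ⟨k, j - 1 - s, s, by omega, by omega, by ring⟩)
  · rw [mem_liftable]
    refine ⟨-∑ j ∈ Finset.range d, r j * Z ^ j, neg_mem (sum_mem fun j hj => ?_), ?_⟩
    · rw [Finset.mem_range] at hj
      have hgj := hg j hj
      by_cases h0 : (g j).natDegree = 0
      · have : r j ∈ wordSpan κ x y T Z ^ 0 := by simpa [h0] using hr j
        refine mul_mem_wordSpan_pow this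
          (Submodule.pow_mem_pow _ (Submodule.subset_span (by simp)) j) (by omega)
      · exact mul_mem_wordSpan_pow (hr j)
          (Submodule.pow_mem_pow _ (Submodule.subset_span (by simp)) j) (by omega)
    · have e1 : (T - x) * -∑ j ∈ Finset.range d, r j * Z ^ j =
          ∑ j ∈ Finset.range d, aeval x (g j) * Z ^ j -
            ∑ j ∈ Finset.range d, aeval T (g j) * Z ^ j := by
        rw [← Finset.sum_sub_distrib, mul_neg, Finset.mul_sum, ← Finset.sum_neg_distrib]
        refine Finset.sum_congr rfl fun j _ => ?_
        rw [← sub_mul, hr']; ring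
      have e2 : (Z - y) * ∑ j ∈ Finset.range d, aeval x (g j) * Γ j =
          ∑ j ∈ Finset.range d, aeval x (g j) * Z ^ j -
            ∑ j ∈ Finset.range d, aeval x (g j) * y ^ j := by
        rw [← Finset.sum_sub_distrib, Finset.mul_sum]
        refine Finset.sum_congr rfl fun j _ => ?_
        rw [mul_left_comm, hΓ]; ring
      linear_combination e1 - hΓ d - e2 - hTZ + hxy

theorem wordSpan_pow_le_sup (hd : 1 ≤ d) (hg : ∀ j < d, (g j).natDegree + j ≤ d)
    (hxy : y ^ d = -∑ j ∈ Finset.range d, aeval x (g j) * y ^ j)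
    (hTZ : Z ^ d = -∑ j ∈ Finset.range d, aeval T (g j) * Z ^ j) (n : ℕ) :
    wordSpan κ x y T Z ^ n ≤ reducedSpan κ x y Z d n ⊔ liftable κ x y T Z n := by
  have lift_mul : ∀ {k l} {a b : A}, a ∈ liftable κ x y T Z k → b ∈ wordSpan κ x y T Z ^ l →
      k + l ≤ n → a * b ∈ liftable κ x y T Z n := by
    intro k l a b ha hb hkl
    rw [mem_liftable] at ha ⊢
    obtain ⟨Q, hQ, h⟩ := ha
    exact ⟨Q * b, mul_mem_wordSpan_pow hQ hb hkl, by rw [← mul_assoc, h, mul_assoc]⟩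
  obtain ⟨l, hl, hlift⟩ := exists_sub_mul_eq hd hg hxy hTZ
  have h2 : ∀ e a b, a + b + e ≤ n →
      x ^ a * y ^ b * Z ^ e ∈ reducedSpan κ x y Z d n ⊔ liftable κ x y T Z n := by
    intro e
    induction e using Nat.strong_induction_on with
    | _ e ih =>
      intro a b h
      rcases lt_or_ge e (d - 1) with he | he
      · exact Submodule.mem_sup_left (mem_reducedSpan hg hxy he a b h)
      · obtain ⟨e, rfl⟩ := Nat.exists_eq_add_of_le' he
        have hm : x ^ a * y ^ b * T ^ 0 * Z ^ e ∈ wordSpan κ x y T Z ^ (a + b + 0 + e) :=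
          monomial_mem_wordSpan_pow le_rfl
        have h3 := lift_mul hlift hm (by omega)
        have h4 : x ^ a * y ^ b * Z ^ e * l ∈
            reducedSpan κ x y Z d n ⊔ liftable κ x y T Z n := by
          have : Submodule.map (LinearMap.mulLeft κ (x ^ a * y ^ b * Z ^ e)) (Submodule.span κ
              {m | ∃ k t s, k + t + s ≤ d - 1 ∧ s < d - 1 ∧ m = x ^ k * y ^ t * Z ^ s}) ≤
              reducedSpan κ x y Z d n ⊔ liftable κ x y T Z n := by
            rw [Submodule.map_span, Submodule.span_le]
            rintro _ ⟨_, ⟨k, t, s, hkts, hs, rfl⟩, rfl⟩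
            have := ih (e + s) (by omega) (a + k) (b + t) (by omega)
            rw [LinearMap.mulLeft_apply, SetLike.mem_coe]
            convert this using 1
            ring
          exact this ⟨l, hl, rfl⟩
        convert sub_mem (Submodule.mem_sup_right h3) h4 using 1
        ring
  have h1 : ∀ c a b e, a + b + c + e ≤ n →
      x ^ a * y ^ b * T ^ c * Z ^ e ∈ reducedSpan κ x y Z d n ⊔ liftable κ x y T Z n := by
    intro c
    induction c with
    | zero => intro a b e h; simpa using h2 e a b (by omega)
    | succ c ih =>
      intro a b e h
      have hm : x ^ a * y ^ b * T ^ c * Z ^ e ∈ wordSpan κ x y T Z ^ (a + b + c + e) :=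
        monomial_mem_wordSpan_pow le_rfl
      have hT : T - x ∈ liftable κ x y T Z 1 := by
        rw [mem_liftable]
        refine ⟨Z - y, ?_, mul_comm _ _⟩
        rw [pow_one]
        exact sub_mem (Submodule.subset_span (by simp)) (Submodule.subset_span (by simp))
      convert add_mem (Submodule.mem_sup_right (lift_mul hT hm (by omega)))
        (ih (a + 1) b e (by omega)) using 1
      ring
  refine (wordSpan_pow_le x y T Z n).trans (Submodule.span_le.2 ?_)
  rintro _ ⟨a, b, c, e, h, rfl⟩
  exact h1 c a b e h

/-- A large enough space of words contains a nonzero element that vanishes to order `M` along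
the diagonal `T = x`, `Z = y`. -/
theorem exists_pow_mul_eq_pow_mul (hd : 1 ≤ d) (hg : ∀ j < d, (g j).natDegree + j ≤ d)
    (hxy : y ^ d = -∑ j ∈ Finset.range d, aeval x (g j) * y ^ j)
    (hTZ : Z ^ d = -∑ j ∈ Finset.range d, aeval T (g j) * Z ^ j) {n M : ℕ}
    (V : Submodule κ A) [FiniteDimensional κ V] (hV : V ≤ wordSpan κ x y T Z ^ n)
    (hM : M * ((n + 1) * (d * (d - 1))) < Module.finrank κ V) :
    ∃ P ∈ V, P ≠ 0 ∧ ∃ Q ∈ wordSpan κ x y T Z ^ n, (T - x) ^ M * Q = (Z - y) ^ M * P := by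
  let W := wordSpan κ x y T Z ^ n
  let Cn : ℕ → Submodule κ A := fun m =>
    V ⊓ (W.map (LinearMap.mulLeft κ ((T - x) ^ m))).comap (LinearMap.mulLeft κ ((Z - y) ^ m))
  have hfin : ∀ m, FiniteDimensional κ (Cn m) := fun m =>
    Submodule.finiteDimensional_of_le (inf_le_left : _ ≤ V)
  have key : ∀ m, Module.finrank κ V ≤
      Module.finrank κ (Cn m) + m * ((n + 1) * (d * (d - 1))) := by
    intro m
    induction m with
    | zero =>
      have : V ≤ Cn 0 := fun v hv => ⟨hv, v, hV hv, by simp⟩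
      have := Submodule.finrank_mono this
      omega
    | succ m ih =>
      have h1 := finrank_le_finrank_inf_comap_add (LinearMap.mulLeft κ ((Z - y) ^ m)) (Cn m)
        ((reducedSpan κ x y Z d n).map (LinearMap.mulLeft κ ((T - x) ^ m)))
        ((liftable κ x y T Z n).map (LinearMap.mulLeft κ ((T - x) ^ m))) (by
          rw [← Submodule.map_sup]
          rintro _ ⟨v, ⟨-, hv⟩, rfl⟩
          exact Submodule.map_mono (wordSpan_pow_le_sup hd hg hxy hTZ n) hv)
      have h2 := (Submodule.finrank_map_le (LinearMap.mulLeft κ ((T - x) ^ m))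
        (reducedSpan κ x y Z d n)).trans (finrank_reducedSpan_le d n)
      have h3 : Cn m ⊓ ((liftable κ x y T Z n).map (LinearMap.mulLeft κ ((T - x) ^ m))).comap
          (LinearMap.mulLeft κ ((Z - y) ^ m)) ≤ Cn (m + 1) := by
        rintro P ⟨⟨hPV, -⟩, Q, hQ, hQP⟩
        obtain ⟨Q', hQ', h⟩ := mem_liftable.1 hQ
        refine ⟨hPV, Q', hQ', ?_⟩
        simp only [LinearMap.mulLeft_apply] at hQP ⊢
        rw [pow_succ, mul_assoc, h, mul_left_comm, hQP, pow_succ]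
        ring
      have h4 := Submodule.finrank_mono h3
      rw [add_mul, one_mul]
      omega
  have hpos : 0 < Module.finrank κ (Cn M) := by have := key M; omega
  have : Nontrivial (Cn M) := Module.nontrivial_of_finrank_pos hpos
  obtain ⟨⟨P, hPV, Q, hQ, h⟩, hne⟩ := exists_ne (0 : Cn M)
  exact ⟨P, hPV, fun h0 => hne (Subtype.ext h0), Q, hQ, h⟩

end Reduction
end Polynomial

namespace Polynomial
open scoped Polynomial

section Extension
variable {κ L : Type*} [Field κ] [IsAlgClosed κ]

theorem exists_algHom_of_finiteType (B : Type*) [CommRing B] [Nontrivial B] [Algebra κ B]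
    [Algebra.FiniteType κ B] : Nonempty (B →ₐ[κ] κ) := by
  obtain ⟨m, hm⟩ := Ideal.exists_maximal B
  let := Ideal.Quotient.field m
  have : Algebra.FiniteType κ (B ⧸ m) :=
    Algebra.FiniteType.of_surjective (Ideal.Quotient.mkₐ κ m) (Ideal.Quotient.mkₐ_surjective κ m)
  have : Module.Finite κ (B ⧸ m) := finite_of_finite_type_of_isJacobsonRing κ (B ⧸ m)
  exact ⟨(IsAlgClosed.lift : (B ⧸ m) →ₐ[κ] κ).comp (Ideal.Quotient.mkₐ κ m)⟩

/-- Over an algebraically closed field, an irreducible monic bivariate polynomial stays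
irreducible over every extension field. -/
theorem Monic.irreducible_map_mapRingHom [Field L] [Algebra κ L] {f : κ[X][X]} (hf : f.Monic)
    (hirr : Irreducible f) : Irreducible (f.map (mapRingHom (algebraMap κ L))) := by
  classical
  rw [(hf.map _).irreducible_iff_natDegree']
  refine ⟨fun h => ?_, fun g h hg hh hgh hdeg => ?_⟩
  · rw [← Polynomial.map_one (mapRingHom (algebraMap κ L))] at h
    exact hirr.ne_one (map_injective _ (map_injective _ (algebraMap κ L).injective) h)
  · let s : Set L := ((g.support.biUnion fun i => (g.coeff i).coeffs) ∪
      h.support.biUnion fun i => (h.coeff i).coeffs : Finset L)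
    let B := Algebra.adjoin κ s
    have hB : Algebra.FiniteType κ B :=
      (Subalgebra.fg_iff_finiteType _).1 (Subalgebra.fg_adjoin_finset _)
    have hs : ∀ p : L[X][X], (∀ i j, (p.coeff i).coeff j ≠ 0 → (p.coeff i).coeff j ∈ s) →
        p ∈ lifts (mapRingHom (algebraMap B L)) := by
      intro p hp
      rw [lifts_iff_coeff_lifts]
      intro i
      have : p.coeff i ∈ lifts (algebraMap B L) := by
        rw [lifts_iff_coeff_lifts]
        intro j
        by_cases h0 : (p.coeff i).coeff j = 0
        · exact ⟨0, by rw [h0, map_zero]⟩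
        · exact ⟨⟨_, Algebra.subset_adjoin (hp i j h0)⟩, rfl⟩
      obtain ⟨q, hq⟩ := this
      exact ⟨q, hq⟩
    have mem_coeffs : ∀ (p : L[X][X]) (i j), (p.coeff i).coeff j ≠ 0 →
        (p.coeff i).coeff j ∈ p.support.biUnion fun i => (p.coeff i).coeffs := by
      intro p i j hij
      refine Finset.mem_biUnion.2 ⟨i, ?_, coeff_mem_coeffs hij⟩
      rw [mem_support_iff]
      intro h
      simp [h] at hij
    obtain ⟨g', hg', -, hgm⟩ := lifts_and_natDegree_eq_and_monic (hs g fun i j hij => by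
      simp only [s, Finset.coe_union]
      exact Or.inl (mem_coeffs g i j hij)) hg
    obtain ⟨h', hh', hdeg', hhm⟩ := lifts_and_natDegree_eq_and_monic (hs h fun i j hij => by
      simp only [s, Finset.coe_union]
      exact Or.inr (mem_coeffs h i j hij)) hh
    have hprod : g' * h' = f.map (mapRingHom (algebraMap κ B)) := by
      apply map_injective (mapRingHom (algebraMap B L))
        (map_injective _ (FaithfulSMul.algebraMap_injective B L))
      rw [Polynomial.map_mul, hg', hh', hgh, Polynomial.map_map,
        mapRingHom_comp]
      congr 1
    obtain ⟨φ⟩ := exists_algHom_of_finiteType (κ := κ) B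
    have hprod' := congrArg (Polynomial.map (mapRingHom (φ : B →+* κ))) hprod
    rw [Polynomial.map_map, Polynomial.map_mul] at hprod'
    have hid : (mapRingHom (φ : B →+* κ)).comp (mapRingHom (algebraMap κ B)) =
        RingHom.id _ := by
      rw [mapRingHom_comp, AlgHom.comp_algebraMap, Algebra.algebraMap_self, mapRingHom_id]
    rw [hid, Polynomial.map_id] at hprod'
    refine (hf.irreducible_iff_natDegree'.1 hirr).2 _ _ (hgm.map _) (hhm.map _) hprod' ?_
    rw [hhm.natDegree_map, hdeg']
    rwa [hf.natDegree_map] at hdeg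

end Extension
end Polynomial

namespace Polynomial
open scoped Polynomial

section Frobenius
variable {κ : Type*} [Field κ] (p : ℕ) [ExpChar κ p] {f : κ[X][X]}

theorem eq_zero_of_dvd_expand (k : ℕ) (hf : f.Monic) (hirr : Irreducible f)
    (hder : derivative f ≠ 0) {G : κ[X][X]} (hG : G.natDegree < f.natDegree)
    (hdvd : f ∣ expand κ[X] (p ^ k) G) : G = 0 := by
  classical
  let K := FractionRing κ[X]
  let Ω := AlgebraicClosure K
  have hinjK : Function.Injective (algebraMap κ[X] K) := IsFractionRing.injective _ _
  have hirrK : Irreducible (f.map (algebraMap κ[X] K)) :=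
    (hf.irreducible_iff_irreducible_map_fraction_map).1 hirr
  have hsepK : (f.map (algebraMap κ[X] K)).Separable := by
    rw [separable_iff_derivative_ne_zero hirrK, derivative_map]
    exact (Polynomial.map_ne_zero_iff hinjK).2 hder
  let i : κ[X] →+* Ω := (algebraMap K Ω).comp (algebraMap κ[X] K)
  have hinj : Function.Injective i := (algebraMap K Ω).injective.comp hinjK
  have hsep : (f.map i).Separable := by
    have := hsepK.map (f := algebraMap K Ω)
    rwa [Polynomial.map_map] at this
  have : ExpChar Ω p :=
    expChar_of_injective_ringHom (f := i.comp C) (hinj.comp C_injective) p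
  have hroots : (f.map i).roots.card = f.natDegree := by
    rw [← hf.natDegree_map i]
    exact (IsAlgClosed.splits (f.map i)).natDegree_eq_card_roots.symm
  by_contra h0
  have hG0 : G.map i ≠ 0 := (Polynomial.map_ne_zero_iff hinj).2 h0
  have hsub : (f.map i).roots.toFinset.image (iterateFrobenius Ω p k) ⊆
      (G.map i).roots.toFinset := by
    intro β hβ
    obtain ⟨α, hα, rfl⟩ := Finset.mem_image.1 hβ
    rw [Multiset.mem_toFinset, mem_roots (hf.map i).ne_zero] at hα
    rw [Multiset.mem_toFinset, mem_roots hG0, IsRoot.def, iterateFrobenius_def, ← expand_eval,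
      ← map_expand]
    exact hα.dvd (Polynomial.map_dvd i hdvd)
  have h1 := Finset.card_le_card hsub
  rw [Finset.card_image_of_injective _ (iterateFrobenius_inj Ω p k),
    Multiset.toFinset_card_of_nodup (nodup_roots hsep), hroots] at h1
  have h2 := (Multiset.toFinset_card_le (G.map i).roots).trans (card_roots' _)
  have h3 := natDegree_map_le (f := i) (p := G)
  omega

theorem eq_zero_of_sum_X_pow_mul_expand_eq_zero {q : ℕ} {g : ℕ → κ[X]}
    (h : ∑ c ∈ Finset.range q, X ^ c * expand κ q (g c) = 0) {c : ℕ} (hc : c < q) : g c = 0 := by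
  ext t
  have h1 := congrArg (fun r => coeff r (q * t + c)) h
  simp only [finsetSum_coeff, coeff_zero] at h1
  rw [Finset.sum_eq_single c] at h1
  · rw [coeff_X_pow_mul, coeff_expand_mul' (by omega)] at h1
    simpa using h1
  · intro b hb hbc
    rw [Finset.mem_range] at hb
    rw [coeff_X_pow_mul']
    split_ifs with hle
    · rw [coeff_expand (by omega), if_neg]
      intro ⟨s, hs⟩
      have h4 : q * t + c = q * s + b := by omega
      have h5 := congrArg (· % q) h4
      simp only [Nat.mul_add_mod, Nat.mod_eq_of_lt hc, Nat.mod_eq_of_lt hb] at h5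
      exact hbc h5.symm
    · rfl
  · intro hc'
    exact absurd (Finset.mem_range.2 hc) hc'

theorem eq_zero_of_dvd_sum_expand_map_expand (k : ℕ) (hf : f.Monic) (hirr : Irreducible f)
    (hder : derivative f ≠ 0) {g : ℕ → κ[X][X]} (hg : ∀ c, (g c).degree < f.degree)
    (hdvd : f ∣ ∑ c ∈ Finset.range (p ^ k), C (X ^ c) *
      expand κ[X] (p ^ k) ((g c).map (expand κ (p ^ k) : κ[X] →+* κ[X])))
    {c : ℕ} (hc : c < p ^ k) : g c = 0 := by
  set q := p ^ k
  have hdeg : 0 < f.natDegree := by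
    rw [Nat.pos_iff_ne_zero]
    intro h0
    exact hirr.ne_one (hf.natDegree_eq_zero.1 h0)
  have h0 := eq_zero_of_dvd_expand p k hf hirr hder
    (G := ∑ c ∈ Finset.range q, C (X ^ c) * (g c).map (expand κ q : κ[X] →+* κ[X])) (by
      refine lt_of_le_of_lt (natDegree_sum_le_of_forall_le (n := f.natDegree - 1) _ _
        fun c _ => ?_) (Nat.sub_one_lt hdeg.ne')
      refine (natDegree_C_mul_le _ _).trans (natDegree_map_le.trans ?_)
      have := hg c
      rcases eq_or_ne (g c) 0 with h | h
      · simp [h]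
      · have := natDegree_lt_natDegree h this
        omega) (by
      convert hdvd using 1
      rw [map_sum]
      refine Finset.sum_congr rfl fun c _ => ?_
      rw [map_mul, expand_C])
  ext1 j
  refine (eq_zero_of_sum_X_pow_mul_expand_eq_zero (g := fun c => (g c).coeff j) ?_ hc).trans
    (coeff_zero _).symm
  have := congrArg (fun r => coeff r j) h0
  simpa only [finsetSum_coeff, coeff_C_mul, coeff_map, coeff_zero, RingHom.coe_coe] using this

end Frobenius

section Box

/-- Bivariate polynomials of degree less than `d` in the outer and less than `N` in the inner
variable. -/
def box (S : Type*) [CommRing S] (d N : ℕ) : Submodule S S[X][X] where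
  carrier := {p | ∀ i, p.coeff i ∈ degreeLT S N ∧ (d ≤ i → p.coeff i = 0)}
  add_mem' hp hq i := by
    rw [coeff_add]
    exact ⟨add_mem (hp i).1 (hq i).1, fun h => by rw [(hp i).2 h, (hq i).2 h, add_zero]⟩
  zero_mem' i := by simp
  smul_mem' c p hp i := by
    rw [coeff_smul]
    exact ⟨Submodule.smul_mem _ _ (hp i).1, fun h => by rw [(hp i).2 h, smul_zero]⟩

variable {S : Type*} [CommRing S] {d N : ℕ}

theorem degree_lt_of_mem_box {p : S[X][X]} (hp : p ∈ box S d N) : p.degree < d :=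
  (degree_lt_iff_coeff_zero _ _).2 fun i hi => (hp i).2 hi

theorem C_X_pow_mul_X_pow_mem_box {k i : ℕ} (hk : k < N) (hi : i < d) :
    (C (X ^ k) * X ^ i : S[X][X]) ∈ box S d N := by
  intro j
  rw [coeff_C_mul_X_pow]
  split_ifs with h
  · refine ⟨mem_degreeLT.2 ((degree_X_pow_le k).trans_lt ?_), fun hd => by omega⟩
    exact_mod_cast hk
  · exact ⟨zero_mem _, fun _ => rfl⟩

end Box
end Polynomial

namespace Polynomial
open scoped Polynomial

section RationalPoints
variable {Fq : Type*} [Field Fq] [Fintype Fq]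

theorem exists_algebraMap_eq_of_pow_card_eq {k : Type*} [Field k] [Algebra Fq k] {x : k}
    (hx : x ^ Fintype.card Fq = x) : ∃ a : Fq, algebraMap Fq k a = x := by
  classical
  have h1 : 1 < Fintype.card Fq := Fintype.one_lt_card
  have hprod : (X ^ Fintype.card Fq - X : Fq[X]) = ∏ a, (X - C a) := by
    rw [← prod_multiset_X_sub_C_of_monic_of_roots_card_eq (p := X ^ Fintype.card Fq - X),
      FiniteField.roots_X_pow_card_sub_X]
    · rfl
    · exact monic_X_pow_sub (by rw [degree_X]; exact_mod_cast h1)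
    · rw [FiniteField.roots_X_pow_card_sub_X, FiniteField.X_pow_card_sub_X_natDegree_eq Fq h1]
      rfl
  have h := congrArg (aeval x) hprod
  simp only [map_sub, map_pow, aeval_X, hx, sub_self, map_prod, aeval_C] at h
  obtain ⟨a, -, ha⟩ := Finset.prod_eq_zero_iff.1 h.symm
  exact ⟨a, (sub_eq_zero.1 ha).symm⟩

/-- If the plane curve `f = 0` has no rational point, then no point of the curve has both
coordinates fixed by Frobenius. -/
theorem isCoprime_pow_card_sub {R : Type*} [CommRing R] [Algebra Fq R] {f : Fq[X][X]} {x y : R}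
    (h : f.eval₂ (aeval x : Fq[X] →ₐ[Fq] R).toRingHom y = 0)
    (hno : ∀ a b : Fq, f.evalEval a b ≠ 0) :
    IsCoprime (x ^ Fintype.card Fq - x) (y ^ Fintype.card Fq - y) := by
  by_contra hc
  rw [← Ideal.isCoprime_span_singleton_iff, Ideal.isCoprime_iff_sup_eq] at hc
  obtain ⟨m, hm, hle⟩ := Ideal.exists_le_maximal _ hc
  let := Ideal.Quotient.field m
  have key : ∀ z : R, z ^ Fintype.card Fq - z ∈ m →
      ∃ a : Fq, algebraMap Fq (R ⧸ m) a = Ideal.Quotient.mk m z := by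
    intro z hz
    apply exists_algebraMap_eq_of_pow_card_eq
    rw [← map_pow, ← sub_eq_zero, ← map_sub]
    exact Ideal.Quotient.eq_zero_iff_mem.2 hz
  obtain ⟨a, ha⟩ := key x (hle (Ideal.mem_sup_left (Ideal.mem_span_singleton_self _)))
  obtain ⟨b, hb⟩ := key y (hle (Ideal.mem_sup_right (Ideal.mem_span_singleton_self _)))
  have h2 := congrArg (Ideal.Quotient.mk m) h
  rw [hom_eval₂, map_zero, ← hb] at h2
  have h3 : (Ideal.Quotient.mk m).comp (aeval x : Fq[X] →ₐ[Fq] R).toRingHom =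
      (algebraMap Fq (R ⧸ m)).comp (evalRingHom a) := by
    ext c
    · simp only [AlgHom.toRingHom_eq_coe, RingHom.comp_apply, RingHom.coe_coe, aeval_C,
        coe_evalRingHom, eval_C]
      rfl
    · simp [ha]
  rw [h3, ← hom_eval₂, map_eq_zero, eval₂_evalRingHom] at h2
  exact hno a b h2

end RationalPoints

section FrobeniusEndomorphism
variable {κ : Type*} [Field κ] {f : κ[X][X]}

theorem lift_mk_eq_mk_expand {q : ℕ}
    (hψ : f.eval₂ (aeval (AdjoinRoot.of f X ^ q) : κ[X] →ₐ[κ] AdjoinRoot f).toRingHom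
      (AdjoinRoot.root f ^ q) = 0) (g : κ[X][X]) :
    AdjoinRoot.lift _ _ hψ (AdjoinRoot.mk f g) =
      AdjoinRoot.mk f (expand κ[X] q (g.map (expand κ q : κ[X] →+* κ[X]))) := by
  rw [AdjoinRoot.lift_mk]
  have : eval₂RingHom (aeval (AdjoinRoot.of f X ^ q) : κ[X] →ₐ[κ] AdjoinRoot f).toRingHom
      (AdjoinRoot.root f ^ q) = (AdjoinRoot.mk f).comp
        ((expand κ[X] q : κ[X][X] →+* κ[X][X]).comp
          (mapRingHom (expand κ q : κ[X] →+* κ[X]))) := by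
    refine ringHom_ext' (ringHom_ext' (RingHom.ext fun c => ?_) ?_) ?_
    · simp
      rfl
    · simp
    · simp
  exact congrArg (fun φ => φ g) this

theorem eq_zero_of_eval₂_lift_eq_zero (p k : ℕ) [ExpChar κ p] (hf : f.Monic)
    (hirr : Irreducible f) (hder : derivative f ≠ 0)
    (hψ : f.eval₂ (aeval (AdjoinRoot.of f X ^ p ^ k) : κ[X] →ₐ[κ] AdjoinRoot f).toRingHom
      (AdjoinRoot.root f ^ p ^ k) = 0) {r : (AdjoinRoot f)[X]} (hr : r.natDegree < p ^ k)
    (h : r.eval₂ (AdjoinRoot.lift _ _ hψ) (AdjoinRoot.of f X) = 0) : r = 0 := by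
  let g : ℕ → κ[X][X] := fun c => AdjoinRoot.modByMonicHom hf (r.coeff c)
  have hg : ∀ c, AdjoinRoot.mk f (g c) = r.coeff c := fun c =>
    AdjoinRoot.mk_leftInverse hf (r.coeff c)
  have hgdeg : ∀ c, (g c).degree < f.degree := by
    intro c
    obtain ⟨s, hs⟩ := AdjoinRoot.mk_surjective (r.coeff c)
    simp only [g, ← hs, AdjoinRoot.modByMonicHom_mk]
    exact degree_modByMonic_lt _ hf
  rw [eval₂_eq_sum_range' _ hr] at h
  ext1 c
  rw [coeff_zero]
  rcases lt_or_ge c (p ^ k) with hc | hc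
  · rw [← hg, eq_zero_of_dvd_sum_expand_map_expand p k hf hirr hder hgdeg ?_ hc, map_zero]
    rw [← AdjoinRoot.mk_eq_zero, map_sum, ← h]
    refine Finset.sum_congr rfl fun c _ => ?_
    rw [map_mul, ← lift_mk_eq_mk_expand hψ, hg, AdjoinRoot.mk_C, map_pow, mul_comm]
  · exact coeff_eq_zero_of_natDegree_lt (by omega)

end FrobeniusEndomorphism
end Polynomial

namespace Polynomial
open scoped Polynomial

section PlaneCurve
variable {κ : Type*} [Field κ] {f : κ[X][X]}

/-- The polynomials of bounded degree, as a filtration. -/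
noncomputable def degreeFiltration (S : Type*) [CommRing S] (n : ℕ) : AddSubgroup S[X] :=
  (degreeLE S n).toAddSubgroup

theorem mem_degreeFiltration {S : Type*} [CommRing S] {n : ℕ} {p : S[X]} :
    p ∈ degreeFiltration S n ↔ p.natDegree ≤ n :=
  mem_degreeLE.trans natDegree_le_iff_degree_le.symm

instance (S : Type*) [CommRing S] : SetLike.GradedMonoid (degreeFiltration S) where
  one_mem := mem_degreeFiltration.2 natDegree_one.le
  mul_mem _ _ _ _ hp hq := mem_degreeFiltration.2
    (natDegree_mul_le_of_le (mem_degreeFiltration.1 hp) (mem_degreeFiltration.1 hq))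

theorem eval₂_lift_map_mapRingHom {q : ℕ}
    (hψ : f.eval₂ (aeval (AdjoinRoot.of f X ^ q) : κ[X] →ₐ[κ] AdjoinRoot f).toRingHom
      (AdjoinRoot.root f ^ q) = 0) :
    (f.map (mapRingHom (algebraMap κ (AdjoinRoot f)))).eval₂
      (eval₂RingHom (AdjoinRoot.lift _ _ hψ) (AdjoinRoot.of f X)) (AdjoinRoot.root f) = 0 := by
  have h : (eval₂RingHom (AdjoinRoot.lift _ _ hψ) (AdjoinRoot.of f X)).comp
      (mapRingHom (algebraMap κ (AdjoinRoot f))) = AdjoinRoot.of f := by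
    refine ringHom_ext' (RingHom.ext fun c => ?_) ?_
    · simp only [RingHom.comp_apply, coe_mapRingHom, map_C, coe_eval₂RingHom, eval₂_C]
      change AdjoinRoot.lift _ _ hψ (AdjoinRoot.of f (C c)) = _
      rw [AdjoinRoot.lift_of]
      simp
      rfl
    · simp
  rw [eval₂_map, h, AdjoinRoot.eval₂_root]

theorem eval₂_lift_ne_zero_of_mem_box [IsAlgClosed κ] (p k : ℕ) [ExpChar κ p] (hf : f.Monic)
    (hirr : Irreducible f) (hder : derivative f ≠ 0)
    (hψ : f.eval₂ (aeval (AdjoinRoot.of f X ^ p ^ k) : κ[X] →ₐ[κ] AdjoinRoot f).toRingHom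
      (AdjoinRoot.root f ^ p ^ k) = 0) {B : ℕ} (hdeg : ∀ i, (f.coeff i).natDegree ≤ f.natDegree)
    (hB : f.natDegree * (f.natDegree - 1) + f.natDegree * (B - 1) < p ^ k)
    {P : (AdjoinRoot f)[X][X]} (hP : P ∈ box (AdjoinRoot f) f.natDegree B) (hP0 : P ≠ 0) :
    P.eval₂ (eval₂RingHom (AdjoinRoot.lift _ _ hψ) (AdjoinRoot.of f X)) (AdjoinRoot.root f) ≠
      0 := by
  have : IsDomain (AdjoinRoot f) := AdjoinRoot.isDomain_of_prime hirr.prime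
  set R := AdjoinRoot f
  let K := FractionRing R
  have hinj : Function.Injective (mapRingHom (algebraMap R K)) :=
    map_injective _ (IsFractionRing.injective R K)
  set fR : R[X][X] := f.map (mapRingHom (algebraMap κ R)) with hfR
  have hfRm : fR.Monic := hf.map _
  have hfRd : fR.natDegree = f.natDegree := hf.natDegree_map _
  have hd0 : f.natDegree ≠ 0 := fun h0 => hirr.ne_one (hf.natDegree_eq_zero.1 h0)
  have hPd : P.natDegree < f.natDegree :=
    (natDegree_lt_iff_degree_lt hP0).2 (degree_lt_of_mem_box hP)
  have hres : resultant fR P ≠ 0 := by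
    have hK : fR.map (mapRingHom (algebraMap R K)) = f.map (mapRingHom (algebraMap κ K)) := by
      rw [hfR, Polynomial.map_map, mapRingHom_comp, ← IsScalarTower.algebraMap_eq]
    have h1 := resultant_ne_zero_of_irreducible (f := fR.map (mapRingHom (algebraMap R K)))
      (h := P.map (mapRingHom (algebraMap R K))) (hfRm.map _)
      (hK ▸ hf.irreducible_map_mapRingHom hirr)
      ((Polynomial.map_ne_zero_iff hinj).2 hP0) (by
        rw [natDegree_map_eq_of_injective hinj, natDegree_map_eq_of_injective hinj, hfRd]
        exact hPd)
    rw [natDegree_map_eq_of_injective hinj, natDegree_map_eq_of_injective hinj,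
      resultant_map_map] at h1
    exact fun h => h1 (by rw [h, map_zero])
  have hresdeg : (resultant fR P).natDegree < p ^ k := by
    have h1 := mem_degreeFiltration.1 (resultant_mem_of_coeff_mem (degreeFiltration R)
      (f := fR) (g := P) (m := fR.natDegree) (n := P.natDegree) (a := f.natDegree) (b := B - 1)
      (fun i => mem_degreeFiltration.2 (by
        rw [hfR, coeff_map]; exact natDegree_map_le.trans (hdeg i)))
      (fun i => mem_degreeFiltration.2 (by
        by_cases h0 : P.coeff i = 0
        · simp [h0]
        · have := (natDegree_lt_iff_degree_lt h0).2 (mem_degreeLT.1 (hP i).1)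
          omega)))
    have h3 : fR.natDegree * (B - 1) = f.natDegree * (B - 1) := by rw [hfRd]
    have h2 : P.natDegree * f.natDegree ≤ f.natDegree * (f.natDegree - 1) := by
      rw [mul_comm]; exact Nat.mul_le_mul_left _ (by omega)
    omega
  obtain ⟨u, v, -, -, huv⟩ := exists_mul_add_mul_eq_C_resultant fR P le_rfl le_rfl
    (Or.inl (hfRd ▸ hd0))
  intro h0
  apply hres
  apply eq_zero_of_eval₂_lift_eq_zero p k hf hirr hder hψ hresdeg
  have h1 := congrArg (eval₂RingHom (eval₂RingHom (AdjoinRoot.lift _ _ hψ) (AdjoinRoot.of f X))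
    (AdjoinRoot.root f)) huv
  simp only [map_add, map_mul, coe_eval₂RingHom, h0, zero_mul, add_zero, eval₂_C] at h1
  rw [← h1, eval₂_lift_map_mapRingHom hψ, zero_mul]

theorem mk_eq_zero_of_of_dvd (hf : f.Monic) {h : κ[X]} (hh : h.Monic) {P : κ[X][X]}
    (hP : P ∈ box κ f.natDegree h.natDegree) (hdvd : AdjoinRoot.of f h ∣ AdjoinRoot.mk f P) :
    P = 0 := by
  obtain ⟨c, hc⟩ := hdvd
  obtain ⟨s, rfl⟩ := AdjoinRoot.mk_surjective c
  have hs : AdjoinRoot.mk f s = AdjoinRoot.mk f (s %ₘ f) := by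
    rw [← AdjoinRoot.modByMonicHom_mk hf, AdjoinRoot.mk_leftInverse hf]
  rw [hs, ← AdjoinRoot.mk_C, ← map_mul, AdjoinRoot.mk_eq_mk] at hc
  have hdf : (f.natDegree : WithBot ℕ) = f.degree := (degree_eq_natDegree hf.ne_zero).symm
  have heq : P - C h * (s %ₘ f) = 0 := by
    by_contra h0
    refine hf.not_dvd_of_degree_lt h0 ?_ hc
    refine (degree_sub_le _ _).trans_lt (max_lt ?_ ?_)
    · rw [← hdf]; exact degree_lt_of_mem_box hP
    · refine lt_of_le_of_lt ?_ (degree_modByMonic_lt s hf)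
      rw [← smul_eq_C_mul]; exact degree_smul_le _ _
  rw [sub_eq_zero] at heq
  ext1 i
  have hi := congrArg (fun r => coeff r i) heq
  simp only [coeff_C_mul] at hi
  by_contra h0
  refine hh.not_dvd_of_degree_lt h0 ?_ ⟨_, hi⟩
  rw [degree_eq_natDegree hh.ne_zero]
  exact mem_degreeLT.1 (hP i).1

end PlaneCurve

theorem linearIndependent_X_pow (S : Type*) [CommRing S] (B : ℕ) :
    LinearIndependent S fun k : Fin B => (X ^ (k : ℕ) : S[X]) := by
  have := (basisMonomials S).linearIndependent.comp (fun k : Fin B => (k : ℕ)) Fin.val_injective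
  simpa only [coe_basisMonomials, Function.comp_def, monomial_one_right_eq_X_pow] using this

theorem linearIndependent_root_pow {S : Type*} [CommRing S] {g : S[X]} (hg : g.Monic) :
    LinearIndependent S fun i : Fin g.natDegree => AdjoinRoot.root g ^ (i : ℕ) := by
  have h := (AdjoinRoot.powerBasis' hg).basis.linearIndependent
  rw [PowerBasis.coe_basis] at h
  exact h

theorem linearIndependent_X_pow_smul_root_pow {S : Type*} [CommRing S] {g : S[X][X]}
    (hg : g.Monic) (B : ℕ) : LinearIndependent S
      fun t : Fin B × Fin g.natDegree =>
        (X ^ (t.1 : ℕ) : S[X]) • AdjoinRoot.root g ^ (t.2 : ℕ) := by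
  have := linearIndependent_smul (linearIndependent_X_pow S B) (linearIndependent_root_pow hg)
  exact this

end Polynomial

namespace Polynomial
open scoped Polynomial

section Stepanov

theorem pow_natDegree_eq_neg_sum {κ A : Type*} [Field κ] [CommRing A] [Algebra κ A] {f : κ[X][X]}
    (hf : f.Monic) {x y : A} (h : f.eval₂ (aeval x : κ[X] →ₐ[κ] A).toRingHom y = 0) :
    y ^ f.natDegree = -∑ j ∈ Finset.range f.natDegree, aeval x (f.coeff j) * y ^ j := by
  rw [eval₂_eq_sum_range, Finset.sum_range_succ, hf.coeff_natDegree, map_one, one_mul] at h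
  exact eq_neg_of_add_eq_zero_right h

variable {κ : Type*} [Field κ] [IsAlgClosed κ]

theorem stepanov_card_lt {d B L M n : ℕ} (hd : 1 ≤ d) (hB : B = 4 * d ^ 3) (hL : L = 2 * d ^ 2)
    (hM : M = L + d - 1) (hn : n = B + L + 2 * d) :
    M * ((n + 1) * (d * (d - 1))) < L * d * (B * d) := by
  obtain ⟨e, rfl⟩ := Nat.exists_eq_add_of_le' hd
  have hM' : M = L + e := by omega
  subst hM' hn hB hL
  have : (2 * (e + 1) ^ 2 + e) * ((4 * (e + 1) ^ 3 + 2 * (e + 1) ^ 2 + 2 * (e + 1) + 1) *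
      ((e + 1) * (e + 1 - 1))) + (e + 1) * (6 * e ^ 4 + 24 * e ^ 3 + 39 * e ^ 2 + 30 * e + 8) =
      2 * (e + 1) ^ 2 * (e + 1) * (4 * (e + 1) ^ 3 * (e + 1)) := by
    rw [Nat.add_sub_cancel]; ring
  rw [← this]
  exact Nat.lt_add_of_pos_right (by positivity)

theorem not_isCoprime_pow_sub {f : κ[X][X]} (p k : ℕ) [ExpChar κ p] (hf : f.Monic)
    (hirr : Irreducible f) (hder : derivative f ≠ 0)
    (hg : ∀ j < f.natDegree, (f.coeff j).natDegree + j ≤ f.natDegree)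
    (hψ : f.eval₂ (aeval (AdjoinRoot.of f X ^ p ^ k) : κ[X] →ₐ[κ] AdjoinRoot f).toRingHom
      (AdjoinRoot.root f ^ p ^ k) = 0)
    (hq : 6 * f.natDegree ^ 4 + 1 ≤ p ^ k) :
    ¬ IsCoprime ((AdjoinRoot.of f X) ^ p ^ k - AdjoinRoot.of f X)
      ((AdjoinRoot.root f) ^ p ^ k - AdjoinRoot.root f) := by
  intro hcop
  have hdom : IsDomain (AdjoinRoot f) := AdjoinRoot.isDomain_of_prime hirr.prime
  have hg' : ∀ j, (f.coeff j).natDegree ≤ f.natDegree := fun j => by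
    rcases lt_trichotomy j f.natDegree with h | h | h
    · have := hg j h; omega
    · rw [h, hf.coeff_natDegree, natDegree_one]; omega
    · rw [coeff_eq_zero_of_natDegree_lt h, natDegree_zero]; omega
  have hd1 : 1 ≤ f.natDegree := by
    rw [Nat.one_le_iff_ne_zero]
    exact fun h0 => hirr.ne_one (hf.natDegree_eq_zero.1 h0)
  obtain ⟨d, hd⟩ : ∃ d, d = f.natDegree := ⟨_, rfl⟩
  obtain ⟨q, hqq⟩ : ∃ q, q = p ^ k := ⟨_, rfl⟩
  let R := AdjoinRoot f
  let x : R := AdjoinRoot.of f X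
  let y : R := AdjoinRoot.root f
  have hx : (aeval x : κ[X] →ₐ[κ] R).toRingHom = AdjoinRoot.of f := by
    refine ringHom_ext' (RingHom.ext fun c => ?_) ?_
    · simp
      rfl
    · simp [x]
  have hxy : f.eval₂ (aeval x : κ[X] →ₐ[κ] R).toRingHom y = 0 := by
    rw [hx]; exact AdjoinRoot.eval₂_root f
  let fR : R[X][X] := f.map (mapRingHom (algebraMap κ R))
  have hfR : fR.Monic := hf.map _
  have hfRd : fR.natDegree = d := (hf.natDegree_map _).trans hd.symm
  let A := AdjoinRoot fR
  let X' : A := AdjoinRoot.of fR X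
  let Y' : A := AdjoinRoot.root fR
  let T : A := AdjoinRoot.of fR (C x)
  let Z : A := AdjoinRoot.of fR (C y)
  have hXY : f.eval₂ (aeval X' : κ[X] →ₐ[κ] A).toRingHom Y' = 0 := by
    have h1 := AdjoinRoot.eval₂_root fR
    rw [eval₂_map] at h1
    convert h1 using 2
    refine ringHom_ext' (RingHom.ext fun c => ?_) ?_
    · simp
      rfl
    · simp [X']
  have hTZ : f.eval₂ (aeval T : κ[X] →ₐ[κ] A).toRingHom Z = 0 := by
    have h1 := congrArg ((AdjoinRoot.of fR).comp C) hxy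
    rw [hom_eval₂, map_zero] at h1
    have h2 : (aeval T : κ[X] →ₐ[κ] A).toRingHom =
        ((AdjoinRoot.of fR).comp C).comp (aeval x : κ[X] →ₐ[κ] R).toRingHom := by
      refine ringHom_ext' (RingHom.ext fun c => ?_) ?_
      · simp
        rfl
      · simp [T]
    rw [h2]
    exact h1
  let B := 4 * d ^ 3
  let L := 2 * d ^ 2
  let M := L + d - 1
  let n := B + L + 2 * d
  have hLI := linearIndependent_smul (linearIndependent_X_pow_smul_root_pow hf L)
    (linearIndependent_X_pow_smul_root_pow hfR B)
  let fam : (Fin L × Fin f.natDegree) × (Fin B × Fin fR.natDegree) → A := fun t =>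
    ((X ^ (t.1.1 : ℕ) : κ[X]) • y ^ (t.1.2 : ℕ)) • ((X ^ (t.2.1 : ℕ) : R[X]) • Y' ^ (t.2.2 : ℕ))
  have hLI' : LinearIndependent κ fam := hLI
  have hfam : ∀ t, fam t =
      X' ^ (t.2.1 : ℕ) * Y' ^ (t.2.2 : ℕ) * T ^ (t.1.1 : ℕ) * Z ^ (t.1.2 : ℕ) := by
    intro t
    have h1 : (X ^ (t.1.1 : ℕ) : κ[X]) • y ^ (t.1.2 : ℕ) = x ^ (t.1.1 : ℕ) * y ^ (t.1.2 : ℕ) := by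
      rw [Algebra.smul_def, map_pow]; rfl
    have h2 : (X ^ (t.2.1 : ℕ) : R[X]) • Y' ^ (t.2.2 : ℕ) =
        X' ^ (t.2.1 : ℕ) * Y' ^ (t.2.2 : ℕ) := by
      rw [Algebra.smul_def, map_pow]; rfl
    have h3 : ∀ r : R, algebraMap R A r = AdjoinRoot.of fR (C r) := fun r => rfl
    simp only [fam, h1, h2]
    rw [Algebra.smul_def, h3, map_mul, map_mul, map_pow, map_pow, map_pow, map_pow]
    ring
  let V : Submodule κ A := Submodule.span κ (Set.range fam)
  have hfin : FiniteDimensional κ V := FiniteDimensional.span_of_finite κ (Set.finite_range _)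
  have hV : V ≤ wordSpan κ X' Y' T Z ^ n := by
    refine Submodule.span_le.2 ?_
    rintro _ ⟨t, rfl⟩
    rw [hfam]
    have h1 := t.1.1.2
    have h2 := t.1.2.2
    have h3 := t.2.1.2
    have h4 := t.2.2.2
    exact monomial_mem_wordSpan_pow (by omega)
  have hrank : Module.finrank κ V = L * d * (B * d) := by
    rw [finrank_span_eq_card hLI']
    simp only [Fintype.card_prod, Fintype.card_fin, hfRd, ← hd]
  obtain ⟨P, hPV, hP0, Q, hQ, hPQ⟩ := exists_pow_mul_eq_pow_mul (M := M) (hd ▸ hd1)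
    (hd ▸ hg) (hd ▸ pow_natDegree_eq_neg_sum hf hXY)
    (hd ▸ pow_natDegree_eq_neg_sum hf hTZ) V hV (by
      rw [hrank]; exact stepanov_card_lt (hd ▸ hd1) rfl rfl rfl rfl)
  let Ψ : R →+* R := AdjoinRoot.lift _ _ hψ
  have hΨx : Ψ x = x ^ q := (AdjoinRoot.lift_of hψ).trans (by rw [hqq]; exact aeval_X _)
  have hΨy : Ψ y = y ^ q := (AdjoinRoot.lift_root hψ).trans (by rw [hqq])
  have hΨc : ∀ c : κ, Ψ (algebraMap κ R c) = algebraMap κ R c := fun c =>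
    (AdjoinRoot.lift_of (x := C c) hψ).trans (aeval_C _ _)
  let Φ : A →+* R := AdjoinRoot.lift (eval₂RingHom Ψ x) y (eval₂_lift_map_mapRingHom hψ)
  have hΦof : ∀ v : R[X], Φ (AdjoinRoot.of fR v) = v.eval₂ Ψ x := fun v =>
    AdjoinRoot.lift_of (eval₂_lift_map_mapRingHom hψ)
  have hΦX : Φ X' = x := (hΦof X).trans (eval₂_X _ _)
  have hΦY : Φ Y' = y := AdjoinRoot.lift_root (eval₂_lift_map_mapRingHom hψ)
  have hΦT : Φ T = x ^ q := (hΦof _).trans ((eval₂_C _ _).trans hΨx)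
  have hΦZ : Φ Z = y ^ q := (hΦof _).trans ((eval₂_C _ _).trans hΨy)
  have hΦc : ∀ (c : κ) (v : A), Φ (c • v) = c • Φ v := by
    intro c v
    have : algebraMap κ A c = AdjoinRoot.of fR (C (algebraMap κ R c)) := rfl
    rw [Algebra.smul_def, map_mul, Algebra.smul_def, this, hΦof, eval₂_C, hΨc]
  have hsmulA : ∀ (c : κ) (v : R[X][X]), AdjoinRoot.mk fR (algebraMap κ R c • v) =
      c • AdjoinRoot.mk fR v := by
    intro c v
    rw [Algebra.smul_def, Algebra.smul_def, map_mul]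
    rfl
  have hsmulR : ∀ (c : κ) (v : κ[X][X]), AdjoinRoot.mk f (c • v) = c • AdjoinRoot.mk f v := by
    intro c v
    rw [Algebra.smul_def, Algebra.smul_def, map_mul]
    rfl
  have hbox : ∀ P ∈ V, (∃ r ∈ box R f.natDegree B, AdjoinRoot.mk fR r = P) := by
    intro P hP
    induction hP using Submodule.span_induction with
    | mem v hv =>
      obtain ⟨t, rfl⟩ := hv
      refine ⟨(x ^ (t.1.1 : ℕ) * y ^ (t.1.2 : ℕ)) • (C (X ^ (t.2.1 : ℕ)) * X ^ (t.2.2 : ℕ)),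
        Submodule.smul_mem _ _ (C_X_pow_mul_X_pow_mem_box t.2.1.2 ?_), ?_⟩
      · exact t.2.2.2.trans_eq (hfRd.trans hd)
      · rw [hfam, Algebra.smul_def]
        have h3 : algebraMap R R[X][X] = C.comp C := rfl
        simp only [map_mul, map_pow, h3, RingHom.comp_apply, AdjoinRoot.mk_C, AdjoinRoot.mk_X]
        ring
    | zero => exact ⟨0, zero_mem _, map_zero _⟩
    | add v w _ _ hv hw =>
      obtain ⟨r, hr, rfl⟩ := hv
      obtain ⟨s, hs, rfl⟩ := hw
      exact ⟨r + s, add_mem hr hs, map_add _ _ _⟩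
    | smul c v _ hv =>
      obtain ⟨r, hr, rfl⟩ := hv
      exact ⟨algebraMap κ R c • r, Submodule.smul_mem _ _ hr, hsmulA c r⟩
  let mkl : κ[X][X] →ₗ[κ] R :=
    { toFun := AdjoinRoot.mk f, map_add' := map_add _, map_smul' := hsmulR }
  have hd3 : d ^ 3 * d = d ^ 4 := by ring
  have hd1' : 1 ≤ d := hd ▸ hd1
  have hqB : B + d ≤ q + 1 := by
    rw [← hqq, ← hd] at hq
    have h1 : d ≤ d ^ 4 := Nat.le_self_pow (by norm_num) d
    have h2 : d ^ 3 ≤ d ^ 4 := Nat.pow_le_pow_right hd1' (by norm_num)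
    simp only [B]
    omega
  have hΦV : ∀ P ∈ V, Φ P ∈ (box κ f.natDegree (q * M)).map mkl := by
    intro P hP
    induction hP using Submodule.span_induction with
    | mem v hv =>
      obtain ⟨t, rfl⟩ := hv
      have h1 := t.1.1.2
      have h2 := t.1.2.2
      have h3 := t.2.1.2
      have h4 := t.2.2.2
      have hΦt : Φ (fam t) = x ^ ((t.2.1 : ℕ) + q * t.1.1) * y ^ ((t.2.2 : ℕ) + q * t.1.2) * 1 := by
        rw [hfam]
        simp only [map_mul, map_pow, hΦX, hΦY, hΦT, hΦZ]
        ring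
      rw [hΦt]
      refine pow_mul_pow_mul_mem (g := f.coeff) (n := q * M - 1) hg
        (pow_natDegree_eq_neg_sum hf hxy) ?_ _ _ ?_
      · intro a i hi hai
        have hqM : 0 < q * M := by
          have : 0 < d ^ 2 := by positivity
          refine Nat.mul_pos (by omega) ?_
          simp only [M, L]; omega
        refine ⟨C (X ^ a) * X ^ i, C_X_pow_mul_X_pow_mem_box (by omega) hi, ?_⟩
        simp only [mkl, LinearMap.coe_mk, AddHom.coe_mk, map_mul, map_pow, AdjoinRoot.mk_C,
          AdjoinRoot.mk_X, mul_one]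
        rfl
      · have hm : q * ((t.1.1 : ℕ) + t.1.2 + 1) ≤ q * M := Nat.mul_le_mul_left _ (by omega)
        have : q * ((t.1.1 : ℕ) + t.1.2 + 1) = q * t.1.1 + q * t.1.2 + q := by ring
        omega
    | zero => rw [map_zero]; exact zero_mem _
    | add v w _ _ hv hw => rw [map_add]; exact add_mem hv hw
    | smul c v _ hv => rw [hΦc]; exact Submodule.smul_mem _ _ hv
  have hΦP : Φ P = 0 := by
    obtain ⟨s, hs, hsP⟩ := hΦV P hPV
    have h1 := congrArg Φ hPQ
    simp only [map_mul, map_pow, map_sub, hΦT, hΦX, hΦZ, hΦY] at h1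
    rw [← hqq] at hcop
    have h2 : (x ^ q - x) ^ M ∣ Φ P :=
      (IsCoprime.pow hcop : IsCoprime ((x ^ q - x) ^ M) ((y ^ q - y) ^ M)).dvd_of_dvd_mul_left
        ⟨_, h1.symm⟩
    have h3 : (x ^ q - x) ^ M = AdjoinRoot.of f ((X ^ q - X) ^ M) := by simp [x]
    have hq1 : 1 < q := by
      have : 0 < f.natDegree ^ 4 := Nat.pow_pos hd1
      omega
    have hmon : (X ^ q - X : κ[X]).Monic :=
      monic_X_pow_sub (by rw [degree_X]; exact_mod_cast hq1)
    have hdegq : (X ^ q - X : κ[X]).natDegree = q := by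
      rw [natDegree_sub_eq_left_of_natDegree_lt] <;> simp [hq1]
    have hs0 : s = 0 := by
      refine mk_eq_zero_of_of_dvd hf (hmon.pow M) ?_ (P := s) ?_
      · rw [hmon.natDegree_pow, hdegq, mul_comm]; exact hs
      · rw [← h3]; exact hsP ▸ h2
    rw [← hsP, hs0, map_zero]
  obtain ⟨r, hr, hrP⟩ := hbox P hPV
  refine eval₂_lift_ne_zero_of_mem_box p k hf hirr hder hψ hg' ?_ hr ?_ ?_
  · rw [← hd, ← hqq] at hq ⊢
    have h1 : d * (B - 1) ≤ d * B := Nat.mul_le_mul_left _ (Nat.sub_le _ _)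
    have h2 : d * B = 4 * d ^ 4 := by simp only [B]; ring
    have h3 : d * (d - 1) ≤ d * d := Nat.mul_le_mul_left _ (Nat.sub_le _ _)
    have h4 : d * d ≤ d ^ 4 := by
      rw [← pow_two]; exact Nat.pow_le_pow_right hd1' (by norm_num)
    omega
  · rintro rfl
    exact hP0 (by rw [← hrP, map_zero])
  · rw [← hΦP, ← hrP]
    exact (AdjoinRoot.lift_mk (eval₂_lift_map_mapRingHom hψ) r).symm

variable {Fq : Type*} [Field Fq] [Fintype Fq] [Algebra Fq κ]

/-- An absolutely irreducible plane curve over a finite field that is large compared to its degree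
has a rational point. -/
theorem exists_evalEval_eq_zero {f₀ : Fq[X][X]} (hf₀ : f₀.Monic)
    (hirr : Irreducible (f₀.map (mapRingHom (algebraMap Fq κ))))
    (hder : derivative (f₀.map (mapRingHom (algebraMap Fq κ))) ≠ 0)
    (hdeg : ∀ i < f₀.natDegree, (f₀.coeff i).natDegree + i ≤ f₀.natDegree)
    (hq : 6 * f₀.natDegree ^ 4 + 1 ≤ Fintype.card Fq) : ∃ a b : Fq, f₀.evalEval a b = 0 := by
  by_contra! hno
  obtain ⟨p, hp⟩ := CharP.exists Fq
  obtain ⟨k, hpp, hcard⟩ := FiniteField.card Fq p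
  have : Fact p.Prime := ⟨hpp⟩
  have : ExpChar Fq p := ExpChar.prime hpp
  have : ExpChar κ p := expChar_of_injective_algebraMap (algebraMap Fq κ).injective p
  obtain ⟨f, hfdef⟩ : ∃ f, f = f₀.map (mapRingHom (algebraMap Fq κ)) := ⟨_, rfl⟩
  rw [← hfdef] at hirr hder
  have hf : f.Monic := hfdef ▸ hf₀.map _
  have hfd : f.natDegree = f₀.natDegree := hfdef ▸ hf₀.natDegree_map _
  have hmap : ∀ {S : Type _} [CommRing S] [Algebra κ S] [Algebra Fq S] [IsScalarTower Fq κ S]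
      (x y : S), f.eval₂ (aeval x : κ[X] →ₐ[κ] S).toRingHom y =
        f₀.eval₂ (aeval x : Fq[X] →ₐ[Fq] S).toRingHom y := by
    intro S _ _ _ _ x y
    rw [hfdef, eval₂_map]
    congr 1
    refine ringHom_ext' (RingHom.ext fun c => ?_) ?_
    · simp [IsScalarTower.algebraMap_apply Fq κ S]
    · simp
  let R := AdjoinRoot f
  have hx : (aeval (AdjoinRoot.of f X) : κ[X] →ₐ[κ] R).toRingHom = AdjoinRoot.of f := by
    refine ringHom_ext' (RingHom.ext fun c => ?_) ?_
    · simp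
      rfl
    · simp
  have hxy : f.eval₂ (aeval (AdjoinRoot.of f X) : κ[X] →ₐ[κ] R).toRingHom (AdjoinRoot.root f) =
      0 := by
    rw [hx]; exact AdjoinRoot.eval₂_root f
  rw [hmap] at hxy
  refine not_isCoprime_pow_sub p k hf hirr hder (fun j hj => ?_) ?_ ?_
    (hcard ▸ isCoprime_pow_card_sub hxy hno)
  · have h1 : (f.coeff j).natDegree ≤ (f₀.coeff j).natDegree := by
      rw [hfdef, coeff_map]; exact natDegree_map_le
    have := hdeg j (hfd ▸ hj)
    omega
  · rw [hmap, ← hcard]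
    have h1 := congrArg (FiniteField.frobeniusAlgHom Fq R).toRingHom hxy
    rw [hom_eval₂, map_zero] at h1
    have h2 : (aeval (AdjoinRoot.of f X ^ Fintype.card Fq) : Fq[X] →ₐ[Fq] R).toRingHom =
        (FiniteField.frobeniusAlgHom Fq R).toRingHom.comp
          (aeval (AdjoinRoot.of f X) : Fq[X] →ₐ[Fq] R).toRingHom := by
      refine ringHom_ext' (RingHom.ext fun c => ?_) ?_
      · simp
      · simp
    rw [h2]
    exact h1
  · rw [hfd, ← hcard]; exact hq

end Stepanov
end Polynomial

theorem Matrix.exists_det_submatrix_ne_zero {R m n : Type*} [CommRing R] [IsDomain R] [Fintype m]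
    [Fintype n] [DecidableEq n] (A : Matrix m n R) (hA : ∀ v, A.mulVec v = 0 → v = 0) :
    ∃ e : n → m, (A.submatrix e id).det ≠ 0 := by
  let K := FractionRing R
  let A' : Matrix m n K := A.map (algebraMap R K)
  have hli : LinearIndependent K A'.col := by
    rw [← LinearIndependent.iff_fractionRing R, Fintype.linearIndependent_iff]
    intro g hg
    refine fun i => congrFun (hA g ?_) i
    ext j
    apply IsFractionRing.injective R K
    have := congrFun hg j
    simp only [Finset.sum_apply, Pi.smul_apply, Matrix.col_apply, Pi.zero_apply] at this
    rw [Matrix.mulVec, dotProduct, Pi.zero_apply, map_zero, ← this, map_sum]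
    refine Finset.sum_congr rfl fun i _ => ?_
    rw [map_mul, mul_comm, Algebra.smul_def]
    rfl
  have hrank : Module.finrank K (Submodule.span K (Set.range A'.row)) = Fintype.card n := by
    rw [← Matrix.rank_eq_finrank_span_row, ← A'.rank_transpose]
    exact hli.rank_matrix
  obtain ⟨f, hf, -, hfli⟩ := Submodule.exists_fun_fin_finrank_span_eq K (Set.range A'.row)
  choose r hr using hf
  let e : n ≃ Fin (Module.finrank K (Submodule.span K (Set.range A'.row))) :=
    (Fintype.equivFin n).trans (finCongr hrank.symm)
  refine ⟨r ∘ e, fun h0 => ?_⟩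
  have hu : IsUnit (A'.submatrix (r ∘ e) id) := by
    rw [← Matrix.linearIndependent_rows_iff_isUnit]
    have h : (A'.submatrix (r ∘ e) id).row = f ∘ e := by
      ext i j
      exact congrFun (hr (e i)) j
    rw [h]
    exact hfli.comp e e.injective
  rw [Matrix.isUnit_iff_isUnit_det, isUnit_iff_ne_zero] at hu
  apply hu
  have : A'.submatrix (r ∘ e) id = (algebraMap R K).mapMatrix (A.submatrix (r ∘ e) id) := rfl
  rw [this, ← RingHom.map_det, h0, map_zero]

namespace Polynomial
open scoped Polynomial

section Newton
variable {R : Type*} [CommRing R]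

theorem eval_mem_of_coeff_mem {B : Subring R} {P : R[X]} (hP : ∀ i, P.coeff i ∈ B) {b : R}
    (hb : b ∈ B) : P.eval b ∈ B := by
  rw [eval_eq_sum_range]
  exact sum_mem fun i _ => mul_mem (hP i) (pow_mem hb i)

/-- Newton iteration: a root of `P` modulo `t` at which the derivative is invertible lifts to a root
modulo any power of `t`. -/
theorem exists_pow_dvd_eval {B : Subring R} {P : R[X]} (hP : ∀ i, P.coeff i ∈ B) {t b₀ c : R}
    (hb₀ : b₀ ∈ B) (hc : c ∈ B) (h0 : t ∣ P.eval b₀) (h1 : t ∣ 1 - c * P.derivative.eval b₀)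
    (n : ℕ) : ∃ b ∈ B, t ∣ b - b₀ ∧ t ^ (n + 1) ∣ P.eval b := by
  induction n with
  | zero => exact ⟨b₀, hb₀, by simp, by simpa using h0⟩
  | succ n ih =>
    obtain ⟨b, hb, hbt, r, hr⟩ := ih
    refine ⟨b - c * P.eval b, sub_mem hb (mul_mem hc (eval_mem_of_coeff_mem hP hb)), ?_, ?_⟩
    · rw [hr]
      have : b - c * (t ^ (n + 1) * r) - b₀ = (b - b₀) - t * (c * t ^ n * r) := by ring
      rw [this]
      exact dvd_sub hbt (dvd_mul_right _ _)
    · obtain ⟨k, hk⟩ := P.binomExpansion b (-(c * P.eval b))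
      obtain ⟨s, hs⟩ : t ∣ 1 - c * P.derivative.eval b := by
        have h2 : t ∣ P.derivative.eval b - P.derivative.eval b₀ :=
          hbt.trans (sub_dvd_eval_sub _ _ _)
        have : 1 - c * P.derivative.eval b = (1 - c * P.derivative.eval b₀) -
            c * (P.derivative.eval b - P.derivative.eval b₀) := by ring
        rw [this]
        exact dvd_sub h1 (h2.mul_left _)
      rw [sub_eq_add_neg, hk]
      have : P.eval b + P.derivative.eval b * -(c * P.eval b) + k * (-(c * P.eval b)) ^ 2 =
          P.eval b * (1 - c * P.derivative.eval b) + k * c ^ 2 * P.eval b ^ 2 := by ring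
      rw [this, hs, hr]
      exact ⟨r * s + k * c ^ 2 * t ^ n * r ^ 2, by ring⟩

end Newton

section CoeffDegree
variable {σ κ : Type*} [CommRing κ]

/-- Polynomials in `x` whose coefficient of `x ^ j` has total degree at most `j`. -/
def coeffDegreeSubring (σ κ : Type*) [CommRing κ] : Subring (MvPolynomial σ κ)[X] where
  carrier := {p | ∀ j, (p.coeff j).totalDegree ≤ j}
  mul_mem' hp hq j := by
    rw [coeff_mul]
    refine totalDegree_finsetSum_le fun t ht => (totalDegree_mul _ _).trans ?_
    rw [← Finset.HasAntidiagonal.mem_antidiagonal.1 ht]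
    exact add_le_add (hp _) (hq _)
  one_mem' j := by
    rw [coeff_one]; split_ifs <;> simp
  add_mem' hp hq j := by
    rw [coeff_add]
    exact (totalDegree_add _ _).trans (max_le (hp j) (hq j))
  zero_mem' j := by simp
  neg_mem' hp j := by
    rw [coeff_neg, totalDegree_neg]; exact hp j

theorem C_C_mem_coeffDegreeSubring (c : κ) :
    C (MvPolynomial.C c) ∈ coeffDegreeSubring σ κ := fun j => by
  rw [coeff_C]; split_ifs <;> simp

theorem X_mem_coeffDegreeSubring : X ∈ coeffDegreeSubring σ κ := fun j => by
  rw [coeff_X]; split_ifs <;> simp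

theorem C_X_mul_X_mem_coeffDegreeSubring [Nontrivial κ] (i : σ) :
    C (MvPolynomial.X i) * X ∈ coeffDegreeSubring σ κ := fun j => by
  rw [coeff_C_mul, coeff_X]
  split_ifs with h
  · rw [mul_one, totalDegree_X, h]
  · simp

/-- The restriction of polynomial functions to the generic line through `w`. -/
noncomputable def genericLine (w : σ → κ) : MvPolynomial σ κ →+* (MvPolynomial σ κ)[X] :=
  eval₂Hom (C.comp MvPolynomial.C) fun i => C (MvPolynomial.C (w i)) + C (MvPolynomial.X i) * X

theorem genericLine_mem [Nontrivial κ] (w : σ → κ) (p : MvPolynomial σ κ) :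
    genericLine w p ∈ coeffDegreeSubring σ κ := by
  induction p using MvPolynomial.induction_on with
  | C c => simpa [genericLine] using C_C_mem_coeffDegreeSubring c
  | add p q hp hq => rw [map_add]; exact add_mem hp hq
  | mul_X p i hp =>
    rw [map_mul]
    refine mul_mem hp ?_
    simpa [genericLine] using add_mem (C_C_mem_coeffDegreeSubring (w i))
      (C_X_mul_X_mem_coeffDegreeSubring i)

theorem natDegree_genericLine_le (w : σ → κ) (p : MvPolynomial σ κ) :
    (genericLine w p).natDegree ≤ p.totalDegree := by
  rw [genericLine, coe_eval₂Hom, eval₂_eq]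
  refine natDegree_sum_le_of_forall_le _ _ fun m hm => ?_
  rw [RingHom.comp_apply]
  refine (natDegree_C_mul_le _ _).trans ((natDegree_prod_le _ _).trans ?_)
  refine le_trans (Finset.sum_le_sum fun i _ => ?_) (le_totalDegree hm)
  refine natDegree_pow_le_of_le _ ?_ |>.trans (mul_one _).le
  refine natDegree_add_le_of_degree_le (by simp) (natDegree_C_mul_le _ _ |>.trans natDegree_X_le)

theorem coeff_zero_genericLine (w : σ → κ) (p : MvPolynomial σ κ) :
    (genericLine w p).coeff 0 = MvPolynomial.C (MvPolynomial.eval w p) := by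
  induction p using MvPolynomial.induction_on with
  | C c => simp [genericLine]
  | add p q hp hq => rw [map_add, coeff_add, map_add, map_add, hp, hq]
  | mul_X p i hp => rw [map_mul, mul_coeff_zero, hp]; simp [genericLine]

end CoeffDegree
end Polynomial

namespace Polynomial
open scoped Polynomial

section GenericLine
variable {σ κ : Type*} [Field κ]

/-- The endomorphism of `κ[u, x]` that sends `u` to `w + x u` and fixes `x`. -/
noncomputable def lineEndomorphism (w : σ → κ) :
    (MvPolynomial σ κ)[X] →+* (MvPolynomial σ κ)[X] :=
  eval₂RingHom (genericLine w) X

theorem lineEndomorphism_C (w : σ → κ) (p : MvPolynomial σ κ) :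
    lineEndomorphism w (C p) = genericLine w p := by simp [lineEndomorphism]

theorem lineEndomorphism_X (w : σ → κ) : lineEndomorphism w X = X := by simp [lineEndomorphism]

theorem lineEndomorphism_injective (w : σ → κ) : Function.Injective (lineEndomorphism w) := by
  let K := FractionRing (MvPolynomial σ κ)[X]
  let ι := algebraMap (MvPolynomial σ κ)[X] K
  have hι : Function.Injective ι := IsFractionRing.injective _ K
  have hX : ι X ≠ 0 := by
    rw [Ne, map_eq_zero_iff ι hι]; exact X_ne_zero
  let τ : (MvPolynomial σ κ)[X] →+* K := eval₂RingHom (eval₂Hom (ι.comp (C.comp MvPolynomial.C))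
    fun i => (ι (C (MvPolynomial.X i)) - ι (C (MvPolynomial.C (w i)))) / ι X) (ι X)
  have : τ.comp (lineEndomorphism w) = ι := by
    refine ringHom_ext' (MvPolynomial.ringHom_ext (fun c => ?_) fun i => ?_) ?_
    · simp [lineEndomorphism_C, genericLine, τ]
    · simp [lineEndomorphism_C, genericLine, τ, div_mul_cancel₀ _ hX]
    · simp [lineEndomorphism_X, τ]
  refine Function.Injective.of_comp (f := τ) ?_
  rw [← RingHom.coe_comp, this]
  exact hι

theorem exists_X_pow_mul_eq_lineEndomorphism (w : σ → κ) (p : (MvPolynomial σ κ)[X]) :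
    ∃ N r, X ^ N * p = lineEndomorphism w r := by
  induction p using Polynomial.induction_on' with
  | add p q hp hq =>
    obtain ⟨N, r, hr⟩ := hp
    obtain ⟨M, s, hs⟩ := hq
    refine ⟨N + M, X ^ M * r + X ^ N * s, ?_⟩
    simp only [map_add, map_mul, map_pow, lineEndomorphism_X, ← hr, ← hs]
    ring
  | monomial n a =>
    induction a using MvPolynomial.induction_on with
    | C c =>
      refine ⟨0, monomial n (MvPolynomial.C c), ?_⟩
      simp [← C_mul_X_pow_eq_monomial, lineEndomorphism_C, lineEndomorphism_X, genericLine]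
    | add a b ha hb =>
      obtain ⟨N, r, hr⟩ := ha
      obtain ⟨M, s, hs⟩ := hb
      refine ⟨N + M, X ^ M * r + X ^ N * s, ?_⟩
      simp only [map_add, map_mul, map_pow, lineEndomorphism_X, ← hr, ← hs]
      ring
    | mul_X a i ha =>
      obtain ⟨N, r, hr⟩ := ha
      refine ⟨N + 1, r * C (MvPolynomial.X i - MvPolynomial.C (w i)), ?_⟩
      have hi : lineEndomorphism w (C (MvPolynomial.X i - MvPolynomial.C (w i))) =
          C (MvPolynomial.X i) * X := by
        simp [lineEndomorphism_C, genericLine]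
      rw [map_mul (lineEndomorphism w), ← hr, hi, ← C_mul_X_pow_eq_monomial,
        ← C_mul_X_pow_eq_monomial, C_mul]
      ring

theorem exists_C_X_pow_mul_eq_map_lineEndomorphism (w : σ → κ) (p : (MvPolynomial σ κ)[X][X]) :
    ∃ N r, C (X ^ N) * p = map (lineEndomorphism w) r := by
  induction p using Polynomial.induction_on' with
  | add p q hp hq =>
    obtain ⟨N, r, hr⟩ := hp
    obtain ⟨M, s, hs⟩ := hq
    refine ⟨N + M, C (X ^ M) * r + C (X ^ N) * s, ?_⟩
    simp only [Polynomial.map_add, Polynomial.map_mul, map_C, map_pow (lineEndomorphism w),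
      lineEndomorphism_X, ← hr, ← hs, C_mul, pow_add]
    ring
  | monomial n a =>
    obtain ⟨N, r, hr⟩ := exists_X_pow_mul_eq_lineEndomorphism w a
    exact ⟨N, monomial n r, by rw [map_monomial, ← hr, C_mul_monomial]⟩

theorem irreducible_map_C {R : Type*} [CommRing R] [IsDomain R] [UniqueFactorizationMonoid R]
    {g : R[X]} (hg : Irreducible g) : Irreducible (g.map C) := by
  have h := (MulEquiv.prime_iff (Bivariate.swap (R := R))).2 (prime_C_iff.2 hg.prime)
  rw [Bivariate.swap_C] at h
  exact h.irreducible

theorem resultant_map_genericLine_ne_zero {g : (MvPolynomial σ κ)[X]} (hg : g.Monic)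
    (hirr : Irreducible g) (w : σ → κ) {h : (MvPolynomial σ κ)[X][X]} (h0 : h ≠ 0)
    (hdeg : h.natDegree < g.natDegree) : resultant (g.map (genericLine w)) h ≠ 0 := by
  obtain ⟨N, r, hr⟩ := exists_C_X_pow_mul_eq_map_lineEndomorphism w h
  have hinj := lineEndomorphism_injective w
  have hXN : (X ^ N : (MvPolynomial σ κ)[X]) ≠ 0 := pow_ne_zero _ X_ne_zero
  have hgm : (g.map C).map (lineEndomorphism w) = g.map (genericLine w) := by
    rw [Polynomial.map_map]
    congr 1
    exact RingHom.ext fun p => lineEndomorphism_C w p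
  have hr0 : r ≠ 0 := by
    rintro rfl
    rw [Polynomial.map_zero, mul_eq_zero, C_eq_zero] at hr
    exact hr.elim hXN h0
  have hrd : r.natDegree = h.natDegree := by
    rw [← natDegree_map_eq_of_injective hinj, ← hr, natDegree_C_mul hXN]
  have key := resultant_ne_zero_of_irreducible (hg.map C) (irreducible_map_C hirr) hr0
    (by rwa [hrd, hg.natDegree_map])
  intro h1
  apply key
  apply hinj
  rw [map_zero, ← resultant_map_map, hgm, ← hr, resultant_C_mul_right, hrd]
  rw [hg.natDegree_map] at h1 ⊢
  rw [h1, mul_zero]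

end GenericLine
end Polynomial

theorem Matrix.totalDegree_det_le {σ R n : Type*} [CommRing R] [Fintype n] [DecidableEq n]
    {A : Matrix n n (MvPolynomial σ R)} {k : ℕ} (hA : ∀ i j, (A i j).totalDegree ≤ k) :
    A.det.totalDegree ≤ Fintype.card n * k := by
  rw [Matrix.det_apply]
  refine totalDegree_finsetSum_le fun s _ => ?_
  have h : (∏ i, A (s i) i).totalDegree ≤ Fintype.card n * k := by
    refine (totalDegree_finsetProd _ _).trans ((Finset.sum_le_sum fun i _ => hA _ _).trans ?_)
    simp
  rcases Int.units_eq_one_or (Equiv.Perm.sign s) with h' | h' <;> simpa [h'] using h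

namespace Polynomial
open scoped Polynomial

section Swap
variable {S : Type*} [CommRing S]

theorem coeff_coeff_swap (p : S[X][X]) (i j : ℕ) :
    ((Bivariate.swap p).coeff i).coeff j = (p.coeff j).coeff i := by
  induction p using Polynomial.induction_on' with
  | add p q hp hq => simp only [map_add, coeff_add, hp, hq]
  | monomial n a =>
    induction a using Polynomial.induction_on' with
    | add a b ha hb => simp only [map_add, coeff_add, ha, hb]
    | monomial m c =>
      rw [Bivariate.swap_monomial_monomial]
      simp only [coeff_monomial]
      split_ifs <;> simp_all [coeff_monomial]

theorem natDegree_swap_le_iff {p : S[X][X]} {n : ℕ} :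
    (Bivariate.swap p).natDegree ≤ n ↔ ∀ i, (p.coeff i).natDegree ≤ n := by
  simp only [natDegree_le_iff_coeff_eq_zero, Polynomial.ext_iff, coeff_coeff_swap, coeff_zero]
  exact ⟨fun h i N hN => h N hN i, fun h N hN i => h i N hN⟩

theorem natDegree_coeff_le_of_mul [IsDomain S] {p q : S[X][X]} (hp : p ≠ 0) (hq : q ≠ 0) {n : ℕ}
    (h : ∀ i, ((p * q).coeff i).natDegree ≤ n) (i : ℕ) : (p.coeff i).natDegree ≤ n := by
  refine natDegree_swap_le_iff.1 ?_ i
  have h1 := natDegree_swap_le_iff.2 h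
  rw [map_mul, natDegree_mul (by simpa using hp) (by simpa using hq)] at h1
  omega

end Swap

section BoxSum
variable {S : Type*} [CommRing S] {d N : ℕ}

/-- The bivariate polynomial with prescribed coefficients in a box. -/
noncomputable def boxSum (v : Fin N × Fin d → S) : S[X][X] :=
  ∑ t, C (C (v t) * X ^ (t.1 : ℕ)) * X ^ (t.2 : ℕ)

theorem boxSum_mem_box (v : Fin N × Fin d → S) : boxSum v ∈ box S d N := by
  refine sum_mem fun t _ => ?_
  rw [C_mul, mul_assoc, ← algebraMap_eq, ← algebraMap_eq]
  rw [← IsScalarTower.algebraMap_apply S S[X] S[X][X], ← Algebra.smul_def]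
  exact Submodule.smul_mem _ _ (C_X_pow_mul_X_pow_mem_box t.1.2 t.2.2)

theorem coeff_coeff_boxSum (v : Fin N × Fin d → S) (t : Fin N × Fin d) :
    ((boxSum v).coeff t.2).coeff t.1 = v t := by
  simp only [boxSum, finsetSum_coeff, coeff_C_mul_X_pow]
  rw [Finset.sum_eq_single t]
  · simp
  · rintro ⟨a, b⟩ - hne
    split_ifs with h
    · rw [coeff_C_mul_X_pow, if_neg]
      exact fun h' => hne (Prod.ext (Fin.ext h'.symm) (Fin.ext h.symm))
    · simp
  · simp

theorem eq_boxSum_of_mem_box {p : S[X][X]} (hp : p ∈ box S d N) :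
    p = boxSum fun t : Fin N × Fin d => (p.coeff t.2).coeff t.1 := by
  ext i j
  by_cases hi : i < d
  · by_cases hj : j < N
    · exact (coeff_coeff_boxSum (fun t : Fin N × Fin d => (p.coeff t.2).coeff t.1)
        (⟨j, hj⟩, ⟨i, hi⟩)).symm
    · have : ∀ q ∈ box S d N, (q.coeff i).coeff j = 0 := fun q hq =>
        coeff_eq_zero_of_degree_lt ((mem_degreeLT.1 (hq i).1).trans_le
          (by exact_mod_cast not_lt.1 hj))
      rw [this p hp, this _ (boxSum_mem_box _)]
  · rw [(hp i).2 (not_lt.1 hi), (boxSum_mem_box _ i).2 (not_lt.1 hi)]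

theorem coeff_eval_boxSum (v : Fin N × Fin d → S) (b : S[X]) (j : ℕ) :
    ((boxSum v).eval b).coeff j =
      ∑ t : Fin N × Fin d, (X ^ (t.1 : ℕ) * b ^ (t.2 : ℕ)).coeff j * v t := by
  simp only [boxSum, eval_finsetSum, finsetSum_coeff, eval_mul, eval_C, eval_pow, eval_X]
  refine Finset.sum_congr rfl fun t _ => ?_
  rw [mul_assoc, coeff_C_mul, mul_comm]

end BoxSum

section Bertini
variable {σ κ : Type*} [Field κ]

/-- The restriction of polynomial functions to the line through `w` with direction `u`. -/
noncomputable def lineRestriction (w u : σ → κ) : MvPolynomial σ κ →+* κ[X] :=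
  eval₂Hom C fun i => C (w i) + C (u i) * X

theorem mapRingHom_comp_genericLine (w u : σ → κ) :
    (mapRingHom (MvPolynomial.eval u)).comp (genericLine w) = lineRestriction w u := by
  refine MvPolynomial.ringHom_ext (fun c => ?_) fun i => ?_ <;>
  simp [genericLine, lineRestriction]

theorem coeff_zero_eval_map_genericLine (w : σ → κ) (p : (MvPolynomial σ κ)[X])
    {b : (MvPolynomial σ κ)[X]} {β : κ} (hb : b.coeff 0 = MvPolynomial.C β) :
    ((p.map (genericLine w)).eval b).coeff 0 =
      MvPolynomial.C ((p.map (MvPolynomial.eval w)).eval β) := by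
  rw [← constantCoeff_apply, eval_map, hom_eval₂, constantCoeff_apply, hb, eval_map, hom_eval₂]
  congr 1
  exact RingHom.ext fun q => coeff_zero_genericLine w q

theorem eq_zero_of_X_pow_dvd_eval {g : (MvPolynomial σ κ)[X]} (hg : g.Monic)
    (hirr : Irreducible g) (hdeg : ∀ i, (g.coeff i).totalDegree ≤ g.natDegree) (w : σ → κ)
    {b : (MvPolynomial σ κ)[X]} {K : ℕ}
    (hK : (g.natDegree - 1) * g.natDegree + g.natDegree * g.natDegree < K)
    (hb : X ^ K ∣ (g.map (genericLine w)).eval b) {p : (MvPolynomial σ κ)[X][X]}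
    (hp : p ∈ box (MvPolynomial σ κ) g.natDegree (g.natDegree + 1)) (hpb : X ^ K ∣ p.eval b) :
    p = 0 := by
  by_contra h0
  have hpd : p.natDegree < g.natDegree :=
    (natDegree_lt_iff_degree_lt h0).2 (degree_lt_of_mem_box hp)
  have hres := resultant_map_genericLine_ne_zero hg hirr w h0 hpd
  have hmd : (g.map (genericLine w)).natDegree = g.natDegree := hg.natDegree_map _
  apply hres
  obtain ⟨r, s, -, -, hrs⟩ := exists_mul_add_mul_eq_C_resultant (g.map (genericLine w)) p
    le_rfl le_rfl (Or.inl (by omega))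
  have h1 := congrArg (eval b) hrs
  rw [eval_add, eval_mul, eval_mul, eval_C] at h1
  have h2 : X ^ K ∣ resultant (g.map (genericLine w)) p := by
    rw [← h1]
    exact dvd_add (hb.mul_right _) (hpb.mul_right _)
  refine eq_zero_of_dvd_of_natDegree_lt h2 ?_
  have h3 := resultant_mem_of_coeff_mem (degreeFiltration (MvPolynomial σ κ))
    (f := g.map (genericLine w)) (g := p) (m := (g.map (genericLine w)).natDegree)
    (n := p.natDegree) (a := g.natDegree) (b := g.natDegree)
    (fun i => mem_degreeFiltration.2 (by
      rw [coeff_map]; exact (natDegree_genericLine_le w _).trans (hdeg i)))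
    (fun i => mem_degreeFiltration.2 (by
      have := mem_degreeLT.1 (hp i).1
      rw [natDegree_le_iff_coeff_eq_zero]
      exact fun N hN => coeff_eq_zero_of_degree_lt (this.trans_le (Nat.cast_le.2 hN))))
  rw [mem_degreeFiltration] at h3
  rw [natDegree_X_pow]
  have : p.natDegree * g.natDegree ≤ (g.natDegree - 1) * g.natDegree :=
    Nat.mul_le_mul_right _ (by omega)
  have hmd' := congrArg (· * g.natDegree) hmd
  omega

/-- Effective Bertini theorem: restricting to a line whose direction avoids a hypersurface of
bounded degree preserves irreducibility. -/
theorem exists_irreducible_map_lineRestriction {g : (MvPolynomial σ κ)[X]} (hg : g.Monic)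
    (hirr : Irreducible g) (hdeg : ∀ i, (g.coeff i).totalDegree ≤ g.natDegree) (w : σ → κ) {β : κ}
    (hβ : (g.map (MvPolynomial.eval w)).eval β = 0)
    (hβ' : (g.derivative.map (MvPolynomial.eval w)).eval β ≠ 0) :
    ∃ D : MvPolynomial σ κ, D ≠ 0 ∧ D.totalDegree ≤ (g.natDegree + 1) * g.natDegree *
      ((g.natDegree - 1) * g.natDegree + g.natDegree * g.natDegree) ∧
      ∀ u, MvPolynomial.eval u D ≠ 0 → Irreducible (g.map (lineRestriction w u)) ∧
        derivative (g.map (lineRestriction w u)) ≠ 0 := by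
  classical
  obtain ⟨k, hk⟩ : ∃ k, k = (g.natDegree - 1) * g.natDegree + g.natDegree * g.natDegree :=
    ⟨_, rfl⟩
  set P := g.map (genericLine w) with hP
  have hPmem : ∀ i, P.coeff i ∈ coeffDegreeSubring σ κ := fun i => by
    rw [hP, coeff_map]; exact genericLine_mem w _
  have hC0 : (C (MvPolynomial.C β : MvPolynomial σ κ)).coeff 0 = MvPolynomial.C β := coeff_C_zero
  have hP' : derivative P = g.derivative.map (genericLine w) := derivative_map _ _
  obtain ⟨b, hbmem, hb0, hb⟩ := exists_pow_dvd_eval (t := X) (b₀ := C (MvPolynomial.C β))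
    (c := C (MvPolynomial.C ((g.derivative.map (MvPolynomial.eval w)).eval β)⁻¹)) hPmem
    (C_C_mem_coeffDegreeSubring _) (C_C_mem_coeffDegreeSubring _)
    (by rw [X_dvd_iff, coeff_zero_eval_map_genericLine w g hC0, hβ, map_zero])
    (by
      rw [X_dvd_iff, coeff_sub, coeff_C_mul, hP', coeff_zero_eval_map_genericLine w _ hC0,
        ← map_mul, inv_mul_cancel₀ hβ', coeff_one_zero, map_one, sub_self]) k
  have hbc : b.coeff 0 = MvPolynomial.C β := by
    rw [X_dvd_iff, coeff_sub, hC0, sub_eq_zero] at hb0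
    exact hb0
  let A : Matrix (Fin (k + 1)) (Fin (g.natDegree + 1) × Fin g.natDegree) (MvPolynomial σ κ) :=
    fun j t => (X ^ (t.1 : ℕ) * b ^ (t.2 : ℕ)).coeff j
  obtain ⟨e, he⟩ := A.exists_det_submatrix_ne_zero fun v hv => by
    have h0 : boxSum v = 0 := by
      refine eq_zero_of_X_pow_dvd_eval hg hirr hdeg w (K := k + 1) (by omega) hb
        (boxSum_mem_box v) ?_
      rw [X_pow_dvd_iff]
      intro j hj
      rw [coeff_eval_boxSum]
      exact congrFun hv ⟨j, hj⟩
    ext1 t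
    rw [← coeff_coeff_boxSum v t, h0]
    simp
  refine ⟨_, he, ?_, fun u hu => ?_⟩
  · refine (Matrix.totalDegree_det_le (k := k) fun i j => ?_).trans (by simp [hk])
    exact (mul_mem (pow_mem X_mem_coeffDegreeSubring _) (pow_mem hbmem _) _).trans
      (Nat.lt_succ_iff.1 (e i).2)
  let ε := mapRingHom (MvPolynomial.eval u)
  have hf : g.map (lineRestriction w u) = P.map ε := by
    rw [hP, Polynomial.map_map, mapRingHom_comp_genericLine]
  have hfm : (g.map (lineRestriction w u)).Monic := hg.map _
  have hfd : (g.map (lineRestriction w u)).natDegree = g.natDegree := hg.natDegree_map _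
  set f := g.map (lineRestriction w u)
  have hfb : X ^ (k + 1) ∣ f.eval (ε b) := by
    rw [hf, eval_map, eval₂_at_apply]
    have := _root_.map_dvd ε hb
    rwa [map_pow, coe_mapRingHom, map_X] at this
  have hinj : ∀ p ∈ box κ g.natDegree (g.natDegree + 1), X ^ (k + 1) ∣ p.eval (ε b) → p = 0 := by
    intro p hp hpb
    rw [eq_boxSum_of_mem_box hp] at hpb ⊢
    set v := fun t : Fin (g.natDegree + 1) × Fin g.natDegree => (p.coeff t.2).coeff t.1
    have hv : v = 0 := by
      refine Matrix.eq_zero_of_mulVec_eq_zero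
        (M := (MvPolynomial.eval u).mapMatrix (A.submatrix e id)) ?_ ?_
      · rwa [← RingHom.map_det]
      · ext i
        have h1 := X_pow_dvd_iff.1 hpb (e i) (e i).2
        rw [coeff_eval_boxSum] at h1
        rw [Pi.zero_apply, ← h1]
        refine Finset.sum_congr rfl fun t _ => ?_
        congr 1
        change MvPolynomial.eval u ((X ^ (t.1 : ℕ) * b ^ (t.2 : ℕ)).coeff (e i)) = _
        rw [← coeff_map]
        simp [ε]
    rw [hv]
    simp [boxSum]
  have hder : ¬ X ∣ f.derivative.eval (ε b) := by
    rw [hf, derivative_map, eval_map, eval₂_at_apply, X_dvd_iff, hP', coe_mapRingHom, coeff_map,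
      coeff_zero_eval_map_genericLine w _ hbc, MvPolynomial.eval_C]
    exact hβ'
  refine ⟨(hfm.irreducible_iff_natDegree).2 ⟨fun h1 => ?_, fun p r hp hr hpr => ?_⟩, fun h => ?_⟩
  · rw [h1] at hder
    simp at hder
  · by_contra! hne
    have hdeg' : ∀ i, (f.coeff i).natDegree ≤ g.natDegree := by
      intro i
      rw [hf, coeff_map, hP, coeff_map]
      exact natDegree_map_le.trans ((natDegree_genericLine_le w _).trans (hdeg i))
    have hsum : p.natDegree + r.natDegree = g.natDegree := by
      rw [← hfd, ← hpr, hp.natDegree_mul hr]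
    have hmem : ∀ p r : κ[X][X], p.Monic → r.Monic → p * r = f → p.natDegree < g.natDegree →
        p ∈ box κ g.natDegree (g.natDegree + 1) := by
      intro p r hp hr hpr hlt i
      refine ⟨mem_degreeLT.2 (degree_le_natDegree.trans_lt (Nat.cast_lt.2 (Nat.lt_succ_of_le ?_))),
        fun hi => coeff_eq_zero_of_natDegree_lt (by omega)⟩
      exact natDegree_coeff_le_of_mul hp.ne_zero hr.ne_zero (by rwa [hpr]) i
    have hfactor : ∀ p r : κ[X][X], p.Monic → r.Monic → p * r = f → p.natDegree < g.natDegree →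
        X ∣ r.eval (ε b) := by
      intro p r hp hr hpr hlt
      by_contra hX
      rw [← hpr, eval_mul] at hfb
      exact hp.ne_zero (hinj p (hmem p r hp hr hpr hlt)
        (prime_X.pow_dvd_of_dvd_mul_right _ hX hfb))
    apply hder
    rw [← hpr, derivative_mul, eval_add, eval_mul, eval_mul]
    exact dvd_add ((hfactor p r hp hr hpr (by omega)).mul_left _)
      ((hfactor r p hr hp (by rw [mul_comm, hpr]) (by omega)).mul_right _)
  · rw [h] at hder
    simp at hder

end Bertini
end Polynomial

namespace Polynomial
open scoped Polynomial

section Pderiv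
variable {σ κ : Type*} [Field κ]

theorem exists_pderiv_ne_zero (p : ℕ) [Fact p.Prime] [CharP κ p] [PerfectRing κ p]
    {G : MvPolynomial σ κ} (hG : Irreducible G) : ∃ i, MvPolynomial.pderiv i G ≠ 0 := by
  by_contra! h
  have hdvd : ∀ m, MvPolynomial.coeff m G ≠ 0 → ∀ i, p ∣ m i := by
    intro m hm i
    by_cases hmi : m i = 0
    · simp [hmi]
    have h1 := congrArg (MvPolynomial.coeff (m - Finsupp.single i 1)) (h i)
    have hle : Finsupp.single i 1 ≤ m := by
      rw [Finsupp.single_le_iff]; omega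
    rw [coeff_pderiv, tsub_add_cancel_of_le hle, MvPolynomial.coeff_zero, mul_eq_zero] at h1
    have h2 := h1.resolve_left hm
    rw [← CharP.cast_eq_zero_iff κ p, ← h2, Finsupp.tsub_apply, Finsupp.single_eq_same]
    rw [← Nat.cast_add_one, Nat.sub_add_cancel (by omega)]
  have hpow : (∑ m ∈ G.support, MvPolynomial.monomial (m.mapRange (· / p) (Nat.zero_div p))
      ((frobeniusEquiv κ p).symm (MvPolynomial.coeff m G))) ^ p = G := by
    rw [sum_pow_char]
    conv_rhs => rw [G.as_sum]
    refine Finset.sum_congr rfl fun m hm => ?_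
    rw [MvPolynomial.monomial_pow, frobeniusEquiv_symm_pow_p]
    congr 2
    ext i
    simpa using Nat.mul_div_cancel' (hdvd m (MvPolynomial.mem_support_iff.1 hm) i)
  rw [← hpow] at hG
  exact (not_irreducible_pow (Fact.out : p.Prime).ne_one) hG

theorem exists_eval_algebraMap_ne_zero [Finite σ] {Fq : Type*} [Field Fq] [Fintype Fq]
    [Algebra Fq κ] {p : MvPolynomial σ κ} (hp : p ≠ 0) (hcard : p.totalDegree < Fintype.card Fq) :
    ∃ x : σ → Fq, MvPolynomial.eval (fun i => algebraMap Fq κ (x i)) p ≠ 0 := by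
  classical
  by_contra! h
  refine hp (MvPolynomial.eq_zero_of_eval_zero_at_prod_finset p
    (fun _ => Finset.univ.image (algebraMap Fq κ)) (fun i => ?_) fun x hx => ?_)
  · rw [Finset.card_image_of_injective _ (algebraMap Fq κ).injective, Finset.card_univ]
    exact (degreeOf_le_totalDegree p i).trans_lt hcard
  · simp only [Finset.mem_image, Finset.mem_univ, true_and] at hx
    choose y hy using hx
    have hxy : x = fun i => algebraMap Fq κ (y i) :=
      _root_.funext fun i => (hy i).symm
    rw [hxy]
    exact h y

end Pderiv

section Shear
variable {σ κ : Type*} [CommRing κ]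

/-- The substitution `X i ↦ X i + Y i * T`, where `T` is a new variable. -/
noncomputable def shear (Y : σ → κ) : MvPolynomial σ κ →+* (MvPolynomial σ κ)[X] :=
  eval₂Hom (C.comp MvPolynomial.C) fun i => C (MvPolynomial.X i) + C (MvPolynomial.C (Y i)) * X

theorem coeff_zero_shear (Y : σ → κ) (p : MvPolynomial σ κ) : (shear Y p).coeff 0 = p := by
  induction p using MvPolynomial.induction_on with
  | C c => simp [shear]
  | add p q hp hq => rw [map_add, coeff_add, hp, hq]
  | mul_X p i hp => rw [map_mul, mul_coeff_zero, hp]; simp [shear]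

theorem shear_injective (Y : σ → κ) : Function.Injective (shear Y) :=
  fun p r h => by rw [← coeff_zero_shear Y p, h, coeff_zero_shear]

theorem map_shear {S : Type*} [CommRing S] (φ : κ →+* S) (Y : σ → κ) (p : MvPolynomial σ κ) :
    (shear Y p).map (MvPolynomial.map φ) = shear (φ ∘ Y) (MvPolynomial.map φ p) := by
  induction p using MvPolynomial.induction_on with
  | C c => simp [shear]
  | add p q hp hq => rw [map_add, Polynomial.map_add, map_add, map_add, hp, hq]
  | mul_X p i hp => rw [map_mul, Polynomial.map_mul, map_mul, map_mul, hp]; simp [shear]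

theorem irreducible_shear [IsDomain κ] [UniqueFactorizationMonoid κ] (Y : σ → κ)
    {p : MvPolynomial σ κ} (hp : Irreducible p) : Irreducible (shear Y p) := by
  have hcomp : ∀ Z : σ → κ,
      (eval₂RingHom (shear (-Z)) X).comp (eval₂RingHom (shear Z) X) = RingHom.id _ := by
    intro Z
    refine Polynomial.ringHom_ext' (MvPolynomial.ringHom_ext (fun c => ?_) fun i => ?_) ?_
    · simp [shear]
    · simp [shear, add_assoc, ← add_mul]
    · simp
  let α : (MvPolynomial σ κ)[X] ≃+* (MvPolynomial σ κ)[X] :=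
    RingEquiv.ofRingHom (eval₂RingHom (shear Y) X) (eval₂RingHom (shear (-Y)) X)
      (by simpa using hcomp (-Y)) (hcomp Y)
  have h := (MulEquiv.prime_iff α).2 (prime_C_iff.2 hp.prime)
  have : α (C p) = shear Y p := by simp [α]
  rw [this] at h
  exact h.irreducible

theorem derivative_shear [Fintype σ] (Y : σ → κ) (p : MvPolynomial σ κ) :
    derivative (shear Y p) = shear Y (∑ i, MvPolynomial.C (Y i) * MvPolynomial.pderiv i p) := by
  classical
  induction p using MvPolynomial.induction_on with
  | C c => simp [shear]
  | add p q hp hq => simp only [map_add, hp, hq, mul_add, Finset.sum_add_distrib]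
  | mul_X p j hp =>
    have hX : derivative (shear Y (MvPolynomial.X j)) = shear Y (MvPolynomial.C (Y j)) := by
      simp [shear]
    rw [map_mul, derivative_mul, hp, hX, ← map_mul, ← map_mul, ← map_add]
    congr 1
    simp only [pderiv_mul, pderiv_X, mul_add, Finset.sum_add_distrib, Finset.sum_mul]
    congr 1
    · exact Finset.sum_congr rfl fun i _ => by ring
    · rw [Finset.sum_eq_single j]
      · simp; ring
      · intro i _ hi
        simp [hi.symm]
      · simp

theorem totalDegree_aeval_le {τ : Type*} {f : σ → MvPolynomial τ κ}
    (hf : ∀ i, (f i).totalDegree ≤ 1) (p : MvPolynomial σ κ) :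
    (MvPolynomial.aeval f p).totalDegree ≤ p.totalDegree := by
  rw [MvPolynomial.aeval_def, eval₂_eq]
  refine totalDegree_finsetSum_le fun m hm => (totalDegree_mul _ _).trans ?_
  rw [MvPolynomial.algebraMap_eq, totalDegree_C, zero_add]
  refine (totalDegree_finsetProd _ _).trans ((Finset.sum_le_sum fun i _ => ?_).trans
    (le_totalDegree hm))
  exact (totalDegree_pow _ _).trans ((Nat.mul_le_mul_left _ (hf i)).trans (mul_one _).le)

theorem coeff_shear (Y : σ → κ) (p : MvPolynomial σ κ) (i : ℕ) :
    (shear Y p).coeff i = 0 ∨ ((shear Y p).coeff i).totalDegree + i ≤ p.totalDegree := by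
  let P : MvPolynomial (Option σ) κ := MvPolynomial.aeval
    (fun i => MvPolynomial.X (some i) + MvPolynomial.C (Y i) * MvPolynomial.X none) p
  have hP : shear Y p = optionEquivLeft κ σ P := by
    simp only [P]
    induction p using MvPolynomial.induction_on with
    | C c => simp [shear]
    | add p q hp hq => simp only [map_add, hp, hq]
    | mul_X p i hp => simp only [map_mul, hp]; simp [shear]
  have hPd : P.totalDegree ≤ p.totalDegree := by
    refine totalDegree_aeval_le (fun i => ?_) p
    cases subsingleton_or_nontrivial κ with
    | inl h => simp [Subsingleton.elim _ (0 : MvPolynomial (Option σ) κ)]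
    | inr h =>
      refine (totalDegree_add _ _).trans (max_le (totalDegree_X _).le ?_)
      refine (totalDegree_mul _ _).trans ?_
      rw [totalDegree_C, totalDegree_X, zero_add]
  rw [hP]
  rcases le_or_gt i P.totalDegree with hi | hi
  · exact Or.inr ((totalDegree_coeff_optionEquivLeft_add_le κ σ P i hi).trans hPd)
  · refine Or.inl (coeff_eq_zero_of_natDegree_lt ?_)
    rw [natDegree_optionEquivLeft]
    exact (degreeOf_le_totalDegree _ _).trans_lt hi

theorem natDegree_shear_le (Y : σ → κ) (p : MvPolynomial σ κ) :
    (shear Y p).natDegree ≤ p.totalDegree := by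
  rw [natDegree_le_iff_coeff_eq_zero]
  exact fun i hi => (coeff_shear Y p i).resolve_right (by omega)

theorem eval_zero_coeff_shear (Y : σ → κ) (p : MvPolynomial σ κ) (n : ℕ) :
    MvPolynomial.eval 0 ((shear Y p).coeff n) =
      MvPolynomial.eval Y (homogeneousComponent n p) := by
  induction p using MvPolynomial.induction_on' with
  | add p q hp hq => simp only [map_add, coeff_add, hp, hq]
  | monomial m a =>
    have h : (shear Y (MvPolynomial.monomial m a)).map (MvPolynomial.eval 0) =
        C (MvPolynomial.eval Y (MvPolynomial.monomial m a)) * X ^ m.degree := by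
      simp [shear, MvPolynomial.eval_monomial, Finsupp.prod, mul_pow,
        Finset.prod_mul_distrib, Polynomial.map_prod, Finset.prod_pow_eq_pow_sum,
        Finsupp.degree_apply, mul_assoc, map_prod]
    rw [← Polynomial.coeff_map, h, coeff_C_mul_X_pow]
    rw [homogeneousComponent_of_mem (isHomogeneous_monomial a rfl)]
    split_ifs <;> simp

theorem coeff_totalDegree_shear (Y : σ → κ) (p : MvPolynomial σ κ) :
    (shear Y p).coeff p.totalDegree =
      MvPolynomial.C (MvPolynomial.eval Y (homogeneousComponent p.totalDegree p)) := by
  have h : ((shear Y p).coeff p.totalDegree).totalDegree = 0 := by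
    rcases coeff_shear Y p p.totalDegree with h | h
    · rw [h, totalDegree_zero]
    · omega
  rw [← eval_zero_coeff_shear, totalDegree_eq_zero_iff_eq_C.1 h]
  simp

end Shear

section Line
variable {σ κ : Type*} [Field κ]

theorem natDegree_lineRestriction_le (w u : σ → κ) (p : MvPolynomial σ κ) :
    (lineRestriction w u p).natDegree ≤ p.totalDegree := by
  rw [lineRestriction, coe_eval₂Hom, eval₂_eq]
  refine natDegree_sum_le_of_forall_le _ _ fun m hm => ?_
  refine (natDegree_C_mul_le _ _).trans ((natDegree_prod_le _ _).trans ?_)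
  refine le_trans (Finset.sum_le_sum fun i _ => ?_) (le_totalDegree hm)
  refine natDegree_pow_le.trans ((Nat.mul_le_mul_left _ ?_).trans (mul_one _).le)
  compute_degree

theorem map_lineRestriction {S : Type*} [Field S] (φ : κ →+* S) (w u : σ → κ)
    (p : MvPolynomial σ κ) :
    (lineRestriction w u p).map φ = lineRestriction (φ ∘ w) (φ ∘ u) (MvPolynomial.map φ p) := by
  induction p using MvPolynomial.induction_on with
  | C c => simp [lineRestriction]
  | add p q hp hq => rw [map_add, Polynomial.map_add, map_add, map_add, hp, hq]
  | mul_X p i hp => rw [map_mul, Polynomial.map_mul, map_mul, map_mul, hp]; simp [lineRestriction]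

theorem evalEval_map_lineRestriction_shear (w u Y : σ → κ) (p : MvPolynomial σ κ) (a b : κ) :
    ((shear Y p).map (lineRestriction w u)).evalEval a b =
      MvPolynomial.eval (fun i => w i + a * u i + b * Y i) p := by
  induction p using MvPolynomial.induction_on with
  | C c => simp [lineRestriction, shear]
  | add p q hp hq => rw [map_add, Polynomial.map_add, evalEval_add, map_add, hp, hq]
  | mul_X p i hp =>
    rw [map_mul, Polynomial.map_mul, evalEval_mul, map_mul, hp]
    congr 1
    simp [lineRestriction, shear, evalEval]
    ring

end Line
end Polynomial

namespace Polynomial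
open scoped Polynomial

/-- The polynomials of bounded total degree, as a filtration. -/
noncomputable def totalDegreeFiltration (σ S : Type*) [CommRing S] (n : ℕ) :
    AddSubgroup (MvPolynomial σ S) :=
  (restrictTotalDegree σ S n).toAddSubgroup

theorem mem_totalDegreeFiltration {σ S : Type*} [CommRing S] {n : ℕ} {p : MvPolynomial σ S} :
    p ∈ totalDegreeFiltration σ S n ↔ p.totalDegree ≤ n :=
  MvPolynomial.mem_restrictTotalDegree σ n p

instance (σ S : Type*) [CommRing S] : SetLike.GradedMonoid (totalDegreeFiltration σ S) where
  one_mem := mem_totalDegreeFiltration.2 totalDegree_one.le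
  mul_mem _ _ _ _ hp hq := mem_totalDegreeFiltration.2 ((totalDegree_mul _ _).trans
    (add_le_add (mem_totalDegreeFiltration.1 hp) (mem_totalDegreeFiltration.1 hq)))

section Monic
variable {σ S : Type*} [CommRing S] {Y : σ → S} {H : MvPolynomial σ S}

theorem natDegree_shear [Nontrivial S]
    (hY : MvPolynomial.eval Y (homogeneousComponent H.totalDegree H) = 1) :
    (shear Y H).natDegree = H.totalDegree :=
  natDegree_eq_of_le_of_coeff_ne_zero (natDegree_shear_le Y H) (by
    rw [coeff_totalDegree_shear, hY, map_one]; exact one_ne_zero)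

theorem monic_shear (hY : MvPolynomial.eval Y (homogeneousComponent H.totalDegree H) = 1) :
    (shear Y H).Monic :=
  monic_of_natDegree_le_of_coeff_eq_one _ (natDegree_shear_le Y H) (by
    rw [coeff_totalDegree_shear, hY, map_one])

end Monic

/-- The resultant with the derivative controls the points over which a monic irreducible polynomial
is separable. -/
theorem exists_discriminant {σ κ : Type*} [Field κ] {g : (MvPolynomial σ κ)[X]} (hg : g.Monic)
    (hirr : Irreducible g) (hder : derivative g ≠ 0)
    (hdeg : ∀ i, (g.coeff i).totalDegree ≤ g.natDegree) :
    ∃ R : MvPolynomial σ κ, R ≠ 0 ∧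
      R.totalDegree ≤ (g.natDegree - 1) * g.natDegree + g.natDegree * g.natDegree ∧
      ∀ w β, MvPolynomial.eval w R ≠ 0 → (g.map (MvPolynomial.eval w)).eval β = 0 →
        (g.derivative.map (MvPolynomial.eval w)).eval β ≠ 0 := by
  have hpos : 0 < g.natDegree := by
    by_contra! h
    exact hder (derivative_of_natDegree_zero (by omega))
  have hlt : (derivative g).natDegree < g.natDegree := natDegree_derivative_lt hpos.ne'
  refine ⟨resultant g (derivative g), resultant_ne_zero_of_irreducible hg hirr hder hlt, ?_,
    fun w β hw h0 h1 => hw ?_⟩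
  · have h := resultant_mem_of_coeff_mem (totalDegreeFiltration σ κ) (f := g) (g := derivative g)
      (m := g.natDegree) (n := (derivative g).natDegree) (a := g.natDegree) (b := g.natDegree)
      (fun i => mem_totalDegreeFiltration.2 (hdeg i))
      (fun i => mem_totalDegreeFiltration.2 (by
        rw [coeff_derivative, ← Nat.cast_succ, ← MvPolynomial.C_eq_coe_nat]
        refine (totalDegree_mul _ _).trans ?_
        rw [totalDegree_C, add_zero]
        exact hdeg _))
    refine (mem_totalDegreeFiltration.1 h).trans (Nat.add_le_add_right ?_ _)
    exact Nat.mul_le_mul_right _ (by omega)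
  · obtain ⟨r, s, -, -, hrs⟩ := exists_mul_add_mul_eq_C_resultant g (derivative g)
      le_rfl le_rfl (Or.inl hpos.ne')
    have h := congrArg (fun p => (p.map (MvPolynomial.eval w)).eval β) hrs
    simpa [h0, h1] using h.symm

section Main
variable {κ : Type*} [Field κ] [IsAlgClosed κ] {Fq : Type*} [Field Fq] [Fintype Fq] [Algebra Fq κ]
  {σ : Type*} [Fintype σ]

/-- An irreducible hypersurface acquires a monic equation in a suitable direction. -/
theorem exists_monic_direction {G : MvPolynomial σ Fq}
    (hirr : Irreducible (MvPolynomial.map (algebraMap Fq κ) G))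
    (hq : G.totalDegree + 2 < Fintype.card Fq)
    {A : MvPolynomial σ κ} (hA : A ≠ 0) (hAd : A.totalDegree ≤ 1) :
    ∃ Y : σ → Fq, MvPolynomial.eval (algebraMap Fq κ ∘ Y) A ≠ 0 ∧
      MvPolynomial.eval Y (homogeneousComponent G.totalDegree G) ≠ 0 ∧
      derivative (shear (algebraMap Fq κ ∘ Y) (MvPolynomial.map (algebraMap Fq κ) G)) ≠ 0 := by
  obtain ⟨p, hp⟩ := CharP.exists Fq
  have : CharP κ p := charP_of_injective_algebraMap (algebraMap Fq κ).injective p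
  have : Fact p.Prime := ⟨CharP.char_is_prime Fq p⟩
  obtain ⟨i, hi⟩ := exists_pderiv_ne_zero p hirr
  obtain ⟨m, hm⟩ := MvPolynomial.ne_zero_iff.1 hi
  set G' := MvPolynomial.map (algebraMap Fq κ) G with hG'
  have hG0 : G ≠ 0 := by
    rintro rfl
    exact hirr.ne_zero (map_zero _)
  have hhom : homogeneousComponent G.totalDegree G ≠ 0 := by
    obtain ⟨s, hs, hsd⟩ := Finset.exists_mem_eq_sup _ (MvPolynomial.support_nonempty.2 hG0)
      fun s => s.sum fun _ e => e
    refine MvPolynomial.ne_zero_iff.2 ⟨s, ?_⟩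
    rw [coeff_homogeneousComponent, if_pos]
    · exact MvPolynomial.mem_support_iff.1 hs
    · rw [totalDegree, hsd]; rfl
  let B := MvPolynomial.map (algebraMap Fq κ) (homogeneousComponent G.totalDegree G)
  let L : MvPolynomial σ κ := ∑ j,
    MvPolynomial.C (MvPolynomial.coeff m (MvPolynomial.pderiv j G')) * MvPolynomial.X j
  have hB : B ≠ 0 :=
    (map_ne_zero_iff _ (MvPolynomial.map_injective _ (algebraMap Fq κ).injective)).2 hhom
  have hL : L ≠ 0 := by
    refine MvPolynomial.ne_zero_iff.2 ⟨Finsupp.single i 1, ?_⟩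
    classical
    simpa [L, MvPolynomial.coeff_sum, MvPolynomial.coeff_C_mul, MvPolynomial.coeff_X,
      Finsupp.single_left_inj] using hm
  have hBd : B.totalDegree ≤ G.totalDegree :=
    ((homogeneousComponent_isHomogeneous _ _).map _).totalDegree_le
  have hLd : L.totalDegree ≤ 1 := totalDegree_finsetSum_le fun j _ =>
    (totalDegree_mul _ _).trans (by rw [totalDegree_C, totalDegree_X])
  obtain ⟨Y, hY⟩ := exists_eval_algebraMap_ne_zero (Fq := Fq)
    (mul_ne_zero (mul_ne_zero hA hB) hL) (by
    have h1 := totalDegree_mul (A * B) L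
    have h2 := totalDegree_mul A B
    omega)
  rw [map_mul, map_mul, mul_ne_zero_iff, mul_ne_zero_iff] at hY
  refine ⟨Y, hY.1.1, fun h => hY.1.2 ?_, fun h => hY.2 ?_⟩
  · change MvPolynomial.eval (algebraMap Fq κ ∘ Y) _ = 0
    rw [← map_eval, h, map_zero]
  · rw [derivative_shear, map_eq_zero_iff _ (shear_injective _)] at h
    have h' := congrArg (MvPolynomial.coeff m) h
    simpa [L, MvPolynomial.coeff_sum, MvPolynomial.coeff_C_mul, mul_comm] using h'

/-- An absolutely irreducible hypersurface has a rational point on a plane spanned by directions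
that avoid prescribed hyperplanes. -/
theorem exists_eval_add_eq_zero {G : MvPolynomial σ Fq}
    (hirr : Irreducible (MvPolynomial.map (algebraMap Fq κ) G)) (hG : G.totalDegree ≠ 0)
    (hq : 6 * G.totalDegree ^ 4 + 1 ≤ Fintype.card Fq)
    {A : MvPolynomial σ Fq} (hA : A ≠ 0) (hAd : A.totalDegree ≤ 1) :
    ∃ Y : σ → Fq, MvPolynomial.eval Y A ≠ 0 ∧
      ∀ B : MvPolynomial σ Fq, B ≠ 0 → B.totalDegree ≤ 1 →
        ∃ w : σ → Fq, MvPolynomial.eval w B ≠ 0 ∧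
          ∀ E : MvPolynomial σ Fq, E ≠ 0 → E.totalDegree ≤ 1 →
            ∃ u : σ → Fq, MvPolynomial.eval u E ≠ 0 ∧
              ∃ a b : Fq, MvPolynomial.eval (fun i => w i + a * u i + b * Y i) G = 0 := by
  set φ := algebraMap Fq κ
  obtain ⟨δ, hδ⟩ : ∃ δ, δ = G.totalDegree := ⟨_, rfl⟩
  rw [← hδ] at hq hG
  have hδ1 : 1 ≤ δ := Nat.one_le_iff_ne_zero.2 hG
  obtain ⟨ε, rfl⟩ : ∃ ε, δ = ε + 1 := ⟨δ - 1, by omega⟩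
  have hne : ∀ {L : MvPolynomial σ Fq}, L ≠ 0 → MvPolynomial.map φ L ≠ 0 := fun hL =>
    (map_ne_zero_iff _ (MvPolynomial.map_injective _ φ.injective)).2 hL
  have hle : ∀ {L : MvPolynomial σ Fq}, L.totalDegree ≤ 1 →
      (MvPolynomial.map φ L).totalDegree ≤ 1 := fun hL =>
    (Finset.sup_mono (MvPolynomial.support_map_subset _ _)).trans hL
  have heval : ∀ {L : MvPolynomial σ Fq} {x : σ → Fq},
      MvPolynomial.eval (φ ∘ x) (MvPolynomial.map φ L) ≠ 0 → MvPolynomial.eval x L ≠ 0 :=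
    fun h h0 => h (by rw [← map_eval, h0, map_zero])
  obtain ⟨Y, hYA, hYG, hder⟩ := exists_monic_direction hirr
    (by rw [← hδ]; nlinarith [Nat.zero_le (ε ^ 2), Nat.zero_le (ε ^ 3), Nat.zero_le (ε ^ 4)])
    (hne hA) (hle hAd)
  refine ⟨Y, heval hYA, fun B hB hBd => ?_⟩
  set c := MvPolynomial.eval Y (homogeneousComponent G.totalDegree G)
  obtain ⟨H, hH⟩ : ∃ H, H = MvPolynomial.C c⁻¹ * G := ⟨_, rfl⟩
  have hu : IsUnit (MvPolynomial.C (φ c⁻¹) : MvPolynomial σ κ) := by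
    rw [MvPolynomial.isUnit_iff_eq_C_of_isReduced]
    exact ⟨_, (by simpa using hYG : φ c⁻¹ ≠ 0).isUnit, rfl⟩
  have hHG : MvPolynomial.map φ H = MvPolynomial.C (φ c⁻¹) * MvPolynomial.map φ G := by
    rw [hH, map_mul, MvPolynomial.map_C]
  have hHirr : Irreducible (MvPolynomial.map φ H) := by
    rwa [hHG, irreducible_isUnit_mul hu]
  have hHd : H.totalDegree = ε + 1 := by
    have hG0 : G ≠ 0 := by rintro rfl; simp at hδ
    rw [hH, totalDegree_mul_of_isDomain (by simpa using hYG) hG0, totalDegree_C, zero_add, hδ]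
  have hHY : MvPolynomial.eval Y (homogeneousComponent H.totalDegree H) = 1 := by
    rw [hHd, hδ, hH, homogeneousComponent_C_mul, map_mul, MvPolynomial.eval_C]
    exact inv_mul_cancel₀ hYG
  have hmon := monic_shear hHY
  have hnat := natDegree_shear hHY
  set g := (shear Y H).map (MvPolynomial.map φ) with hg
  have hgs : g = shear (φ ∘ Y) (MvPolynomial.map φ H) := map_shear _ _ _
  have hgm : g.Monic := hmon.map _
  have hgn : g.natDegree = ε + 1 := (hmon.natDegree_map _).trans (hnat.trans hHd)
  have hgirr : Irreducible g := by
    rw [hgs]; exact irreducible_shear _ hHirr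
  have hgd : derivative g ≠ 0 := by
    rw [hgs, hHG, map_mul]
    have : shear (φ ∘ Y) (MvPolynomial.C (φ c⁻¹)) = C (MvPolynomial.C (φ c⁻¹)) := by simp [shear]
    rw [this, derivative_C_mul]
    exact mul_ne_zero (C_ne_zero.2 hu.ne_zero) hder
  have hgdeg : ∀ i, (g.coeff i).totalDegree ≤ g.natDegree := by
    intro i
    rw [hgn, ← hHd, hg, coeff_map]
    refine (Finset.sup_mono (MvPolynomial.support_map_subset _ _)).trans ?_
    rcases coeff_shear Y H i with h | h
    · simp [h]
    · exact (Nat.le_add_right _ _).trans h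
  obtain ⟨R, hR0, hRd, hR⟩ := exists_discriminant hgm hgirr hgd hgdeg
  obtain ⟨w, hw⟩ := exists_eval_algebraMap_ne_zero (Fq := Fq) (mul_ne_zero hR0 (hne hB)) (by
    have h1 := totalDegree_mul R (MvPolynomial.map φ B)
    have h2 := hle hBd
    rw [hgn, Nat.add_sub_cancel] at hRd
    nlinarith [Nat.zero_le (ε ^ 2), Nat.zero_le (ε ^ 3), Nat.zero_le (ε ^ 4)])
  rw [map_mul, mul_ne_zero_iff] at hw
  refine ⟨w, heval hw.2, fun E hE hEd => ?_⟩
  obtain ⟨β, hβ⟩ := IsAlgClosed.exists_root (g.map (MvPolynomial.eval (φ ∘ w))) (by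
    rw [hgm.degree_map, degree_eq_natDegree hgm.ne_zero, hgn]
    exact_mod_cast hG)
  obtain ⟨D, hD0, hDd, hD⟩ := exists_irreducible_map_lineRestriction hgm hgirr hgdeg (φ ∘ w) hβ
    (hR _ _ hw.1 hβ)
  obtain ⟨u, hu⟩ := exists_eval_algebraMap_ne_zero (Fq := Fq) (mul_ne_zero hD0 (hne hE)) (by
    have h1 := totalDegree_mul D (MvPolynomial.map φ E)
    have h2 := hle hEd
    rw [hgn, Nat.add_sub_cancel] at hDd
    nlinarith [Nat.zero_le (ε ^ 2), Nat.zero_le (ε ^ 3), Nat.zero_le (ε ^ 4)])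
  rw [map_mul, mul_ne_zero_iff] at hu
  refine ⟨u, heval hu.2, ?_⟩
  obtain ⟨hfirr, hfder⟩ := hD _ hu.1
  set f₀ := (shear Y H).map (lineRestriction w u) with hf₀
  have hf : f₀.map (mapRingHom φ) = g.map (lineRestriction (φ ∘ w) (φ ∘ u)) := by
    ext1 i
    simp only [hf₀, hg, coeff_map, coe_mapRingHom, map_lineRestriction]
  have hf₀n : f₀.natDegree = ε + 1 := (hmon.natDegree_map _).trans (hnat.trans hHd)
  change Irreducible (g.map (lineRestriction (φ ∘ w) (φ ∘ u))) at hfirr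
  change derivative (g.map (lineRestriction (φ ∘ w) (φ ∘ u))) ≠ 0 at hfder
  rw [← hf] at hfirr hfder
  obtain ⟨a, b, hab⟩ := exists_evalEval_eq_zero (hmon.map _) hfirr hfder (fun i hi => by
    rw [hf₀n] at hi ⊢
    rw [coeff_map, ← hHd]
    rcases coeff_shear Y H i with h | h
    · rw [h, map_zero, natDegree_zero]; omega
    · exact (Nat.add_le_add_right (natDegree_lineRestriction_le _ _ _) _).trans h)
    (by rwa [hf₀n])
  refine ⟨a, b, ?_⟩
  rw [evalEval_map_lineRestriction_shear, hH, map_mul, MvPolynomial.eval_C] at hab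
  exact (mul_eq_zero.1 hab).resolve_left (inv_ne_zero hYG)

end Main
end Polynomial

theorem totalDegree_polyF_le {F : Type*} [CommRing F] {f1 f2 f3 : MvPolynomial (Fin 3) F} {d : ℕ}
    (h1 : f1.totalDegree ≤ d) (h2 : f2.totalDegree ≤ d) (h3 : f3.totalDegree ≤ d) :
    (polyF f1 f2 f3).totalDegree ≤ d + 1 := by
  have hX : ∀ i : Fin 6, (X i : MvPolynomial (Fin 6) F).totalDegree ≤ 1 := fun i => by
    cases subsingleton_or_nontrivial F with
    | inl h => simp [Subsingleton.elim (X i) (0 : MvPolynomial (Fin 6) F)]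
    | inr h => exact (totalDegree_X i).le
  have hterm : ∀ (i j : Fin 6) (f : MvPolynomial (Fin 3) F), f.totalDegree ≤ d →
      ((X i - X j) * (aeval ![(X 3 : MvPolynomial (Fin 6) F), X 4, X 5] f -
        aeval ![(X 0 : MvPolynomial (Fin 6) F), X 1, X 2] f)).totalDegree ≤ d + 1 := by
    intro i j f hf
    refine (totalDegree_mul _ _).trans ((add_le_add ((totalDegree_sub _ _).trans
      (max_le (hX i) (hX j))) ((totalDegree_sub _ _).trans (max_le ?_ ?_))).trans (add_comm 1 d).le)
    · refine (Polynomial.totalDegree_aeval_le (fun k => ?_) f).trans hf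
      fin_cases k <;> exact hX _
    · refine (Polynomial.totalDegree_aeval_le (fun k => ?_) f).trans hf
      fin_cases k <;> exact hX _
  exact (totalDegree_add _ _).trans (max_le ((totalDegree_add _ _).trans
    (max_le (hterm _ _ _ h3) (hterm _ _ _ h2))) (hterm _ _ _ h1))

theorem eval_polyF {F : Type*} [CommRing F] (f1 f2 f3 : MvPolynomial (Fin 3) F) (x : Fin 6 → F) :
    eval x (polyF f1 f2 f3) =
      (x 0 - x 3) * (eval ![x 3, x 4, x 5] f3 - eval ![x 0, x 1, x 2] f3) +
      (x 1 - x 4) * (eval ![x 3, x 4, x 5] f2 - eval ![x 0, x 1, x 2] f2) +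
      (x 2 - x 5) * (eval ![x 3, x 4, x 5] f1 - eval ![x 0, x 1, x 2] f1) := by
  have h : ∀ (i j k : Fin 6) (f : MvPolynomial (Fin 3) F),
      eval x (aeval ![(X i : MvPolynomial (Fin 6) F), X j, X k] f) = eval ![x i, x j, x k] f := by
    intro i j k f
    rw [aeval_def, ← coe_eval₂Hom, map_eval₂Hom, coe_eval₂Hom, eval, coe_eval₂Hom]
    congr 1
    · ext c
      simp
    · ext l
      fin_cases l <;> simp
  simp only [polyF, map_add, map_mul, map_sub, h, eval_X]

/-- A rational zero of `G` off the locus where both triples of coordinates coincide. -/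
theorem exists_eval_eq_zero_of_ne {Fq : Type*} [Field Fq] [Fintype Fq] {G : MvPolynomial (Fin 6) Fq}
    (hirr : Irreducible (map (algebraMap Fq (AlgebraicClosure Fq)) G)) (hG : G.totalDegree ≠ 0)
    (hq : 6 * G.totalDegree ^ 4 + 1 ≤ Fintype.card Fq) :
    ∃ x : Fin 6 → Fq, eval x G = 0 ∧ (x 0, x 1, x 2) ≠ (x 3, x 4, x 5) := by
  have hX : ∀ i : Fin 6, (X i : MvPolynomial (Fin 6) Fq) ∈ restrictTotalDegree (Fin 6) Fq 1 :=
    fun i => (mem_restrictTotalDegree _ _ _).2 (totalDegree_X i).le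
  have hne : ∀ {L : MvPolynomial (Fin 6) Fq} (i : Fin 6), eval (Pi.single i 1) L ≠ 0 → L ≠ 0 := by
    rintro L i h rfl
    exact h (map_zero _)
  obtain ⟨Y, hY, H⟩ := Polynomial.exists_eval_add_eq_zero hirr hG hq (A := X 3 - X 0)
    (hne 3 (by simp)) ((mem_restrictTotalDegree _ _ _).1 (sub_mem (hX 3) (hX 0)))
  simp only [map_sub, eval_X] at hY
  obtain ⟨w, hw, H⟩ := H ((Y 3 - Y 0) • (X 4 - X 1) - (Y 4 - Y 1) • (X 3 - X 0))
    (hne 4 (by simpa [smul_eval] using hY)) ((mem_restrictTotalDegree _ _ _).1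
      (sub_mem (Submodule.smul_mem _ _ (sub_mem (hX 4) (hX 1)))
        (Submodule.smul_mem _ _ (sub_mem (hX 3) (hX 0)))))
  simp only [map_sub, eval_X, smul_eval] at hw
  obtain ⟨u, hu, a, b, hab⟩ := H
    (((w 4 - w 1) * (Y 5 - Y 2) - (w 5 - w 2) * (Y 4 - Y 1)) • (X 3 - X 0) +
      ((w 5 - w 2) * (Y 3 - Y 0) - (w 3 - w 0) * (Y 5 - Y 2)) • (X 4 - X 1) -
      ((Y 3 - Y 0) * (w 4 - w 1) - (Y 4 - Y 1) * (w 3 - w 0)) • (X 5 - X 2))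
    (hne 5 (by simpa [smul_eval] using sub_ne_zero.2 (sub_ne_zero.1 hw).symm))
    ((mem_restrictTotalDegree _ _ _).1
      (sub_mem (add_mem (Submodule.smul_mem _ _ (sub_mem (hX 3) (hX 0)))
        (Submodule.smul_mem _ _ (sub_mem (hX 4) (hX 1))))
        (Submodule.smul_mem _ _ (sub_mem (hX 5) (hX 2)))))
  simp only [map_sub, map_add, eval_X, smul_eval] at hu
  refine ⟨_, hab, fun h => ?_⟩
  simp only [Prod.mk.injEq] at h
  obtain ⟨h0, h1, h2⟩ := h
  have ha : a = 0 := by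
    refine (mul_eq_zero.1 ?_).resolve_right hu
    linear_combination
      -((w 4 - w 1) * (Y 5 - Y 2) - (w 5 - w 2) * (Y 4 - Y 1)) * h0 -
      ((w 5 - w 2) * (Y 3 - Y 0) - (w 3 - w 0) * (Y 5 - Y 2)) * h1 +
      ((Y 3 - Y 0) * (w 4 - w 1) - (Y 4 - Y 1) * (w 3 - w 0)) * h2
  apply hw
  rw [ha] at h0 h1
  linear_combination (Y 4 - Y 1) * h0 - (Y 3 - Y 0) * h1

/-- Theorem 2.4 of the paper. If `q > 6.3·(d+1)^(13/3)` and the hypersurface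
`S_{f1,f2,f3}` contains an absolutely irreducible component defined over `F_q`, then
`O_7(f1,f2,f3)` is not an ovoid of `Q`. -/
theorem statement0 {q d : ℕ} (Fq : Type*) [Field Fq] [Fintype Fq]
    (hcard : Fintype.card Fq = q)
    (f1 f2 f3 : MvPolynomial (Fin 3) Fq)
    (h01 : eval (fun _ => (0 : Fq)) f1 = 0)
    (h02 : eval (fun _ => (0 : Fq)) f2 = 0)
    (h03 : eval (fun _ => (0 : Fq)) f3 = 0)
    (hd : max (max f1.totalDegree f2.totalDegree) f3.totalDegree = d)
    (hq : (6.3 : ℝ) * ((d : ℝ) + 1) ^ ((13 : ℝ) / 3) < (q : ℝ))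
    (hcomp : ∃ G : MvPolynomial (Fin 6) Fq, G.totalDegree ≠ 0 ∧ G ∣ polyF f1 f2 f3 ∧
      Irreducible (MvPolynomial.map (algebraMap Fq (AlgebraicClosure Fq)) G)) :
    ¬ ovoidCondition (fun x y z => eval ![x, y, z] f1)
        (fun x y z => eval ![x, y, z] f2)
        (fun x y z => eval ![x, y, z] f3) := by
  suffices h : ∃ x : Fin 6 → Fq, eval x (polyF f1 f2 f3) = 0 ∧ (x 0, x 1, x 2) ≠ (x 3, x 4, x 5) by
    obtain ⟨x, hx, hne⟩ := h
    rw [eval_polyF] at hx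
    exact fun hov => hov _ _ _ _ _ _ hne hx
  by_cases h0 : polyF f1 f2 f3 = 0
  · exact ⟨Pi.single 0 1, by rw [h0, map_zero], by simp⟩
  obtain ⟨G, hG, hdvd, hirr⟩ := hcomp
  have hGd : G.totalDegree ≤ d + 1 := by
    refine (totalDegree_le_of_dvd_of_isDomain hdvd h0).trans (totalDegree_polyF_le ?_ ?_ ?_) <;>
    omega
  have hcard' : 6 * G.totalDegree ^ 4 + 1 ≤ Fintype.card Fq := by
    rw [hcard]
    have h1 : ((d : ℝ) + 1) ^ (4 : ℕ) ≤ ((d : ℝ) + 1) ^ ((13 : ℝ) / 3) := by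
      rw [← Real.rpow_natCast]
      exact Real.rpow_le_rpow_of_exponent_le (by simp) (by norm_num)
    have h2 : (6 * (d + 1) ^ 4 : ℝ) < q := by
      have : (0 : ℝ) ≤ ((d : ℝ) + 1) ^ (4 : ℕ) := by positivity
      linarith
    have h3 : 6 * (d + 1) ^ 4 < q := by exact_mod_cast h2
    have h4 := Nat.pow_le_pow_left hGd 4
    omega
  obtain ⟨x, hx, hne⟩ := exists_eval_eq_zero_of_ne hirr hG hcard'
  obtain ⟨r, hr⟩ := hdvd
  exact ⟨x, by rw [hr, map_mul, hx, zero_mul], hne⟩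
end

section
/- Let q be a prime power with q > 6.3·4^(13/3), and let f1, f2, f3 ∈ F_q[X,Y,Z] have degree 3 and satisfy f_i(0,0,0) = 0. If the degree-4 homogenization F*(X0,X1,...,X6) of F with respect to a new variable X0 factors in K[X0,X1,...,X6], where K is an algebraic closure of F_q, as a product of four homogeneous linear forms (i.e., the hypersurface S_{f1,f2,f3} splits into four hyperplanes), then the ovoid condition fails, i.e., O_7(f1,f2,f3) is not an ovoid of Q. -/
open MvPolynomial

open scoped Matrix

/-- Second differences in both variables annihilate sums of functions that are affine in `s` or
in `t`, but not `s ^ 2 * t ^ 2`. -/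
lemma eq_zero_of_sum_eq_sq_mul {K : Type*} [Field K] [Infinite K] (A B C D : K → K) (x y z : K)
    (h : ∀ s t, A s + B t + t * C s + s * D t = t ^ 2 * s * (s * x + t * y + z)) : x = 0 := by
  classical
  obtain ⟨l, hl⟩ := Infinite.exists_notMem_finset ({0, 1} : Finset K)
  simp only [Finset.mem_insert, Finset.mem_singleton, not_or] at hl
  have hl1 : l - 1 ≠ 0 := sub_ne_zero.2 hl.2
  have key : (l * (l - 1)) ^ 2 * x = 0 := by
    linear_combination -(
      (l - 1) * ((l - 1) * h 0 0 - l * h 0 1 + h 0 l)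
        - l * ((l - 1) * h 1 0 - l * h 1 1 + h 1 l)
        + ((l - 1) * h l 0 - l * h l 1 + h l l))
  simpa [hl.1, hl1] using key

lemma exists_eq_smul_of_cross_eq_zero {K : Type*} [Field K] {x a : Fin 3 → K} (ha : a ≠ 0)
    (h : x ⨯₃ a = 0) : ∃ r : K, x = r • a := by
  obtain ⟨j, hj⟩ := Function.ne_iff.1 ha
  refine ⟨x j / a j, ?_⟩
  have h0 := congrFun h 0
  have h1 := congrFun h 1
  have h2 := congrFun h 2
  simp only [cross_apply, Matrix.cons_val_zero, Matrix.cons_val_one, Matrix.cons_val,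
    Pi.zero_apply] at h0 h1 h2 hj
  ext i
  simp only [Pi.smul_apply, smul_eq_mul]
  rw [div_mul_eq_mul_div, eq_div_iff hj]
  fin_cases i <;> fin_cases j <;> simp <;>
    first
      | linear_combination h0 | linear_combination h1 | linear_combination h2
      | linear_combination -h0 | linear_combination -h1 | linear_combination -h2

/-- A vector orthogonal to three vectors with nonzero triple product is zero. -/
lemma eq_zero_of_dotProduct_cross_eq_zero {K : Type*} [Field K] {a b c α : Fin 3 → K}
    (hd : a ⬝ᵥ b ⨯₃ c ≠ 0) (ha : α ⬝ᵥ b ⨯₃ c = 0) (hb : α ⬝ᵥ c ⨯₃ a = 0)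
    (hc : α ⬝ᵥ a ⨯₃ b = 0) : α = 0 := by
  have key : ∀ i, (a ⬝ᵥ b ⨯₃ c) * α i = 0 := by
    intro i
    have : (a ⬝ᵥ b ⨯₃ c) * α i
        = (α ⬝ᵥ b ⨯₃ c) * a i + (α ⬝ᵥ c ⨯₃ a) * b i + (α ⬝ᵥ a ⨯₃ b) * c i := by
      fin_cases i <;> simp [cross_apply, dotProduct, Fin.sum_univ_three] <;> ring
    rw [this, ha, hb, hc]
    ring
  ext i
  simpa [hd] using key i

section Factor

variable {K : Type*} [Field K] [Infinite K]

/-- A product of affine functions vanishes identically only if one of them does. -/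
lemma exists_forall_eq_zero_of_prod_eq_zero {V ι : Type*} [AddCommGroup V] [Module K V]
    (s : Finset ι) (f : ι → V → K)
    (hf : ∀ i x y (t : K), f i (x + t • (y - x)) = f i x + t * (f i y - f i x))
    (h : ∀ x, ∏ i ∈ s, f i x = 0) : ∃ i ∈ s, ∀ x, f i x = 0 := by
  classical
  by_contra! hne
  suffices ∃ x, ∀ i ∈ s, f i x ≠ 0 by
    obtain ⟨x, hx⟩ := this
    exact Finset.prod_ne_zero_iff.2 hx (h x)
  clear h
  induction s using Finset.induction_on with
  | empty => exact ⟨0, by simp⟩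
  | insert i s hi ih =>
    obtain ⟨x, hx⟩ := ih fun j hj => hne j (Finset.mem_insert_of_mem hj)
    obtain ⟨y, hy⟩ := hne i (Finset.mem_insert_self i s)
    let P : Polynomial K := ∏ j ∈ insert i s,
      (Polynomial.C (f j x) + Polynomial.X * Polynomial.C (f j y - f j x))
    have hP : P ≠ 0 := by
      refine Finset.prod_ne_zero_iff.2 fun j hj h0 => ?_
      have e0 := congrArg (Polynomial.eval 0) h0
      have e1 := congrArg (Polynomial.eval 1) h0
      simp only [Polynomial.eval_add, Polynomial.eval_C, Polynomial.eval_mul, Polynomial.eval_X,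
        Polynomial.eval_zero, zero_mul, add_zero, one_mul, add_sub_cancel] at e0 e1
      rcases Finset.mem_insert.1 hj with rfl | hj
      · exact hy e1
      · exact hx j hj e0
    obtain ⟨t, ht⟩ : ∃ t, P.eval t ≠ 0 := by
      by_contra! h0
      exact hP (Polynomial.funext fun t => by simp [h0 t])
    refine ⟨x + t • (y - x), fun j hj => ?_⟩
    rw [Polynomial.eval_prod] at ht
    have := Finset.prod_ne_zero_iff.1 ht j hj
    rw [hf]
    simpa using this

/-- If a product of affine functions of `(u, v)` vanishes whenever `u - v` is orthogonal to `a`,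
then some factor is a linear form in `u - v` with coefficient vector parallel to `a`. -/
lemma exists_factor_of_vanishing {ι : Type*} [Fintype ι] (α β : ι → Fin 3 → K) (γ : ι → K)
    (a : Fin 3 → K)
    (h : ∀ v y : Fin 3 → K, ∏ i, (γ i + α i ⬝ᵥ (v + a ⨯₃ y) + β i ⬝ᵥ v) = 0) :
    ∃ i, γ i = 0 ∧ β i = -α i ∧ α i ⨯₃ a = 0 := by
  obtain ⟨i, -, hi⟩ := exists_forall_eq_zero_of_prod_eq_zero Finset.univ
    (fun i (p : (Fin 3 → K) × (Fin 3 → K)) => γ i + α i ⬝ᵥ (p.1 + a ⨯₃ p.2) + β i ⬝ᵥ p.1)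
    (fun i x y t => by
      simp only [Prod.fst_add, Prod.snd_add, Prod.smul_fst, Prod.smul_snd, Prod.fst_sub,
        Prod.snd_sub, map_add, map_sub, map_smul, dotProduct_add, dotProduct_sub,
        dotProduct_smul, smul_eq_mul]
      ring)
    (fun p => h p.1 p.2)
  have hγ : γ i = 0 := by simpa using hi (0, 0)
  refine ⟨i, hγ, ?_, ?_⟩
  · rw [eq_neg_iff_add_eq_zero, add_comm]
    refine dotProduct_eq_zero _ fun v => ?_
    simpa [hγ, add_dotProduct] using hi (v, 0)
  · refine dotProduct_eq_zero _ fun y => ?_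
    have := hi (0, y)
    simp only [hγ, zero_add, dotProduct_zero, add_zero] at this
    rw [← this]
    simp [cross_apply, dotProduct, Fin.sum_univ_three]
    ring

end Factor

section Difference

variable {K : Type*} [Field K] [Infinite K]

/-- The part of bidegree `(2, 2)` of `(u - v) ⬝ᵥ (g v - g u)` vanishes. -/
lemma dotProduct_cross_eq_zero_of_factor (g : (Fin 3 → K) → Fin 3 → K) {a b c α β : Fin 3 → K}
    {γ : K} (hd : a ⬝ᵥ b ⨯₃ c ≠ 0)
    (h : ∀ u v, (u - v) ⬝ᵥ (g v - g u)
      = (a ⬝ᵥ (u - v)) * (b ⬝ᵥ (u - v)) * (c ⬝ᵥ (u - v)) * (γ + α ⬝ᵥ u + β ⬝ᵥ v)) :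
    α ⬝ᵥ a ⨯₃ b = 0 := by
  set d := a ⬝ᵥ b ⨯₃ c with hdef
  set e := a ⨯₃ b with he
  set f := b ⨯₃ c + c ⨯₃ a with hf
  have ae : a ⬝ᵥ e = 0 := dot_self_cross a b
  have be : b ⬝ᵥ e = 0 := dot_cross_self a b
  have ce : c ⬝ᵥ e = d := by rw [hdef, he, triple_product_permutation]
  have af : a ⬝ᵥ f = d := by rw [hf, dotProduct_add, dot_cross_self, add_zero]
  have bf : b ⬝ᵥ f = d := by
    rw [hf, dotProduct_add, dot_self_cross, zero_add, hdef, triple_product_permutation a]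
  have cf : c ⬝ᵥ f = 0 := by rw [hf, dotProduct_add, dot_self_cross, dot_cross_self, zero_add]
  have key := eq_zero_of_sum_eq_sq_mul
    (fun s => -(s * (e ⬝ᵥ g (s • e)))) (fun t => -(t * (f ⬝ᵥ g (t • f))))
    (fun s => f ⬝ᵥ g (s • e)) (fun t => e ⬝ᵥ g (t • f))
    (d ^ 3 * α ⬝ᵥ e) (d ^ 3 * β ⬝ᵥ f) (d ^ 3 * γ) (fun s t => by
      have := h (s • e) (t • f)
      simp only [dotProduct_sub, sub_dotProduct, smul_dotProduct, dotProduct_smul, smul_eq_mul,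
        ae, be, ce, af, bf, cf] at this
      linear_combination this)
  simpa [hd] using key

lemma coeff_eq_zero_of_factor (g : (Fin 3 → K) → Fin 3 → K) {a b c α β : Fin 3 → K}
    {γ : K} (hd : a ⬝ᵥ b ⨯₃ c ≠ 0)
    (h : ∀ u v, (u - v) ⬝ᵥ (g v - g u)
      = (a ⬝ᵥ (u - v)) * (b ⬝ᵥ (u - v)) * (c ⬝ᵥ (u - v)) * (γ + α ⬝ᵥ u + β ⬝ᵥ v)) :
    α = 0 := by
  have hd1 : b ⬝ᵥ c ⨯₃ a ≠ 0 := by rwa [← triple_product_permutation]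
  have hd2 : c ⬝ᵥ a ⨯₃ b ≠ 0 := by rwa [← triple_product_permutation]
  refine eq_zero_of_dotProduct_cross_eq_zero hd ?_ ?_ ?_
  · exact dotProduct_cross_eq_zero_of_factor g (β := β) (γ := γ) hd1 fun u v => by rw [h]; ring
  · exact dotProduct_cross_eq_zero_of_factor g (β := β) (γ := γ) hd2 fun u v => by rw [h]; ring
  · exact dotProduct_cross_eq_zero_of_factor g hd h

lemma coeffs_eq_zero_of_factor (g : (Fin 3 → K) → Fin 3 → K) {a b c α β : Fin 3 → K}
    {γ : K} (hd : a ⬝ᵥ b ⨯₃ c ≠ 0)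
    (h : ∀ u v, (u - v) ⬝ᵥ (g v - g u)
      = (a ⬝ᵥ (u - v)) * (b ⬝ᵥ (u - v)) * (c ⬝ᵥ (u - v)) * (γ + α ⬝ᵥ u + β ⬝ᵥ v)) :
    α = 0 ∧ β = 0 := by
  refine ⟨coeff_eq_zero_of_factor g hd h, neg_eq_zero.1 ?_⟩
  refine coeff_eq_zero_of_factor g (β := -α) (γ := -γ) hd fun u v => ?_
  have := h v u
  simp only [dotProduct_sub, sub_dotProduct, neg_dotProduct] at this ⊢
  linear_combination this

end Difference

section Homogeneous

lemma aeval_smul_of_isHomogeneous {σ R A : Type*} [CommSemiring R] [CommSemiring A]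
    [Algebra R A] {p : MvPolynomial σ R} {n : ℕ} (hp : p.IsHomogeneous n) (t : A) (v : σ → A) :
    aeval (t • v) p = t ^ n * aeval v p := by
  rw [aeval_def, aeval_def, eval₂_eq, eval₂_eq, Finset.mul_sum]
  refine Finset.sum_congr rfl fun d hd => ?_
  have : ∑ i ∈ d.support, d i = n := by
    have := hp (mem_support_iff.1 hd)
    simpa [Finsupp.weight_apply, Finsupp.sum] using this
  simp only [Pi.smul_apply, smul_eq_mul, mul_pow, Finset.prod_mul_distrib,
    Finset.prod_pow_eq_pow_sum, this]
  ring

/-- If `p` is quadratic along every line through the origin, it has no cubic part. -/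
lemma homogeneousComponent_three_eq_zero {σ F K : Type*} [Field F] [Field K] [Infinite K]
    [Algebra F K] {p : MvPolynomial σ F} (hp : p.totalDegree ≤ 3)
    (h : ∀ v : σ → K, ∃ x y z : K, ∀ t : K, aeval (t • v) p = x + y * t + z * t ^ 2) :
    homogeneousComponent 3 p = 0 := by
  refine map_injective _ (algebraMap F K).injective (MvPolynomial.funext fun v => ?_)
  rw [map_zero, map_zero, eval_map, ← aeval_def]
  obtain ⟨x, y, z, hxyz⟩ := h v
  have hsum : ∑ i ∈ Finset.range 4, homogeneousComponent i p = p := by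
    conv_rhs => rw [← sum_homogeneousComponent p]
    symm
    refine Finset.sum_subset (fun i hi => ?_) fun i _ hi => ?_
    · simp only [Finset.mem_range] at hi ⊢
      omega
    · simp only [Finset.mem_range] at hi
      exact homogeneousComponent_eq_zero _ _ (by omega)
  let P : Polynomial K := ∑ i ∈ Finset.range 4,
    Polynomial.C (aeval v (homogeneousComponent i p)) * Polynomial.X ^ i
  have hP : P = Polynomial.C x + Polynomial.C y * Polynomial.X
      + Polynomial.C z * Polynomial.X ^ 2 := by
    refine Polynomial.funext fun t => ?_
    simp only [P, Polynomial.eval_finsetSum, Polynomial.eval_mul, Polynomial.eval_C,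
      Polynomial.eval_pow, Polynomial.eval_X, Polynomial.eval_add]
    rw [← hxyz t]
    conv_rhs => rw [← hsum, map_sum]
    refine Finset.sum_congr rfl fun i _ => ?_
    rw [aeval_smul_of_isHomogeneous (homogeneousComponent_isHomogeneous i p), mul_comm]
  have := congrArg (Polynomial.coeff · 3) hP
  simpa only [P, Polynomial.finsetSum_coeff, Polynomial.coeff_C_mul_X_pow,
    Polynomial.coeff_add, Polynomial.coeff_C, Polynomial.coeff_C_mul_X, OfNat.ofNat_ne_zero,
    OfNat.ofNat_ne_one, if_false, Nat.reduceEqDiff, add_zero, Finset.sum_ite_eq,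
    Finset.mem_range, Nat.reduceLT, if_true] using this

lemma totalDegree_ne_of_homogeneousComponent_eq_zero {σ F : Type*} [CommSemiring F]
    {p : MvPolynomial σ F} {n : ℕ} (hn : n ≠ 0) (h : homogeneousComponent n p = 0) :
    p.totalDegree ≠ n := by
  rintro rfl
  have hp : p.support.Nonempty := by
    rw [Finset.nonempty_iff_ne_empty, Ne, support_eq_empty]
    rintro rfl
    simp at hn
  obtain ⟨d, hd, hdeg⟩ := Finset.exists_mem_eq_sup p.support hp fun s => s.sum fun _ e => e
  have := congrArg (coeff d) h
  rw [coeff_homogeneousComponent, coeff_zero, if_pos] at this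
  · exact mem_support_iff.1 hd this
  · exact hdeg.symm

/-- A difference `(u - v) ⬝ᵥ (g v - g u)` with `g` of degree three is not a product of three linear
forms in `u - v`. -/
lemma totalDegree_ne_three_of_factor {F K : Type*} [Field F] [Field K] [Infinite K] [Algebra F K]
    (g : Fin 3 → MvPolynomial (Fin 3) F) (hg : ∀ i, (g i).totalDegree ≤ 3) {a b c : Fin 3 → K}
    {γ : K}
    (h : ∀ u v : Fin 3 → K, (u - v) ⬝ᵥ ((fun i => aeval v (g i)) - fun i => aeval u (g i))
      = (a ⬝ᵥ (u - v)) * (b ⬝ᵥ (u - v)) * (c ⬝ᵥ (u - v)) * γ) (i : Fin 3) :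
    (g i).totalDegree ≠ 3 := by
  refine totalDegree_ne_of_homogeneousComponent_eq_zero three_ne_zero
    (homogeneousComponent_three_eq_zero (K := K) (hg i) fun v => ?_)
  let u : Fin 3 → K := Pi.single i 1
  let G : (Fin 3 → K) → Fin 3 → K := fun v j => aeval v (g j)
  have hG : ∀ t : K, aeval (t • v) (g i) = u ⬝ᵥ G (t • v) := fun t => by
    simp [u, G]
  let A := a ⬝ᵥ u
  let A' := a ⬝ᵥ v
  let B := b ⬝ᵥ u
  let B' := b ⬝ᵥ v
  let C := c ⬝ᵥ u
  let C' := c ⬝ᵥ v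
  refine ⟨u ⬝ᵥ G u + A * B * C * γ,
    -(v ⬝ᵥ G u) + v ⬝ᵥ G 0 - (A * B * C' + A * B' * C + A' * B * C) * γ,
    (A * B' * C' + A' * B * C' + A' * B' * C) * γ, fun t => ?_⟩
  rw [hG]
  have h1 := h u (t • v)
  have h0 := h 0 (t • v)
  change _ ⬝ᵥ (G _ - G _) = _ at h1 h0
  simp only [zero_sub, dotProduct_sub, sub_dotProduct, smul_dotProduct, dotProduct_smul,
    neg_dotProduct, dotProduct_neg, smul_eq_mul] at h1 h0
  linear_combination h1 - h0

lemma exists_eval_eq_dotProduct {n : ℕ} {R : Type*} [CommRing R] {L : MvPolynomial (Fin n) R}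
    (hL : L.IsHomogeneous 1) (hL0 : L ≠ 0) :
    ∃ b : Fin n → R, b ≠ 0 ∧ ∀ x, eval x L = b ⬝ᵥ x := by
  have hmem : L ∈ homogeneousSubmodule (Fin n) R 1 := hL
  rw [homogeneousSubmodule_one_eq_span_X, Submodule.mem_span_range_iff_exists_fun] at hmem
  obtain ⟨b, rfl⟩ := hmem
  refine ⟨b, ?_, fun x => by simp [dotProduct, smul_eval]⟩
  rintro rfl
  simp at hL0

end Homogeneous

section Frobenius

variable {F K : Type*} [Field F] [Fintype F] [Field K] [Algebra F K]

lemma exists_algebraMap_eq_of_pow_card_eq {x : K} (hx : x ^ Fintype.card F = x) :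
    ∃ c : F, algebraMap F K c = x := by
  have hprod : ∏ c : F, (Polynomial.X - Polynomial.C c)
      = (Polynomial.X ^ Fintype.card F - Polynomial.X : Polynomial F) := by
    have hdeg := FiniteField.X_pow_card_sub_X_natDegree_eq F (Fintype.one_lt_card (α := F))
    have hmonic : (Polynomial.X ^ Fintype.card F - Polynomial.X : Polynomial F).Monic :=
      Polynomial.monic_X_pow_sub (by
        rw [Polynomial.degree_X]
        exact_mod_cast Fintype.one_lt_card (α := F))
    have := Polynomial.prod_multiset_X_sub_C_of_monic_of_roots_card_eq hmonic (by
      rw [hdeg, FiniteField.roots_X_pow_card_sub_X]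
      rfl)
    rwa [FiniteField.roots_X_pow_card_sub_X] at this
  have := congrArg (Polynomial.aeval x) hprod
  simp only [map_prod, map_sub, Polynomial.aeval_X, Polynomial.aeval_C, map_pow, hx,
    sub_self] at this
  obtain ⟨c, -, hc⟩ := Finset.prod_eq_zero_iff.1 this
  exact ⟨c, (sub_eq_zero.1 hc).symm⟩

lemma exists_smul_algebraMap_of_cross_eq_zero {x : Fin 3 → K} (hx : x ≠ 0)
    (h : (fun i => x i ^ Fintype.card F) ⨯₃ x = 0) :
    ∃ (w : Fin 3 → F) (r : K), w ≠ 0 ∧ r ≠ 0 ∧ x = r • fun i => algebraMap F K (w i) := by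
  obtain ⟨r, hr⟩ := exists_eq_smul_of_cross_eq_zero hx h
  obtain ⟨j, hj⟩ := Function.ne_iff.1 hx
  simp only [Pi.zero_apply] at hj
  have hr' : ∀ i, x i ^ Fintype.card F = r * x i := fun i => congrFun hr i
  have hr0 : r ≠ 0 := by
    rintro rfl
    have := hr' j
    rw [zero_mul] at this
    exact hj (pow_eq_zero_iff (Fintype.card_ne_zero) |>.1 this)
  have hfix : ∀ i, ∃ c : F, algebraMap F K c = x i / x j := fun i => by
    refine exists_algebraMap_eq_of_pow_card_eq ?_
    rw [div_pow, hr', hr', mul_div_mul_left _ _ hr0]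
  choose w hw using hfix
  have hxw : x = x j • fun i => algebraMap F K (w i) := by
    ext i
    simp only [Pi.smul_apply, smul_eq_mul, hw]
    field_simp
  refine ⟨w, x j, ?_, hj, hxw⟩
  rintro rfl
  apply hx
  rw [hxw]
  ext i
  simp

/-- If the coordinates of `a` are linearly independent over `F`, then `a` and its first two
Frobenius conjugates are linearly independent. -/
lemma triple_product_frobenius_ne_zero [Algebra.IsAlgebraic F K] {a : Fin 3 → K}
    (ha : ∀ w : Fin 3 → F, w ≠ 0 → a ⬝ᵥ (fun i => algebraMap F K (w i)) ≠ 0) :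
    a ⬝ᵥ (fun i => FiniteField.frobeniusAlgEquivOfAlgebraic F K (a i)) ⨯₃
      (fun i => FiniteField.frobeniusAlgEquivOfAlgebraic F K
        (FiniteField.frobeniusAlgEquivOfAlgebraic F K (a i))) ≠ 0 := by
  set φ := FiniteField.frobeniusAlgEquivOfAlgebraic F K
  have hφ : ∀ x, x ^ Fintype.card F = φ x := fun x => rfl
  set b := fun i => φ (a i) with hb
  set c := fun i => φ (φ (a i)) with hc
  intro hd
  have ha0 : a ≠ 0 := by
    rintro rfl
    exact ha 1 one_ne_zero (zero_dotProduct _)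
  have hab : a ⨯₃ b ≠ 0 := by
    intro hab
    obtain ⟨w, r, hw, -, hr⟩ := exists_smul_algebraMap_of_cross_eq_zero (F := F) ha0
      (by change b ⨯₃ a = 0; rw [← cross_anticomm, hab, neg_zero])
    -- a nonzero `F`-vector orthogonal to `w`
    obtain ⟨z, hz, hwz⟩ : ∃ z : Fin 3 → F, z ≠ 0 ∧ w ⬝ᵥ z = 0 := by
      by_cases h0 : w 0 = 0
      · refine ⟨![1, 0, 0], fun h => ?_, by simp [dotProduct, Fin.sum_univ_three, h0]⟩
        simpa using congrFun h 0
      · refine ⟨![-w 1, w 0, 0], fun h => h0 ?_, ?_⟩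
        · simpa using congrFun h 1
        · simp only [dotProduct, Fin.sum_univ_three, Matrix.cons_val_zero, Matrix.cons_val_one, Matrix.cons_val]
          ring
    refine ha z hz ?_
    rw [hr, smul_dotProduct]
    have : (fun i => algebraMap F K (w i)) ⬝ᵥ (fun i => algebraMap F K (z i))
        = algebraMap F K (w ⬝ᵥ z) := by simp [dotProduct]
    rw [this, hwz, map_zero, smul_zero]
  have hφab : (fun i => (a ⨯₃ b) i ^ Fintype.card F) = b ⨯₃ c := by
    ext i
    rw [hφ]
    fin_cases i <;> simp [cross_apply, hb, hc]
  obtain ⟨w, r, hw, hr0, hr⟩ := exists_smul_algebraMap_of_cross_eq_zero (F := F) hab (by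
    rw [hφab]
    have : (b ⨯₃ c) ⨯₃ (a ⨯₃ b) = -((a ⬝ᵥ b ⨯₃ c) • b) := by
      ext i
      fin_cases i <;> simp [cross_apply, dotProduct, Fin.sum_univ_three] <;> ring
    rw [this, hd, zero_smul, neg_zero])
  refine ha w hw ?_
  have := dot_self_cross a b
  rw [hr, dotProduct_smul, smul_eq_mul] at this
  exact (mul_eq_zero.1 this).resolve_left hr0

end Frobenius


section Split

variable {F K : Type*} [Field F] [Field K] [Algebra F K]

lemma vanishing_frobenius (φ : K ≃ₐ[F] K) (g : Fin 3 → MvPolynomial (Fin 3) F) {a : Fin 3 → K}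
    (h : ∀ v y : Fin 3 → K, (v + a ⨯₃ y - v) ⬝ᵥ
      ((fun i => aeval v (g i)) - fun i => aeval (v + a ⨯₃ y) (g i)) = 0) (v y : Fin 3 → K) :
    (v + (fun i => φ (a i)) ⨯₃ y - v) ⬝ᵥ
      ((fun i => aeval v (g i)) - fun i => aeval (v + (fun i => φ (a i)) ⨯₃ y) (g i)) = 0 := by
  obtain ⟨v, rfl⟩ : ∃ v', (fun i => φ (v' i)) = v := ⟨fun i => φ.symm (v i), by simp⟩
  obtain ⟨y, rfl⟩ : ∃ y', (fun i => φ (y' i)) = y := ⟨fun i => φ.symm (y i), by simp⟩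
  have hpt : (fun i => φ (v i)) + (fun i => φ (a i)) ⨯₃ (fun i => φ (y i))
      = fun i => φ ((v + a ⨯₃ y) i) := by
    ext i
    fin_cases i <;> simp [cross_apply]
  have hev : ∀ (p : MvPolynomial (Fin 3) F) (x : Fin 3 → K),
      aeval (fun i => φ (x i)) p = φ (aeval x p) :=
    fun p x => (comp_aeval_apply x (φ : K →ₐ[F] K) p).symm
  rw [hpt]
  have := congrArg φ (h v y)
  simpa only [dotProduct, map_sum, map_mul, map_sub, Pi.sub_apply, map_zero, hev] using this

lemma exists_univ_eq_insert {i j k : Fin 4} (hij : i ≠ j) (hik : i ≠ k) (hjk : j ≠ k) :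
    ∃ l, i ≠ l ∧ j ≠ l ∧ k ≠ l ∧ (Finset.univ : Finset (Fin 4)) = {i, j, k, l} := by
  obtain ⟨l, -, hl⟩ := Finset.exists_mem_notMem_of_card_lt_card
    (s := ({i, j, k} : Finset (Fin 4))) (t := Finset.univ) (by simp [hij, hik, hjk])
  simp only [Finset.mem_insert, Finset.mem_singleton, not_or] at hl
  obtain ⟨hil, hjl, hkl⟩ := hl
  refine ⟨l, Ne.symm hil, Ne.symm hjl, Ne.symm hkl, (Finset.eq_univ_of_card _ ?_).symm⟩
  simp [hij, hik, hjk, Ne.symm hil, Ne.symm hjl, Ne.symm hkl]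

/-- If `(u - v) ⬝ᵥ (g v - g u)`, with `g` of degree three over a finite field, is a product of four
affine factors over an algebraically closed extension, then it vanishes at a rational point
`(w, 0)` with `w ≠ 0`. -/
lemma exists_rational_zero_of_split [Fintype F] [IsAlgClosed K] [Algebra.IsAlgebraic F K]
    (g : Fin 3 → MvPolynomial (Fin 3) F) (hg : ∀ i, (g i).totalDegree ≤ 3)
    (hg3 : ∃ i, (g i).totalDegree = 3) (α β : Fin 4 → Fin 3 → K) (γ : Fin 4 → K)
    (hne : ∀ i, γ i = 0 → β i = -α i → α i ≠ 0)
    (hfac : ∀ u v : Fin 3 → K, (u - v) ⬝ᵥ ((fun i => aeval v (g i)) - fun i => aeval u (g i))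
      = ∏ i, (γ i + α i ⬝ᵥ u + β i ⬝ᵥ v)) :
    ∃ w : Fin 3 → F, w ≠ 0 ∧ w ⬝ᵥ ((fun i => eval 0 (g i)) - fun i => eval w (g i)) = 0 := by
  by_contra! hno
  have : Infinite K := IsAlgClosed.instInfinite
  obtain ⟨i, hγi, hβi, -⟩ := exists_factor_of_vanishing α β γ 0 fun v y => by
    rw [← hfac]
    simp
  have hαi := hne i hγi hβi
  set a := α i with ha
  have hindep : ∀ w : Fin 3 → F, w ≠ 0 → a ⬝ᵥ (fun i => algebraMap F K (w i)) ≠ 0 := by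
    intro w hw haw
    have h0 := hfac (fun i => algebraMap F K (w i)) 0
    rw [Finset.prod_eq_zero (Finset.mem_univ i) (by
      rw [hγi, ← ha, haw, dotProduct_zero, add_zero, add_zero])] at h0
    refine hno w hw ((algebraMap F K).injective ?_)
    have hev : ∀ (p : MvPolynomial (Fin 3) F) (x : Fin 3 → F),
        aeval (fun i => algebraMap F K (x i)) p = algebraMap F K (eval x p) :=
      fun p x => aeval_algebraMap_apply K x p
    have hev0 : ∀ p : MvPolynomial (Fin 3) F, aeval (0 : Fin 3 → K) p
        = algebraMap F K (eval 0 p) := fun p => by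
      rw [← hev]
      congr 1
      simp [Pi.zero_def]
    simpa only [dotProduct, hev, hev0, Pi.sub_apply, Pi.zero_apply, sub_zero, map_sum, map_mul,
      map_sub, map_zero] using h0
  have hvan : ∀ v y : Fin 3 → K, (v + a ⨯₃ y - v) ⬝ᵥ
      ((fun i => aeval v (g i)) - fun i => aeval (v + a ⨯₃ y) (g i)) = 0 := by
    intro v y
    rw [hfac]
    refine Finset.prod_eq_zero (Finset.mem_univ i) ?_
    rw [hγi, hβi, ← ha, dotProduct_add, dot_self_cross, neg_dotProduct]
    ring
  have hdet := triple_product_frobenius_ne_zero hindep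
  set φ := FiniteField.frobeniusAlgEquivOfAlgebraic F K
  have hvan' := vanishing_frobenius φ g hvan
  have hvan'' := vanishing_frobenius φ g hvan'
  set b := fun i => φ (a i) with hb
  set c := fun i => φ (b i) with hc
  change a ⬝ᵥ b ⨯₃ c ≠ 0 at hdet
  have hb0 : b ≠ 0 := fun h => hdet (by simp [h])
  have hc0 : c ≠ 0 := fun h => hdet (by simp [h])
  obtain ⟨j, hγj, hβj, hj⟩ := exists_factor_of_vanishing α β γ b fun v y => by
    rw [← hfac, hvan']
  obtain ⟨k, hγk, hβk, hk⟩ := exists_factor_of_vanishing α β γ c fun v y => by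
    rw [← hfac, hvan'']
  obtain ⟨r, hr⟩ := exists_eq_smul_of_cross_eq_zero hb0 hj
  obtain ⟨s, hs⟩ := exists_eq_smul_of_cross_eq_zero hc0 hk
  have hr0 : r ≠ 0 := by
    rintro rfl
    exact hne j hγj hβj (by rw [hr, zero_smul])
  have hs0 : s ≠ 0 := by
    rintro rfl
    exact hne k hγk hβk (by rw [hs, zero_smul])
  have hdet' : α i ⬝ᵥ α j ⨯₃ α k ≠ 0 := by
    rw [hr, hs, ← ha]
    simpa [hr0, hs0] using hdet
  have hij : i ≠ j := by
    rintro rfl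
    exact hdet' (dot_self_cross _ _)
  have hik : i ≠ k := by
    rintro rfl
    exact hdet' (dot_cross_self _ _)
  have hjk : j ≠ k := by
    rintro rfl
    exact hdet' (by rw [cross_self, dotProduct_zero])
  obtain ⟨l, hil, hjl, hkl, huniv⟩ := exists_univ_eq_insert hij hik hjk
  have hfac' : ∀ u v : Fin 3 → K,
      (u - v) ⬝ᵥ ((fun i => aeval v (g i)) - fun i => aeval u (g i))
      = (α i ⬝ᵥ (u - v)) * (α j ⬝ᵥ (u - v)) * (α k ⬝ᵥ (u - v))
        * (γ l + α l ⬝ᵥ u + β l ⬝ᵥ v) := by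
    intro u v
    rw [hfac, huniv, Finset.prod_insert (by simp [hij, hik, hil]),
      Finset.prod_insert (by simp [hjk, hjl]), Finset.prod_insert (by simp [hkl]),
      Finset.prod_singleton, hγi, hγj, hγk, hβi, hβj, hβk, ← ha]
    simp only [dotProduct_sub, neg_dotProduct]
    ring
  obtain ⟨hαl, hβl⟩ := coeffs_eq_zero_of_factor (fun x i => aeval x (g i)) hdet' hfac'
  obtain ⟨m, hm⟩ := hg3
  refine totalDegree_ne_three_of_factor (a := α i) (b := α j) (c := α k) (γ := γ l) g hg (fun u v => ?_) m hm
  rw [hfac', hαl, hβl, zero_dotProduct, zero_dotProduct, add_zero, add_zero]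

end Split

/-- Theorem 5.1 of the paper: if the degree-4 homogenization of `F` splits
into four hyperplanes over the algebraic closure, then `O_7(f1,f2,f3)` is not an ovoid. -/
theorem statement2 {q : ℕ} (Fq : Type*) [Field Fq] [Fintype Fq]
    (hcard : Fintype.card Fq = q)
    (hq : (6.3 : ℝ) * (4 : ℝ) ^ ((13 : ℝ) / 3) < (q : ℝ))
    (f1 f2 f3 : MvPolynomial (Fin 3) Fq)
    (h01 : eval (fun _ => (0 : Fq)) f1 = 0)
    (h02 : eval (fun _ => (0 : Fq)) f2 = 0)
    (h03 : eval (fun _ => (0 : Fq)) f3 = 0)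
    (hdeg : max (max f1.totalDegree f2.totalDegree) f3.totalDegree = 3)
    (hsplit : ∃ Fstar : MvPolynomial (Fin 7) Fq,
      Fstar.IsHomogeneous 4 ∧
      aeval (Matrix.vecCons (1 : MvPolynomial (Fin 6) Fq) X) Fstar = polyF f1 f2 f3 ∧
      ∃ L1 L2 L3 L4 : MvPolynomial (Fin 7) (AlgebraicClosure Fq),
        L1.IsHomogeneous 1 ∧ L1 ≠ 0 ∧ L2.IsHomogeneous 1 ∧ L2 ≠ 0 ∧
        L3.IsHomogeneous 1 ∧ L3 ≠ 0 ∧ L4.IsHomogeneous 1 ∧ L4 ≠ 0 ∧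
        MvPolynomial.map (algebraMap Fq (AlgebraicClosure Fq)) Fstar = L1 * L2 * L3 * L4) :
    ¬ ovoidCondition (fun x y z => eval ![x, y, z] f1)
        (fun x y z => eval ![x, y, z] f2)
        (fun x y z => eval ![x, y, z] f3) := by
  obtain ⟨Fstar, -, haff, L1, L2, L3, L4, hL1, hL1', hL2, hL2', hL3, hL3', hL4, hL4', hprod⟩ :=
    hsplit
  let K := AlgebraicClosure Fq
  obtain ⟨b1, hb1, hev1⟩ := exists_eval_eq_dotProduct hL1 hL1'
  obtain ⟨b2, hb2, hev2⟩ := exists_eval_eq_dotProduct hL2 hL2'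
  obtain ⟨b3, hb3, hev3⟩ := exists_eval_eq_dotProduct hL3 hL3'
  obtain ⟨b4, hb4, hev4⟩ := exists_eval_eq_dotProduct hL4 hL4'
  let b : Fin 4 → Fin 7 → K := ![b1, b2, b3, b4]
  have hb : ∀ i, b i ≠ 0 := by
    intro i
    fin_cases i <;> assumption
  let g : Fin 3 → MvPolynomial (Fin 3) Fq := ![f3, f2, f1]
  obtain ⟨w, hw, hzero⟩ := exists_rational_zero_of_split (K := K) g
    (by
      intro i
      fin_cases i <;> simp only [g] <;> simp <;> omega)
    (by
      rcases max_choice (max f1.totalDegree f2.totalDegree) f3.totalDegree with h | h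
      · rcases max_choice f1.totalDegree f2.totalDegree with h' | h'
        · exact ⟨2, by simp only [g]; simp; omega⟩
        · exact ⟨1, by simp only [g]; simp; omega⟩
      · exact ⟨0, by simp only [g]; simp; omega⟩)
    (fun i => ![b i 1, b i 2, b i 3]) (fun i => ![b i 4, b i 5, b i 6]) (fun i => b i 0)
    (by
      intro i h0 hβ hα
      rw [hα, neg_zero] at hβ
      refine hb i (funext fun j => ?_)
      fin_cases j
      · exact h0
      · exact congrFun hα 0
      · exact congrFun hα 1
      · exact congrFun hα 2
      · exact congrFun hβ 0
      · exact congrFun hβ 1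
      · exact congrFun hβ 2)
    (by
      intro u v
      have h1 : aeval ![u 0, u 1, u 2, v 0, v 1, v 2] (polyF f1 f2 f3)
          = ∏ i, b i ⬝ᵥ ![1, u 0, u 1, u 2, v 0, v 1, v 2] := by
        rw [← haff, comp_aeval_apply]
        have hpt : (fun i => aeval ![u 0, u 1, u 2, v 0, v 1, v 2]
            ((Matrix.vecCons (1 : MvPolynomial (Fin 6) Fq) X : Fin 7 → _) i))
            = ![1, u 0, u 1, u 2, v 0, v 1, v 2] := by
          ext i
          refine Fin.cases ?_ (fun i => ?_) i
          · simp
          · simp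
        rw [hpt, aeval_def, ← eval_map, hprod]
        simp [b, Fin.prod_univ_four, hev1, hev2, hev3, hev4]
      have hu : (fun i => aeval ![u 0, u 1, u 2, v 0, v 1, v 2]
          ((![X 0, X 1, X 2] : Fin 3 → MvPolynomial (Fin 6) Fq) i)) = u := by
        ext i
        fin_cases i <;> simp
      have hv : (fun i => aeval ![u 0, u 1, u 2, v 0, v 1, v 2]
          ((![X 3, X 4, X 5] : Fin 3 → MvPolynomial (Fin 6) Fq) i)) = v := by
        ext i
        fin_cases i <;> simp
      have h2 : aeval ![u 0, u 1, u 2, v 0, v 1, v 2] (polyF f1 f2 f3)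
          = (u - v) ⬝ᵥ ((fun i => aeval v (g i)) - fun i => aeval u (g i)) := by
        simp only [polyF, map_add, map_sub, map_mul, comp_aeval_apply, hu, hv, aeval_X]
        simp [dotProduct, Fin.sum_univ_three, g]
      rw [← h2, h1]
      refine Finset.prod_congr rfl fun i _ => ?_
      simp [dotProduct, Fin.sum_univ_succ]
      ring)
  intro hov
  have hvec : ![w 0, w 1, w 2] = w := by
    ext i
    fin_cases i <;> rfl
  have hvec0 : ![(0 : Fq), 0, 0] = 0 := by
    ext i
    fin_cases i <;> rfl
  refine hov (w 0) (w 1) (w 2) 0 0 0 (fun h => hw ?_) ?_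
  · simp only [Prod.mk.injEq] at h
    rw [← hvec, h.1, h.2.1, h.2.2, hvec0]
  · simp only [hvec, hvec0, sub_zero]
    simpa only [dotProduct, Fin.sum_univ_three, Pi.sub_apply, g, Matrix.cons_val_zero,
      Matrix.cons_val_one, Matrix.cons_val] using hzero
end

section
/- Let q = 2^h (h ≥ 1), let F_q be the field with q elements and L a field extension of F_q with q^3 elements, and let α, β ∈ L be such that {1, α, β} is an F_q-basis of L. Set T(u) = u + u^q + u^(q^2) and N(u) = u^(1+q+q^2), and define f1, f2, f3 : F_q^3 → L by f1(x,y,z) = T(αβ^q + αβ^(q^2))·xy + T(β)·x^2 + T(α^(q+1)β^(q^2))·y^2 + N(β)·z^2, f2(x,y,z) = T(αβ^q + αβ^(q^2))·xz + T(α)·x^2 + N(α)·y^2 + T(αβ^(q+q^2))·z^2, f3(x,y,z) = T(αβ^q + αβ^(q^2))·yz + x^2 + T(α^(q+1))·y^2 + T(β^(q+1))·z^2. Then for all x, y, z ∈ F_q, writing t = x + yα + zβ, one has N(t) = t^(1+q+q^2) = x·f3(x,y,z) + y·f2(x,y,z) + z·f1(x,y,z) in L. -/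
/-- Relative trace `T(u) = u + u^q + u^(q^2)` from `F_{q^3}` to `F_q`. -/
def trq (q : ℕ) {L : Type*} [CommRing L] (u : L) : L := u + u ^ q + u ^ q ^ 2

/-- Section 3.1 of the paper: the Kantor ovoid for `q = 2^h` is
parameterized by the degree-2 polynomials `f1, f2, f3`: for `t = x + yα + zβ`,
`N(t) = x·f3(x,y,z) + y·f2(x,y,z) + z·f1(x,y,z)`. -/
theorem statement6 {h q : ℕ} (hh : 1 ≤ h) (hq : q = 2 ^ h)
    (Fq : Type*) [Field Fq] [Fintype Fq] (hcardq : Fintype.card Fq = q)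
    (L : Type*) [Field L] [Fintype L] [Algebra Fq L] (hcardL : Fintype.card L = q ^ 3)
    (α β : L)
    (hbasis : LinearIndependent Fq ![(1 : L), α, β] ∧
      Submodule.span Fq (Set.range ![(1 : L), α, β]) = ⊤)
    (f1 f2 f3 : Fq → Fq → Fq → L)
    (hf1 : ∀ x y z : Fq, f1 x y z =
      trq q (α * β ^ q + α * β ^ q ^ 2) * algebraMap Fq L (x * y) +
        trq q β * algebraMap Fq L (x ^ 2) +
        trq q (α ^ (q + 1) * β ^ q ^ 2) * algebraMap Fq L (y ^ 2) +
        β ^ (1 + q + q ^ 2) * algebraMap Fq L (z ^ 2))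
    (hf2 : ∀ x y z : Fq, f2 x y z =
      trq q (α * β ^ q + α * β ^ q ^ 2) * algebraMap Fq L (x * z) +
        trq q α * algebraMap Fq L (x ^ 2) +
        α ^ (1 + q + q ^ 2) * algebraMap Fq L (y ^ 2) +
        trq q (α * β ^ (q + q ^ 2)) * algebraMap Fq L (z ^ 2))
    (hf3 : ∀ x y z : Fq, f3 x y z =
      trq q (α * β ^ q + α * β ^ q ^ 2) * algebraMap Fq L (y * z) +
        algebraMap Fq L (x ^ 2) +
        trq q (α ^ (q + 1)) * algebraMap Fq L (y ^ 2) +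
        trq q (β ^ (q + 1)) * algebraMap Fq L (z ^ 2)) :
    ∀ x y z : Fq,
      (algebraMap Fq L x + algebraMap Fq L y * α + algebraMap Fq L z * β) ^ (1 + q + q ^ 2) =
        algebraMap Fq L x * f3 x y z + algebraMap Fq L y * f2 x y z +
          algebraMap Fq L z * f1 x y z := by
  have : Fact (Nat.Prime 2) := ⟨Nat.prime_two⟩
  have hchar : CharP L 2 := charP_of_card_eq_prime_pow (f := h * 3) (by
    rw [hcardL, hq, pow_mul])
  have add_pow_q (u v : L) : (u + v) ^ q = u ^ q + v ^ q := by
    rw [hq, add_pow_char_pow]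
  have pow_q_sq (u : L) : u ^ q ^ 2 = (u ^ q) ^ q := by rw [pow_two, pow_mul]
  have pow_q_cube (u : L) : ((u ^ q) ^ q) ^ q = u := by
    rw [← pow_mul, ← pow_mul, ← pow_three, ← hcardL, FiniteField.pow_card]
  have algebraMap_pow_q (c : Fq) : algebraMap Fq L c ^ q = algebraMap Fq L c := by
    rw [← map_pow, ← hcardq, FiniteField.pow_card]
  intro x y z
  simp only [hf1, hf2, hf3, trq, pow_add, pow_one, map_mul, map_pow, pow_q_sq, add_pow_q,
    mul_pow, pow_q_cube, algebraMap_pow_q]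
  linear_combination (-algebraMap Fq L x * algebraMap Fq L y * algebraMap Fq L z *
    (α * β ^ q + α * (β ^ q) ^ q + α ^ q * β + α ^ q * (β ^ q) ^ q + (α ^ q) ^ q * β +
      (α ^ q) ^ q * β ^ q)) * CharTwo.two_eq_zero (R := L)
end

section
/- Let q = 2^h (h ≥ 1), let F_q be the field with q elements and L a field extension of F_q with q^3 elements, and set T(u) = u + u^q + u^(q^2) and N(u) = u^(1+q+q^2). Then for all distinct t, s ∈ L one has N(t) + N(s) + T(t·s^(q+q^2) + s·t^(q+q^2)) ≠ 0. (Equivalently, the points of the Kantor set {(0,0,0,1)} ∪ {(1, t, t^(q+q^2), N(t)) : t ∈ L} ⊆ F_q ⊕ L ⊕ L ⊕ F_q are pairwise non-orthogonal with respect to the bilinear form of Q((a,γ,δ,d)) = ad + T(γδ), i.e., the Kantor set is an ovoid of this hyperbolic quadric.) -/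
/-- Section 3.1 of the paper: the Kantor set
`{(0,0,0,1)} ∪ {(1, t, t^(q+q^2), N(t)) : t ∈ F_{q^3}}` is an ovoid of the hyperbolic quadric
`Q((a,γ,δ,d)) = ad + T(γδ)` for `q = 2^h`: distinct points `t ≠ s` are non-orthogonal. -/
theorem statement7 {h q : ℕ} (hh : 1 ≤ h) (hq : q = 2 ^ h)
    (Fq : Type*) [Field Fq] [Fintype Fq] (hcardq : Fintype.card Fq = q)
    (L : Type*) [Field L] [Fintype L] [Algebra Fq L] (hcardL : Fintype.card L = q ^ 3) :
    ∀ t s : L, t ≠ s →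
      t ^ (1 + q + q ^ 2) + s ^ (1 + q + q ^ 2) +
        trq q (t * s ^ (q + q ^ 2) + s * t ^ (q + q ^ 2)) ≠ 0 := by
  intro t s hts
  have hcard : Fintype.card L = 2 ^ (h * 3) := by rw [hcardL, hq, pow_mul]
  have : CharP L 2 := charP_of_card_eq_prime_pow hcard
  have : ExpChar L 2 := ExpChar.prime Nat.prime_two
  have hadd (u v : L) : (u + v) ^ q = u ^ q + v ^ q := by
    rw [hq, add_pow_expChar_pow]
  have hcube (u : L) : ((u ^ q) ^ q) ^ q = u := by
    rw [← pow_mul, ← pow_mul, ← pow_three, ← hcardL, FiniteField.pow_card]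
  have hprod : t ^ (1 + q + q ^ 2) + s ^ (1 + q + q ^ 2) +
      trq q (t * s ^ (q + q ^ 2) + s * t ^ (q + q ^ 2)) =
        (t + s) * (t + s) ^ q * ((t + s) ^ q) ^ q := by
    simp only [trq, sq q, pow_add, pow_mul, pow_one, hadd, mul_pow, hcube]
    ring
  rw [hprod]
  have hne : t + s ≠ 0 := fun h0 => hts (CharTwo.add_eq_zero.mp h0)
  exact mul_ne_zero (mul_ne_zero hne (pow_ne_zero _ hne)) (pow_ne_zero _ (pow_ne_zero _ hne))
end

section
/- Let q be an odd prime power with q ≡ 2 (mod 3), and define f1, f2, f3 : F_q^3 → F_q by f1(X,Y,Z) = -6XY - 3Y^3 - 9Z^3 - 9YZ^2 - 3Y^2Z, f2(X,Y,Z) = -Y^3 - 3YZ^2 + 6XZ + 3Y^2Z + 9Z^3, f3(X,Y,Z) = -3X - 3Y^2 - 9Z^2. Then the ovoid condition holds: for all distinct triples (x1,y1,z1), (x2,y2,z2) ∈ F_q^3, (x1-x2)(f3(x2,y2,z2)-f3(x1,y1,z1)) + (y1-y2)(f2(x2,y2,z2)-f2(x1,y1,z1)) + (z1-z2)(f1(x2,y2,z2)-f1(x1,y1,z1))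 ≠ 0; that is, O_7(f1,f2,f3) is an ovoid of Q (the Kantor ovoid for q ≡ 2 (mod 3), q odd). -/
theorem neg_three_ne_sq {F : Type*} [Field F] [Fintype F] (hodd : Odd (Fintype.card F))
    (hmod : Fintype.card F % 3 = 2) (s : F) : s ^ 2 ≠ -3 := by
  intro hs
  have hcard : ((Fintype.card F : ℕ) : F) = 0 := FiniteField.cast_card_eq_zero F
  have h2 : (2 : F) ≠ 0 := by
    intro h
    obtain ⟨k, hk⟩ := hodd
    rw [hk] at hcard
    push_cast at hcard
    rw [h] at hcard
    simp at hcard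
  have h3 : (3 : F) ≠ 0 := by
    intro h
    rw [← Nat.div_add_mod (Fintype.card F) 3, hmod] at hcard
    push_cast at hcard
    rw [h] at hcard
    simp [h2] at hcard
  -- A square root of `-3` yields a primitive cube root of unity.
  obtain ⟨w, hw⟩ : ∃ w : F, 2 * w = -1 + s := ⟨(-1 + s) / 2, by field_simp⟩
  have hw3 : w ^ 3 = 1 := by
    have h8 : (2 : F) ^ 3 * (w ^ 3 - 1) = 0 := by
      have hc : (2 * w) ^ 3 = (-1 + s) ^ 3 := by rw [hw]
      linear_combination hc + (s - 3) * hs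
    exact sub_eq_zero.mp ((mul_eq_zero.mp h8).resolve_left (pow_ne_zero 3 h2))
  have hw0 : w ≠ 0 := by
    rintro rfl
    simp at hw3
  have hw1 : w = 1 := by
    have hpow := FiniteField.pow_card_sub_one_eq_one w hw0
    have he : Fintype.card F - 1 = 3 * (Fintype.card F / 3) + 1 := by omega
    rwa [he, pow_succ, pow_mul, hw3, one_pow, one_mul] at hpow
  have hzero : (2 : F) ^ 2 * 3 = 0 := by
    rw [hw1] at hw
    linear_combination hs + (s + 3) * hw
  exact mul_ne_zero (pow_ne_zero 2 h2) h3 hzero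

theorem eq_zero_of_sq_add_three_mul_sq_eq_zero {F : Type*} [Field F]
    (hns : ∀ s : F, s ^ 2 ≠ -3) {r t : F} (h : r ^ 2 + 3 * t ^ 2 = 0) : r = 0 ∧ t = 0 := by
  have ht : t = 0 := by
    by_contra ht
    apply hns (r / t)
    field_simp
    linear_combination h
  subst ht
  exact ⟨by simpa using h, rfl⟩

/-- Section 3.3 of the paper: the Kantor ovoid for `q` odd,
`q ≡ 2 (mod 3)`, is an ovoid of `Q`. -/
theorem statement8 {q : ℕ} (hodd : Odd q) (hmod : q % 3 = 2)
    (Fq : Type*) [Field Fq] [Fintype Fq] (hcard : Fintype.card Fq = q)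
    (f1 f2 f3 : Fq → Fq → Fq → Fq)
    (hf1 : ∀ x y z : Fq, f1 x y z =
      -6 * x * y - 3 * y ^ 3 - 9 * z ^ 3 - 9 * y * z ^ 2 - 3 * y ^ 2 * z)
    (hf2 : ∀ x y z : Fq, f2 x y z =
      -y ^ 3 - 3 * y * z ^ 2 + 6 * x * z + 3 * y ^ 2 * z + 9 * z ^ 3)
    (hf3 : ∀ x y z : Fq, f3 x y z = -3 * x - 3 * y ^ 2 - 9 * z ^ 2) :
    ovoidCondition f1 f2 f3 := by
  subst hcard
  have hns := neg_three_ne_sq hodd hmod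
  have h2 : (2 : Fq) ≠ 0 := by
    intro h
    exact hns 1 (by linear_combination 2 * h)
  intro x1 y1 z1 x2 y2 z2 hne h0
  apply hne
  rw [hf1, hf1, hf2, hf2, hf3, hf3] at h0
  -- Four times the form is a sum `B ^ 2 + 3 * A ^ 2`.
  obtain ⟨hB, hA⟩ := eq_zero_of_sq_add_three_mul_sq_eq_zero hns
    (r := (y1 - y2) ^ 2 + 3 * (z1 - z2) ^ 2)
    (t := 2 * (x1 - x2) + ((y1 + y2) - (z1 + z2)) * (y1 - y2) +
      ((y1 + y2) + 3 * (z1 + z2)) * (z1 - z2))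
    (by linear_combination 4 * h0)
  obtain ⟨hy, hz⟩ := eq_zero_of_sq_add_three_mul_sq_eq_zero hns hB
  rw [hy, hz, mul_zero, mul_zero, add_zero, add_zero] at hA
  have hx := (mul_eq_zero.mp hA).resolve_left h2
  rw [sub_eq_zero.mp hx, sub_eq_zero.mp hy, sub_eq_zero.mp hz]
end

section
/- Let q = 2^h with h odd (equivalently, q even with q ≡ 2 (mod 3)), and define f1, f2, f3 : F_q^3 → F_q by f1(X,Y,Z) = Z^3 + Z^2·Y + Z·Y^2 + XY, f2(X,Y,Z) = Z^3 + Y^3 + XZ, f3(X,Y,Z) = X + Z^2 + ZY + Y^2. Then the ovoid condition holds: for all distinct triples (x1,y1,z1), (x2,y2,z2) ∈ F_q^3, (x1-x2)(f3(x2,y2,z2)-f3(x1,y1,z1)) + (y1-y2)(f2(x2,y2,z2)-f2(x1,y1,z1)) + (z1-z2)(f1(x2,y2,z2)-f1(x1,y1,z1)) ≠ 0; that is, O_7(f1,f2,f3) is an ovoid of Q (the Kantor ovoid for q ≡ 2 (mod 3), q even). -/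
/-- In a field of characteristic two whose order is `2` modulo `3`, the norm form
`u ^ 2 + u * v + v ^ 2` is anisotropic. -/
theorem eq_zero_of_sq_add_mul_add_sq_eq_zero {F : Type*} [Field F] [Fintype F]
    (h2 : (2 : F) = 0) (hq : Fintype.card F % 3 = 2) {u v : F}
    (huv : u ^ 2 + u * v + v ^ 2 = 0) : u = 0 ∧ v = 0 := by
  by_cases hu : u = 0
  · subst hu
    simpa using huv
  by_cases hv : v = 0
  · subst hv
    simpa using huv
  have hcube : u ^ 3 = v ^ 3 := by linear_combination (u - v) * huv
  have hpow (t : F) (ht : t ≠ 0) : (t ^ 3) ^ (Fintype.card F / 3) * t = 1 := by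
    apply mul_right_cancel₀ ht
    calc (t ^ 3) ^ (Fintype.card F / 3) * t * t
        = t ^ (3 * (Fintype.card F / 3) + Fintype.card F % 3) := by
          rw [hq, pow_add, pow_mul]; ring
      _ = 1 * t := by rw [Nat.div_add_mod, FiniteField.pow_card, one_mul]
  have hu1 := hpow u hu
  have hv1 := hpow v hv
  rw [hcube] at hu1
  have heq : u = v := mul_left_cancel₀ (left_ne_zero_of_mul_eq_one hv1) (hu1.trans hv1.symm)
  subst heq
  have hsq : u ^ 2 = 0 := by linear_combination huv - u ^ 2 * h2
  exact absurd (pow_eq_zero_iff two_ne_zero |>.mp hsq) hu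

/-- Section 3.3 of the paper: the Kantor ovoid for `q = 2^h`, `h` odd
(i.e. `q` even with `q ≡ 2 (mod 3)`), is an ovoid of `Q`. -/
theorem statement9 {h q : ℕ} (hodd : Odd h) (hq : q = 2 ^ h)
    (Fq : Type*) [Field Fq] [Fintype Fq] (hcard : Fintype.card Fq = q)
    (f1 f2 f3 : Fq → Fq → Fq → Fq)
    (hf1 : ∀ x y z : Fq, f1 x y z = z ^ 3 + z ^ 2 * y + z * y ^ 2 + x * y)
    (hf2 : ∀ x y z : Fq, f2 x y z = z ^ 3 + y ^ 3 + x * z)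
    (hf3 : ∀ x y z : Fq, f3 x y z = x + z ^ 2 + z * y + y ^ 2) :
    ovoidCondition f1 f2 f3 := by
  subst hq
  have hpos : h ≠ 0 := by rintro rfl; simp at hodd
  have h2 : (2 : Fq) = 0 := by
    have hc := FiniteField.cast_card_eq_zero Fq
    rw [hcard, Nat.cast_pow] at hc
    exact_mod_cast (pow_eq_zero_iff hpos).mp hc
  have hmod : Fintype.card Fq % 3 = 2 := by
    obtain ⟨k, rfl⟩ := hodd
    rw [hcard, pow_succ, pow_mul, Nat.mul_mod, Nat.pow_mod]
    simp
  intro x1 y1 z1 x2 y2 z2 hne hD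
  simp only [hf1, hf2, hf3] at hD
  obtain ⟨a, rfl⟩ : ∃ a, x2 = x1 + a := ⟨x2 - x1, by ring⟩
  obtain ⟨b, rfl⟩ : ∃ b, y2 = y1 + b := ⟨y2 - y1, by ring⟩
  obtain ⟨c, rfl⟩ : ∃ c, z2 = z1 + c := ⟨z2 - z1, by ring⟩
  have hform : (a + (b + c) * y1 + c * z1) ^ 2 +
      (a + (b + c) * y1 + c * z1) * (b ^ 2 + b * c + c ^ 2) +
      (b ^ 2 + b * c + c ^ 2) ^ 2 = 0 := by
    grind
  obtain ⟨hs, hN⟩ := eq_zero_of_sq_add_mul_add_sq_eq_zero h2 hmod hform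
  obtain ⟨rfl, rfl⟩ := eq_zero_of_sq_add_mul_add_sq_eq_zero h2 hmod hN
  apply hne
  have ha : a = 0 := by simpa using hs
  simp [ha]
end

section
/- Let F_q be the finite field with q elements and L a field extension of F_q with q^4 elements. Let α ∈ L with α ∉ F_q (i.e., α^q ≠ α). Then every β ∈ L satisfying (α^q - α)·β^(q^2) + (α - α^(q^2))·β^q + (α^(q^2) - α^q)·β = 0 is of the form β = λ1 + λ2·α for some λ1, λ2 ∈ F_q; in particular, 1, α, β are F_q-linearly dependent. -/
/-- An element of an extension of a finite field `K` that is fixed by `x ↦ x ^ #K` lies in `K`. -/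
theorem mem_range_algebraMap_of_pow_card_eq {K L : Type*} [Field K] [Fintype K] [Field L]
    [Algebra K L] {x : L} (hx : x ^ Fintype.card K = x) : x ∈ Set.range (algebraMap K L) := by
  have hsplits := Polynomial.splits_X_pow_nat_card_sub_X (K := K)
  rw [Nat.card_eq_fintype_card] at hsplits
  refine hsplits.mem_range_of_isRoot
    (FiniteField.X_pow_card_sub_X_ne_zero K Fintype.one_lt_card) ?_
  simp [hx]

/-- Section 5.1 of the paper: the roots in `F_{q^4}` of the linearized
polynomial `(α^q-α)X^(q^2) + (α-α^(q^2))X^q + (α^(q^2)-α^q)X` are exactly of the form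
`λ1 + λ2·α` with `λ1, λ2 ∈ F_q`; in particular `1, α, β` are `F_q`-linearly dependent. -/
theorem statement10 {q : ℕ} (Fq : Type*) [Field Fq] [Fintype Fq]
    (hcardq : Fintype.card Fq = q)
    (L : Type*) [Field L] [Fintype L] [Algebra Fq L] (hcardL : Fintype.card L = q ^ 4)
    (α : L) (hα : α ∉ Set.range (algebraMap Fq L)) :
    ∀ β : L,
      (α ^ q - α) * β ^ q ^ 2 + (α - α ^ q ^ 2) * β ^ q + (α ^ q ^ 2 - α ^ q) * β = 0 →
        (∃ lam1 lam2 : Fq, β = algebraMap Fq L lam1 + algebraMap Fq L lam2 * α) ∧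
          ¬ LinearIndependent Fq ![(1 : L), α, β] := by
  subst hcardq
  intro β hβ
  set φ := FiniteField.frobeniusAlgHom Fq L
  have hφ (x : L) : x ^ Fintype.card Fq = φ x := rfl
  have hα0 : φ α - α ≠ 0 := fun h ↦
    hα (mem_range_algebraMap_of_pow_card_eq (sub_eq_zero.mp h))
  simp only [pow_two (Fintype.card Fq), pow_mul, hφ] at hβ
  have hφα0 : φ (φ α) - φ α ≠ 0 := by rwa [← map_sub, map_ne_zero]
  obtain ⟨l, hl⟩ : (φ β - β) / (φ α - α) ∈ Set.range (algebraMap Fq L) := by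
    apply mem_range_algebraMap_of_pow_card_eq
    rw [hφ, map_div₀, map_sub, map_sub, div_eq_div_iff hφα0 hα0]
    linear_combination hβ
  rw [eq_div_iff hα0] at hl
  obtain ⟨m, hm⟩ : β - algebraMap Fq L l * α ∈ Set.range (algebraMap Fq L) := by
    apply mem_range_algebraMap_of_pow_card_eq
    rw [hφ, map_sub, map_mul, AlgHom.commutes]
    linear_combination -hl
  have hcomb : β = algebraMap Fq L m + algebraMap Fq L l * α := by
    linear_combination -hm
  refine ⟨⟨m, l, hcomb⟩, fun hind ↦ ?_⟩
  have h := Fintype.linearIndependent_iff.mp hind ![m, l, -1]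
    (by simp [Fin.sum_univ_three, Algebra.smul_def, ← hcomb]) 2
  simp at h
end

section
/- Let F_q be the finite field with q elements and f1, f2, f3 : F_q^3 → F_q with f_i(0,0,0) = 0. For (x,y,z) ∈ F_q^3 define the 4×4 skew-symmetric matrix M(x,y,z) over F_q with rows (0, x, -y, z), (-x, 0, f1(x,y,z), f2(x,y,z)), (y, -f1(x,y,z), 0, f3(x,y,z)), (-z, -f2(x,y,z), -f3(x,y,z), 0). Then the ovoid condition holds for f1, f2, f3 if and only if for all distinct triples P1 = (x1,y1,z1) and P2 = (x2,y2,z2) in F_q^3 the matrix M(P1) - M(P2) is invertible. (Thus O_7(f1,f2,f3) is an ovoid of Q if and only if {M(x,y,z) : x,y,z ∈ F_q} is a Kerdock set of q^3 skew-symmetric matrices of order 4, i.e., the difference of any two distinct matrices in the set has full rank.) -/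
/-- The skew-symmetric matrix associated with the point `(x,y,z)` (Section 3 of the paper). -/
def kerdockM {F : Type*} [Field F] (f1 f2 f3 : F → F → F → F) (x y z : F) :
    Matrix (Fin 4) (Fin 4) F :=
  !![0, x, -y, z;
     -x, 0, f1 x y z, f2 x y z;
     y, -(f1 x y z), 0, f3 x y z;
     -z, -(f2 x y z), -(f3 x y z), 0]

/-- The determinant of a `4×4` alternating matrix is the square of its Pfaffian. -/
theorem det_alternating_fin_four {R : Type*} [CommRing R] (a b c d e f : R) :
    (!![0, a, b, c; -a, 0, d, e; -b, -d, 0, f; -c, -e, -f, 0] : Matrix (Fin 4) (Fin 4) R).det =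
      (a * f - b * e + c * d) ^ 2 := by
  simp [Matrix.det_succ_row_zero, Fin.sum_univ_succ, Fin.succAbove]
  ring

theorem kerdockM_sub_det {F : Type*} [Field F] (f1 f2 f3 : F → F → F → F)
    (x1 y1 z1 x2 y2 z2 : F) :
    (kerdockM f1 f2 f3 x1 y1 z1 - kerdockM f1 f2 f3 x2 y2 z2).det =
      ((x1 - x2) * (f3 x2 y2 z2 - f3 x1 y1 z1) +
        (y1 - y2) * (f2 x2 y2 z2 - f2 x1 y1 z1) +
        (z1 - z2) * (f1 x2 y2 z2 - f1 x1 y1 z1)) ^ 2 := by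
  have h : kerdockM f1 f2 f3 x1 y1 z1 - kerdockM f1 f2 f3 x2 y2 z2 =
      !![0, x1 - x2, -(y1 - y2), z1 - z2;
        -(x1 - x2), 0, f1 x1 y1 z1 - f1 x2 y2 z2, f2 x1 y1 z1 - f2 x2 y2 z2;
        -(-(y1 - y2)), -(f1 x1 y1 z1 - f1 x2 y2 z2), 0, f3 x1 y1 z1 - f3 x2 y2 z2;
        -(z1 - z2), -(f2 x1 y1 z1 - f2 x2 y2 z2), -(f3 x1 y1 z1 - f3 x2 y2 z2), 0] := by
    ext i j
    fin_cases i <;> fin_cases j <;> simp [kerdockM] <;> ring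
  rw [h, det_alternating_fin_four]
  ring

/-- Section 3 of the paper: `O_7(f1,f2,f3)` is an ovoid of `Q` if and only
if `{M(x,y,z) : x,y,z ∈ F_q}` is a Kerdock set of `q^3` skew-symmetric `4×4` matrices. -/
theorem statement12 {F : Type*} [Field F] [Fintype F] (f1 f2 f3 : F → F → F → F)
    (h01 : f1 0 0 0 = 0) (h02 : f2 0 0 0 = 0) (h03 : f3 0 0 0 = 0) :
    ovoidCondition f1 f2 f3 ↔
      ∀ x1 y1 z1 x2 y2 z2 : F, (x1, y1, z1) ≠ (x2, y2, z2) →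
        IsUnit (kerdockM f1 f2 f3 x1 y1 z1 - kerdockM f1 f2 f3 x2 y2 z2) := by
  simp only [ovoidCondition, Matrix.isUnit_iff_isUnit_det, kerdockM_sub_det, isUnit_iff_ne_zero,
    ne_eq, pow_eq_zero_iff two_ne_zero]
end

section
/- Let q be an odd prime power with q ≡ 2 (mod 3), let F_{q^2} be a field extension of F_q with q^2 elements, and let ξ ∈ F_{q^2} satisfy ξ^2 = -3 (such ξ exists and ξ ∉ F_q since -3 is a nonsquare in F_q). Define f1(X,Y,Z) = -6XY - 3Y^3 - 9Z^3 - 9YZ^2 - 3Y^2Z, f2(X,Y,Z) = -Y^3 - 3YZ^2 + 6XZ + 3Y^2Z + 9Z^3, f3(X,Y,Z) = -3X - 3Y^2 - 9Z^2. Then for all x1, x2, x3, x4, x5, x6 ∈ F_q, with U = x1-x4, V = x2-x5, W = x3-x6, the following identity holds in F_{q^2}: (x1-x4)(f3(x4,x5,x6)-f3(x1,x2,x3)) + (x2-x5)(f2(x4,x5,x6)-f2(x1,x2,x3)) + (x3-x6)(f1(x4,x5,x6)-f1(x1,x2,x3)) = 3·(U + x5·W - x6·V + x5·V + 3x6·W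 + ((3-ξ)/6)·V^2 + ((3-ξ)/2)·W^2)·(U + x5·W - x6·V + x5·V + 3x6·W + ((3+ξ)/6)·V^2 + ((3+ξ)/2)·W^2). -/
/-- Section 3.3 of the paper, case `q` odd: factorization over `F_{q^2}`
of the ovoid-condition expression of the Kantor ovoid for `q ≡ 2 (mod 3)`, `q` odd. -/
theorem statement13 {q : ℕ} (hodd : Odd q) (hmod : q % 3 = 2)
    (Fq : Type*) [Field Fq] [Fintype Fq] (hcardq : Fintype.card Fq = q)
    (L : Type*) [Field L] [Fintype L] [Algebra Fq L] (hcardL : Fintype.card L = q ^ 2)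
    (ξ : L) (hξ : ξ ^ 2 = -3)
    (f1 f2 f3 : Fq → Fq → Fq → Fq)
    (hf1 : ∀ x y z : Fq, f1 x y z =
      -6 * x * y - 3 * y ^ 3 - 9 * z ^ 3 - 9 * y * z ^ 2 - 3 * y ^ 2 * z)
    (hf2 : ∀ x y z : Fq, f2 x y z =
      -y ^ 3 - 3 * y * z ^ 2 + 6 * x * z + 3 * y ^ 2 * z + 9 * z ^ 3)
    (hf3 : ∀ x y z : Fq, f3 x y z = -3 * x - 3 * y ^ 2 - 9 * z ^ 2) :
    ∀ x1 x2 x3 x4 x5 x6 : Fq,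
      algebraMap Fq L ((x1 - x4) * (f3 x4 x5 x6 - f3 x1 x2 x3) +
          (x2 - x5) * (f2 x4 x5 x6 - f2 x1 x2 x3) +
          (x3 - x6) * (f1 x4 x5 x6 - f1 x1 x2 x3)) =
        3 * (algebraMap Fq L (x1 - x4) + algebraMap Fq L x5 * algebraMap Fq L (x3 - x6)
              - algebraMap Fq L x6 * algebraMap Fq L (x2 - x5)
              + algebraMap Fq L x5 * algebraMap Fq L (x2 - x5)
              + 3 * algebraMap Fq L x6 * algebraMap Fq L (x3 - x6)
              + (3 - ξ) / 6 * algebraMap Fq L (x2 - x5) ^ 2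
              + (3 - ξ) / 2 * algebraMap Fq L (x3 - x6) ^ 2) *
            (algebraMap Fq L (x1 - x4) + algebraMap Fq L x5 * algebraMap Fq L (x3 - x6)
              - algebraMap Fq L x6 * algebraMap Fq L (x2 - x5)
              + algebraMap Fq L x5 * algebraMap Fq L (x2 - x5)
              + 3 * algebraMap Fq L x6 * algebraMap Fq L (x3 - x6)
              + (3 + ξ) / 6 * algebraMap Fq L (x2 - x5) ^ 2
              + (3 + ξ) / 2 * algebraMap Fq L (x3 - x6) ^ 2) := by
  have hq : (q : L) = 0 := by
    have h := FiniteField.cast_card_eq_zero L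
    rw [hcardL] at h
    push_cast at h
    exact pow_eq_zero_iff two_ne_zero |>.mp h
  have h2 : (2 : L) ≠ 0 := by
    intro h
    obtain ⟨k, rfl⟩ := hodd
    push_cast at hq
    exact one_ne_zero (by linear_combination hq - (k : L) * h : (1 : L) = 0)
  have h3 : (3 : L) ≠ 0 := by
    intro h
    obtain ⟨m, rfl⟩ : ∃ m, q = 3 * m + 2 := ⟨q / 3, by omega⟩
    push_cast at hq
    exact h2 (by linear_combination hq - (m : L) * h)
  have h6 : (6 : L) ≠ 0 := by
    have h : (6 : L) = 2 * 3 := by norm_num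
    exact h ▸ mul_ne_zero h2 h3
  intro x1 x2 x3 x4 x5 x6
  simp only [hf1, hf2, hf3, map_add, map_sub, map_mul, map_pow, map_neg, map_ofNat]
  generalize algebraMap Fq L x1 = a1
  generalize algebraMap Fq L x2 = a2
  generalize algebraMap Fq L x3 = a3
  generalize algebraMap Fq L x4 = a4
  generalize algebraMap Fq L x5 = a5
  generalize algebraMap Fq L x6 = a6
  obtain ⟨s, hs⟩ : ∃ s : L, 6 * s = (a2 - a5) ^ 2 + 3 * (a3 - a6) ^ 2 :=
    ⟨((a2 - a5) ^ 2 + 3 * (a3 - a6) ^ 2) / 6, by field_simp⟩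
  have key (t : L) : t / 6 * (a2 - a5) ^ 2 + t / 2 * (a3 - a6) ^ 2 = t * s := by
    have h : t / 2 = 3 * (t / 6) := by
      field_simp
      ring
    have ht : 6 * (t / 6) = t := by field_simp
    rw [h]
    linear_combination -(t / 6) * hs + s * ht
  rw [add_assoc _ ((3 - ξ) / 6 * _), key, add_assoc _ ((3 + ξ) / 6 * _), key]
  set B := a1 - a4 + a5 * (a3 - a6) - a6 * (a2 - a5) + a5 * (a2 - a5) + 3 * a6 * (a3 - a6)
    with hB
  have hprod : 3 * (B + (3 - ξ) * s) * (B + (3 + ξ) * s) =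
      3 * B ^ 2 + 3 * B * (6 * s) + (6 * s) ^ 2 := by
    linear_combination -3 * s ^ 2 * hξ
  rw [hprod, hs, hB]
  ring
end

section
/- Let q = 2^h with h odd (so q ≡ 2 (mod 3)), let F_{q^2} be a field extension of F_q with q^2 elements, and let ξ ∈ F_{q^2} \ F_q satisfy ξ^2 = 1 + ξ. Define f1(X,Y,Z) = Z^3 + Z^2·Y + Z·Y^2 + XY, f2(X,Y,Z) = Z^3 + Y^3 + XZ, f3(X,Y,Z) = X + Z^2 + ZY + Y^2. Then for all x1, x2, x3, x4, x5, x6 ∈ F_q, with U = x1+x4, V = x2+x5, W = x3+x6, the following identity holds in F_{q^2}: (x1-x4)(f3(x4,x5,x6)-f3(x1,x2,x3)) + (x2-x5)(f2(x4,x5,x6)-f2(x1,x2,x3)) + (x3-x6)(f1(x4,x5,x6)-f1(x1,x2,x3)) = (U + x5·(V+W) + x6·W + ξ·(V^2+VW+W^2))·(U + x2·(V+W) + x3·W + ξ·(V^2+VW+W^2)). -/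
/-- Section 3.3 of the paper, case `q` even: factorization over `F_{q^2}`
of the ovoid-condition expression of the Kantor ovoid for `q = 2^h`, `h` odd. -/
theorem statement14 {h q : ℕ} (hodd : Odd h) (hq : q = 2 ^ h)
    (Fq : Type*) [Field Fq] [Fintype Fq] (hcardq : Fintype.card Fq = q)
    (L : Type*) [Field L] [Fintype L] [Algebra Fq L] (hcardL : Fintype.card L = q ^ 2)
    (ξ : L) (hξ : ξ ∉ Set.range (algebraMap Fq L)) (hξ2 : ξ ^ 2 = 1 + ξ)
    (f1 f2 f3 : Fq → Fq → Fq → Fq)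
    (hf1 : ∀ x y z : Fq, f1 x y z = z ^ 3 + z ^ 2 * y + z * y ^ 2 + x * y)
    (hf2 : ∀ x y z : Fq, f2 x y z = z ^ 3 + y ^ 3 + x * z)
    (hf3 : ∀ x y z : Fq, f3 x y z = x + z ^ 2 + z * y + y ^ 2) :
    ∀ x1 x2 x3 x4 x5 x6 : Fq,
      algebraMap Fq L ((x1 - x4) * (f3 x4 x5 x6 - f3 x1 x2 x3) +
          (x2 - x5) * (f2 x4 x5 x6 - f2 x1 x2 x3) +
          (x3 - x6) * (f1 x4 x5 x6 - f1 x1 x2 x3)) =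
        (algebraMap Fq L (x1 + x4)
            + algebraMap Fq L x5 * (algebraMap Fq L (x2 + x5) + algebraMap Fq L (x3 + x6))
            + algebraMap Fq L x6 * algebraMap Fq L (x3 + x6)
            + ξ * (algebraMap Fq L (x2 + x5) ^ 2
                + algebraMap Fq L (x2 + x5) * algebraMap Fq L (x3 + x6)
                + algebraMap Fq L (x3 + x6) ^ 2)) *
          (algebraMap Fq L (x1 + x4)
            + algebraMap Fq L x2 * (algebraMap Fq L (x2 + x5) + algebraMap Fq L (x3 + x6))
            + algebraMap Fq L x3 * algebraMap Fq L (x3 + x6)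
            + ξ * (algebraMap Fq L (x2 + x5) ^ 2
                + algebraMap Fq L (x2 + x5) * algebraMap Fq L (x3 + x6)
                + algebraMap Fq L (x3 + x6) ^ 2)) := by
  have hcharFq : CharP Fq 2 := by
    have : Fact (Nat.Prime 2) := ⟨Nat.prime_two⟩
    exact charP_of_card_eq_prime_pow (f := h) (by rw [hcardq, hq])
  have : CharP L 2 := charP_of_injective_algebraMap (algebraMap Fq L).injective 2
  have h2 : (2 : L) = 0 := CharTwo.two_eq_zero
  intro x1 x2 x3 x4 x5 x6
  simp only [hf1, hf2, hf3, map_add, map_sub, map_mul, map_pow]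
  generalize algebraMap Fq L x1 = a1
  generalize algebraMap Fq L x2 = a2
  generalize algebraMap Fq L x3 = a3
  generalize algebraMap Fq L x4 = a4
  generalize algebraMap Fq L x5 = a5
  generalize algebraMap Fq L x6 = a6
  grind
end
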